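/- arXiv:2010.05053 — 3 statements merged into one kernel-verified Lean document; each statement's English description precedes it below -/
import Mathlib

section
/- For every d-dimensional polytope P and every integer k with 0 ≤ k ≤ d−1, the hypergraph H_k(P) — whose nodes are the k-faces of P and whose hyperedges are the (k+1)-faces of P (a hyperedge being incident to the k-faces it contains) — is strongly (d−k)-vertex connected. That is, for every set B of fewer than d−k k-faces of P and any two k-faces F, G of P not in B, there is a sequence F = F_0, F_1, …, F_m = G of k-faces of P, none belonging to B, such that for each i the faces F_i and F_{i+1} are both contained in a common (k+1)-face of P that contains no k-face from B. -/
open Set Classical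

/-- Points of `ℝ^N`. -/
abbrev Pt (N : ℕ) := EuclideanSpace ℝ (Fin N)

/-- A polytope: the convex hull of a finite set of points. -/
def IsPolytope {N : ℕ} (Q : Set (Pt N)) : Prop :=
  ∃ S : Set (Pt N), S.Finite ∧ Q = convexHull ℝ S

/-- Dimension of a subset of `ℝ^N`: the dimension of its affine span,
with the empty set having dimension `-1`. -/
noncomputable def faceDim {N : ℕ} (s : Set (Pt N)) : ℤ :=
  if s = ∅ then -1 else (Module.finrank ℝ (affineSpan ℝ s).direction : ℤ)

/-- A face of a polytope: an exposed subset (this includes `∅` and the polytope itself). -/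
def IsFaceOf {N : ℕ} (Q F : Set (Pt N)) : Prop :=
  IsExposed ℝ Q F

/-- A `k`-face: a face of dimension `k`. -/
def IsKFaceOf {N : ℕ} (k : ℕ) (Q F : Set (Pt N)) : Prop :=
  IsFaceOf Q F ∧ faceDim F = k

/-- A vertex: a point spanning a `0`-dimensional face. -/
def IsVertexOf {N : ℕ} (Q : Set (Pt N)) (v : Pt N) : Prop :=
  IsKFaceOf 0 Q {v}

/-- An affine hyperplane: the zero set of a nonconstant affine functional. -/
def IsHyperplane {N : ℕ} (H : Set (Pt N)) : Prop :=
  ∃ f : Pt N →ᵃ[ℝ] ℝ, f.linear ≠ 0 ∧ H = {x | f x = 0}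

open Module Submodule

section Config

variable {V : Type*} [AddCommGroup V] [Module ℝ V]

/-- Faces of a finite vector configuration. -/
def CFace (S F : Finset V) : Prop :=
  ∃ l : V →ₗ[ℝ] ℝ, (∀ s ∈ S, 0 ≤ l s) ∧ ∀ s, s ∈ F ↔ s ∈ S ∧ l s = 0

/-- Rank of a configuration. -/
noncomputable def rk (F : Finset V) : ℕ := finrank ℝ (span ℝ (F : Set V))

theorem CFace.subset {S F : Finset V} (h : CFace S F) : F ⊆ S := by
  obtain ⟨l, _, h2⟩ := h
  intro s hs
  exact ((h2 s).1 hs).1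

theorem CFace.restrict {S E F : Finset V} (h : CFace S E) (hEF : E ⊆ F) (hFS : F ⊆ S) :
    CFace F E := by
  obtain ⟨l, h1, h2⟩ := h
  refine ⟨l, fun s hs => h1 s (hFS hs), fun s => ⟨fun hs => ⟨hEF hs, ((h2 s).1 hs).2⟩, ?_⟩⟩
  rintro ⟨hs, h0⟩
  exact (h2 s).2 ⟨hFS hs, h0⟩

theorem CFace.trans {S F E : Finset V} (hF : CFace S F) (hE : CFace F E) : CFace S E := by
  have hFS := hF.subset
  obtain ⟨l, h1, h2⟩ := hF
  obtain ⟨m, h3, h4⟩ := hE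
  set K : ℝ := 1 + ∑ s ∈ S, |m s| / l s with hK
  have key : ∀ s ∈ S, s ∉ F → 0 < m s + K * l s := by
    intro s hs hsF
    have hl : 0 < l s := lt_of_le_of_ne (h1 s hs) (fun h => hsF ((h2 s).2 ⟨hs, h.symm⟩))
    have h5 : |m s| / l s ≤ ∑ s ∈ S, |m s| / l s :=
      Finset.single_le_sum (f := fun s => |m s| / l s)
        (fun t ht => div_nonneg (abs_nonneg _) (h1 t ht)) hs
    have h6 : |m s| / l s + 1 ≤ K := by linarith
    have h7 : (|m s| / l s + 1) * l s ≤ K * l s := mul_le_mul_of_nonneg_right h6 hl.le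
    have h8 : (|m s| / l s + 1) * l s = |m s| + l s := by field_simp
    have := neg_abs_le (m s)
    linarith
  refine ⟨m + K • l, ?_, ?_⟩
  · intro s hs
    by_cases hsF : s ∈ F
    · have := ((h2 s).1 hsF).2
      simpa [this] using h3 s hsF
    · simpa using (key s hs hsF).le
  · intro s
    constructor
    · intro hs
      obtain ⟨ha, hb⟩ := (h4 s).1 hs
      have := ((h2 s).1 ha).2
      exact ⟨hFS ha, by simp [this, hb]⟩
    · rintro ⟨hs, h0⟩
      by_cases hsF : s ∈ F
      · have := ((h2 s).1 hsF).2
        exact (h4 s).2 ⟨hsF, by simpa [this] using h0⟩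
      · have := key s hs hsF
        simp at h0
        linarith

theorem rk_mono {F G : Finset V} (h : F ⊆ G) : rk F ≤ rk G :=
  Submodule.finrank_mono (span_mono (by exact_mod_cast h))

theorem vanish_span {F : Set V} {f : V →ₗ[ℝ] ℝ} (h : ∀ s ∈ F, f s = 0) :
    ∀ s ∈ span ℝ F, f s = 0 := by
  have : span ℝ F ≤ LinearMap.ker f := span_le.2 fun s hs => h s hs
  exact fun s hs => this hs

theorem CFace.eq_of_rk {S F G : Finset V} (hF : CFace S F) (hG : G ⊆ S) (h : F ⊆ G)
    (hr : rk G ≤ rk F) : F = G := by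
  obtain ⟨l, h1, h2⟩ := hF
  refine Finset.Subset.antisymm h fun s hs => (h2 s).2 ⟨hG hs, ?_⟩
  have he : span ℝ (F : Set V) = span ℝ (G : Set V) :=
    Submodule.eq_of_le_of_finrank_le (span_mono (by exact_mod_cast h)) hr
  apply vanish_span (F := (F : Set V)) (fun t ht => ((h2 t).1 ht).2)
  rw [he]
  exact subset_span hs

theorem exists_functional {S F Y : Finset V} (h : rk F + Y.card < rk S) :
    ∃ f : V →ₗ[ℝ] ℝ, (∀ s ∈ F, f s = 0) ∧ (∀ y ∈ Y, f y = 0) ∧ ∃ s ∈ S, f s ≠ 0 := by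
  set W : Submodule ℝ V := span ℝ (F : Set V) ⊔ span ℝ (Y : Set V) with hW
  have hWr : finrank ℝ W < rk S := by
    have h1 := Submodule.finrank_add_le_finrank_add_finrank (span ℝ (F : Set V)) (span ℝ (Y : Set V))
    have h2 : finrank ℝ (span ℝ (Y : Set V)) ≤ Y.card := finrank_span_finset_le_card Y
    unfold rk at *
    rw [hW]
    omega
  have : ∃ s ∈ S, s ∉ W := by
    by_contra! hc
    have : span ℝ (S : Set V) ≤ W := span_le.2 fun s hs => hc s hs
    have := Submodule.finrank_mono this
    unfold rk at hWr
    omega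
  obtain ⟨s, hs, hsW⟩ := this
  obtain ⟨f, hf, hfW⟩ := Submodule.exists_le_ker_of_notMem hsW
  refine ⟨f, fun t ht => ?_, fun t ht => ?_, s, hs, hf⟩
  · exact hfW ((le_sup_left : _ ≤ W) (subset_span ht))
  · exact hfW ((le_sup_right : _ ≤ W) (subset_span ht))

theorem max_ratio {S u : Finset V} {h g : V →ₗ[ℝ] ℝ} (h0 : ∀ s ∈ S, 0 ≤ h s)
    (hu : ∀ s, s ∈ u ↔ s ∈ S ∧ h s = 0) (hne : ∃ s ∈ S, s ∉ u) (hg : ∀ s ∈ u, g s = 0) :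
    ∃ (M : ℝ) (F : Finset V), CFace S F ∧ u ⊆ F ∧ (∃ s ∈ F, s ∉ u) ∧
      (∀ s, s ∈ F ↔ s ∈ S ∧ g s = M * h s) ∧ ∀ s ∈ S, g s ≤ M * h s := by
  classical
  obtain ⟨s0, hs0, hs0u⟩ := hne
  obtain ⟨m, hm, hmax⟩ := Finset.exists_max_image (S \ u) (fun s => g s / h s)
    ⟨s0, Finset.mem_sdiff.2 ⟨hs0, hs0u⟩⟩
  have hpos : ∀ s ∈ S, s ∉ u → 0 < h s := fun s hs hsu =>
    lt_of_le_of_ne (h0 s hs) (fun he => hsu ((hu s).2 ⟨hs, he.symm⟩))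
  obtain ⟨hmS, hmu⟩ := Finset.mem_sdiff.1 hm
  set M := g m / h m with hM
  have hle : ∀ s ∈ S, g s ≤ M * h s := by
    intro s hs
    by_cases hsu : s ∈ u
    · rw [hg s hsu, ((hu s).1 hsu).2]; simp
    · have := hmax s (Finset.mem_sdiff.2 ⟨hs, hsu⟩)
      exact (div_le_iff₀ (hpos s hs hsu)).1 this
  have hmem : ∀ s, s ∈ S.filter (fun s => g s = M * h s) ↔ s ∈ S ∧ g s = M * h s := by
    intro s; simp
  refine ⟨M, S.filter (fun s => g s = M * h s), ?_, ?_, ?_, hmem, hle⟩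
  · refine ⟨M • h - g, fun s hs => by simpa using hle s hs, fun s => ?_⟩
    rw [hmem]
    simp [sub_eq_zero, eq_comm (a := g s)]
  · intro s hs
    rw [hmem, hg s hs, ((hu s).1 hs).2]
    exact ⟨((hu s).1 hs).1, by simp⟩
  · refine ⟨m, ?_, hmu⟩
    rw [hmem]
    exact ⟨hmS, by rw [hM, div_mul_cancel₀ _ (hpos m hmS hmu).ne']⟩

theorem exists_cover {S u F : Finset V} (hu : CFace S u) (hF : CFace S F) (huF : u ⊂ F) :
    ∃ E, CFace S E ∧ u ⊆ E ∧ E ⊆ F ∧ rk E = rk u + 1 := by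
  induction F using Finset.strongInduction with
  | H F ih =>
  have hFS := hF.subset
  have hlt : rk u < rk F := by
    by_contra! hc
    exact huF.ne (hu.eq_of_rk hFS huF.1 hc)
  by_cases hr : rk F = rk u + 1
  · exact ⟨F, hF, huF.1, subset_rfl, hr⟩
  obtain ⟨s, hsF, hsu⟩ := Finset.exists_of_ssubset huF
  obtain ⟨g, hg1, hg2, t, htF, hgt⟩ := exists_functional (S := F) (F := u) (Y := {s})
    (by simp; omega)
  have hgs : g s = 0 := hg2 s (by simp)
  obtain ⟨h, hh0, hhu⟩ := hu.restrict huF.1 hFS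
  obtain ⟨M, E, hE, huE, ⟨e, heE, heu⟩, hEm, hle⟩ := max_ratio hh0 hhu ⟨s, hsF, hsu⟩ hg1
  have hhs : 0 < h s := lt_of_le_of_ne (hh0 s hsF) (fun he => hsu ((hhu s).2 ⟨hsF, he.symm⟩))
  have hEF : E ⊂ F := by
    refine Finset.ssubset_iff_subset_ne.2 ⟨hE.subset, ?_⟩
    rintro rfl
    have h1 := ((hEm s).1 hsF).2
    have h2 := ((hEm t).1 htF).2
    rw [hgs] at h1
    have : M = 0 := by
      rcases mul_eq_zero.1 h1.symm with h | h
      · exact h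
      · exact absurd h hhs.ne'
    rw [this] at h2
    exact hgt (by simpa using h2)
  have huE' : u ⊂ E := Finset.ssubset_iff_subset_ne.2 ⟨huE, by rintro rfl; exact heu heE⟩
  obtain ⟨E', h1, h2, h3, h4⟩ := ih E hEF (hF.trans hE) huE'
  exact ⟨E', h1, h2, h3.trans hEF.1, h4⟩

theorem exists_up {S u : Finset V} (hu : CFace S u) {g : V →ₗ[ℝ] ℝ} (hg : ∀ s ∈ u, g s = 0)
    (hs : ∃ s ∈ S, 0 < g s) :
    ∃ E, CFace S E ∧ u ⊆ E ∧ rk E = rk u + 1 ∧ ∀ s ∈ E, s ∉ u → 0 < g s := by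
  obtain ⟨s, hsS, hgs⟩ := hs
  obtain ⟨h, hh0, hhu⟩ := id hu
  have hsu : s ∉ u := fun hc => hgs.ne' (hg s hc)
  obtain ⟨M, F, hF, huF, ⟨e, heF, heu⟩, hFm, hle⟩ := max_ratio hh0 hhu ⟨s, hsS, hsu⟩ hg
  have hM : 0 < M := by
    have h1 := hle s hsS
    have h2 := hh0 s hsS
    by_contra! hc
    nlinarith
  have huF' : u ⊂ F := Finset.ssubset_iff_subset_ne.2 ⟨huF, by rintro rfl; exact heu heF⟩
  obtain ⟨E, h1, h2, h3, h4⟩ := exists_cover hu hF huF'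
  refine ⟨E, h1, h2, h4, fun t ht htu => ?_⟩
  obtain ⟨htS, hte⟩ := (hFm t).1 (h3 ht)
  rw [hte]
  exact mul_pos hM (lt_of_le_of_ne (hh0 t htS) (fun he => htu ((hhu t).2 ⟨htS, he.symm⟩)))

/-- Face of rank `j` avoiding `B`. -/
def Good (S : Finset V) (B : Finset (Finset V)) (j : ℕ) (F : Finset V) : Prop :=
  CFace S F ∧ rk F = j ∧ ∀ b ∈ B, ¬ b ⊆ F

/-- Adjacency of good faces. -/
def GAdj (S : Finset V) (B : Finset (Finset V)) (j : ℕ) (F G : Finset V) : Prop :=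
  Good S B j F ∧ Good S B j G ∧ ∃ T, Good S B (j + 1) T ∧ F ⊆ T ∧ G ⊆ T

theorem GAdj.symm {S : Finset V} {B : Finset (Finset V)} {j : ℕ} {F G : Finset V}
    (h : GAdj S B j F G) : GAdj S B j G F := by
  obtain ⟨h1, h2, T, h3, h4, h5⟩ := h
  exact ⟨h2, h1, T, h3, h5, h4⟩

theorem conn_symm {S : Finset V} {B : Finset (Finset V)} {j : ℕ} {F G : Finset V}
    (h : Relation.ReflTransGen (GAdj S B j) F G) : Relation.ReflTransGen (GAdj S B j) G F :=
  by
  induction h with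
  | refl => exact .refl
  | tail _ h2 ih => exact .head h2.symm ih

theorem zero_of_sum {b : Finset V} {f : V →ₗ[ℝ] ℝ} (h0 : f (∑ s ∈ b, s) = 0)
    (hn : ∀ s ∈ b, 0 ≤ f s) : ∀ s ∈ b, f s = 0 := by
  rw [map_sum] at h0
  exact (Finset.sum_eq_zero_iff_of_nonneg hn).1 h0

theorem exists_functional' {S F : Finset V} {B : Finset (Finset V)}
    (h : rk F + B.card < rk S) :
    ∃ f : V →ₗ[ℝ] ℝ, (∀ s ∈ F, f s = 0) ∧ (∀ b ∈ B, f (∑ s ∈ b, s) = 0) ∧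
      ∃ s ∈ S, f s ≠ 0 := by
  classical
  obtain ⟨f, h1, h2, h3⟩ := exists_functional (S := S) (F := F)
    (Y := B.image fun b => ∑ s ∈ b, s)
    (lt_of_le_of_lt (Nat.add_le_add_left Finset.card_image_le _) h)
  exact ⟨f, h1, fun b hb => h2 _ (Finset.mem_image_of_mem _ hb), h3⟩

theorem extend_one {S F : Finset V} {B : Finset (Finset V)} {j : ℕ} (hF : Good S B j F)
    (hB : B.card + j < rk S) : ∃ E, Good S B (j + 1) E ∧ F ⊆ E := by
  obtain ⟨hF, rfl, hFB⟩ := hF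
  obtain ⟨f, h1, h2, s, hs, hfs⟩ := exists_functional' (S := S) (F := F) (B := B) (by omega)
  have : ∃ f : V →ₗ[ℝ] ℝ, (∀ s ∈ F, f s = 0) ∧ (∀ b ∈ B, f (∑ s ∈ b, s) = 0) ∧
      ∃ s ∈ S, 0 < f s := by
    rcases lt_or_gt_of_ne hfs with h | h
    · refine ⟨-f, fun s hs => by simp [h1 s hs], fun b hb => ?_, s, hs, by simpa using h⟩
      rw [LinearMap.neg_apply, h2 b hb, neg_zero]
    · exact ⟨f, h1, h2, s, hs, h⟩
  obtain ⟨f, h1, h2, h3⟩ := this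
  obtain ⟨E, hE, hFE, hr, hp⟩ := exists_up hF h1 h3
  refine ⟨E, ⟨hE, hr, fun b hb hbE => hFB b hb fun s hs => ?_⟩, hFE⟩
  by_contra hsF
  have hn : ∀ s ∈ E, 0 ≤ f s := fun s hs => by
    by_cases h : s ∈ F
    · rw [h1 s h]
    · exact (hp s hs h).le
  have := zero_of_sum (h2 b hb) (fun s hs => hn s (hbE hs)) s hs
  exact (hp s (hbE hs) hsF).ne' this

theorem extend_many {S F : Finset V} {B : Finset (Finset V)} {j : ℕ} (hF : Good S B j F)
    (i : ℕ) (hB : B.card + j + i ≤ rk S) : ∃ E, Good S B (j + i) E ∧ F ⊆ E := by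
  induction i with
  | zero => exact ⟨F, hF, subset_rfl⟩
  | succ i ih =>
    obtain ⟨E, hE, hFE⟩ := ih (by omega)
    obtain ⟨E', hE', hEE⟩ := extend_one hE (by omega)
    exact ⟨E', hE', hFE.trans hEE⟩

theorem ray {A u : Finset V} {h f : V →ₗ[ℝ] ℝ} (hAu : A ⊆ u) (hr : rk u = rk A + 1)
    (hh : ∀ s ∈ A, h s = 0) (hf : ∀ s ∈ A, f s = 0) {s0 : V} (hs0 : s0 ∈ u) (h0 : h s0 ≠ 0) :
    ∀ s ∈ u, f s * h s0 = f s0 * h s := by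
  have hs0A : s0 ∉ span ℝ (A : Set V) := fun hc => h0 (vanish_span hh s0 hc)
  have hle : span ℝ (insert s0 (A : Set V)) ≤ span ℝ (u : Set V) := by
    apply span_mono
    intro x hx
    rcases hx with rfl | hx
    · exact hs0
    · exact hAu hx
  have hlt : finrank ℝ (span ℝ (A : Set V)) < finrank ℝ (span ℝ (insert s0 (A : Set V))) := by
    have : FiniteDimensional ℝ (span ℝ (insert s0 (A : Set V))) :=
      FiniteDimensional.span_of_finite ℝ (A.finite_toSet.insert s0)
    apply Submodule.finrank_lt_finrank_of_lt
    refine lt_of_le_of_ne (span_mono (Set.subset_insert _ _)) fun he => hs0A ?_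
    rw [he]
    exact subset_span (Set.mem_insert _ _)
  have he : span ℝ (insert s0 (A : Set V)) = span ℝ (u : Set V) := by
    apply Submodule.eq_of_le_of_finrank_le hle
    unfold rk at hr
    omega
  intro s hs
  have : s ∈ span ℝ (insert s0 (A : Set V)) := by rw [he]; exact subset_span hs
  have key := vanish_span (F := insert s0 (A : Set V)) (f := h s0 • f - f s0 • h) (by
    intro x hx
    rcases hx with rfl | hx
    · simp [mul_comm]
    · simp [hh x hx, hf x hx]) s this
  simp at key
  linarith


/-- The half-space part of Balinski's argument. -/
theorem half {S A : Finset V} {B : Finset (Finset V)}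
    (ih : ∀ S' : Finset V, S' ⊂ S → CFace S' A → rk A + 2 ≤ rk S' →
      ∀ u v, Good S' ∅ (rk A + 1) u → Good S' ∅ (rk A + 1) v → A ⊆ u → A ⊆ v →
        Relation.ReflTransGen (GAdj S' ∅ (rk A + 1)) u v)
    (hA : CFace S A) (hAB : ∀ b ∈ B, ¬ b ⊆ A)
    {f : V →ₗ[ℝ] ℝ} (hfA : ∀ s ∈ A, f s = 0) (hfB : ∀ b ∈ B, f (∑ s ∈ b, s) = 0)
    (hp : ∃ s ∈ S, 0 < f s) (ht : ∃ t ∈ S, t ∉ A ∧ f t ≤ 0)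
    (u v : Finset V) (hu : Good S B (rk A + 1) u) (hv : Good S B (rk A + 1) v)
    (hAu : A ⊆ u) (hAv : A ⊆ v) (hfu : ∀ s ∈ u, 0 ≤ f s) (hfv : ∀ s ∈ v, 0 ≤ f s) :
    Relation.ReflTransGen (GAdj S B (rk A + 1)) u v := by
  obtain ⟨h, hh0, hhA⟩ := id hA
  have hhA0 : ∀ s ∈ A, h s = 0 := fun s hs => ((hhA s).1 hs).2
  have hhp : ∀ s ∈ S, s ∉ A → 0 < h s := fun s hs hsu =>
    lt_of_le_of_ne (hh0 s hs) (fun he => hsu ((hhA s).2 ⟨hs, he.symm⟩))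
  obtain ⟨t, htS, htA, hft⟩ := ht
  obtain ⟨M, X, hX, hAX, ⟨e, heX, heA⟩, hXm, hle⟩ := max_ratio hh0 hhA ⟨t, htS, htA⟩ hfA
  have hM : 0 < M := by
    obtain ⟨s, hs, hfs⟩ := hp
    have h1 := hle s hs
    have h2 := hh0 s hs
    by_contra! hc
    nlinarith
  have heS : e ∈ S := hX.subset heX
  have hXB : ∀ b ∈ B, ¬ b ⊆ X := by
    intro b hb hbX
    refine hAB b hb fun s hs => ?_
    have hz := zero_of_sum (hfB b hb) (fun s hs => by
      obtain ⟨a1, a2⟩ := (hXm s).1 (hbX hs)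
      rw [a2]; exact mul_nonneg hM.le (hh0 s a1)) s hs
    obtain ⟨a1, a2⟩ := (hXm s).1 (hbX hs)
    rw [a2] at hz
    exact (hhA s).2 ⟨a1, (mul_eq_zero.1 hz).resolve_left hM.ne'⟩
  have hXS : X ⊂ S := by
    refine Finset.ssubset_iff_subset_ne.2 ⟨hX.subset, ?_⟩
    rintro rfl
    have h1 := ((hXm t).1 htS).2
    have := mul_pos hM (hhp t htS htA)
    linarith
  -- climbing
  have climb : ∀ u, Good S B (rk A + 1) u → A ⊆ u → (∀ s ∈ u, 0 ≤ f s) →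
      ∃ w, Relation.ReflTransGen (GAdj S B (rk A + 1)) u w ∧ Good S B (rk A + 1) w ∧
        A ⊆ w ∧ w ⊆ X := by
    intro u hu hAu hfu
    classical
    set ρ : Finset V → ℝ := fun w => (∑ s ∈ w, f s) / (∑ s ∈ w, h s) with hρ
    obtain ⟨w, hw, hmax⟩ := Finset.exists_max_image
      (S.powerset.filter fun w => Relation.ReflTransGen (GAdj S B (rk A + 1)) u w ∧
        Good S B (rk A + 1) w ∧ A ⊆ w ∧ ∀ s ∈ w, 0 ≤ f s) ρ
      ⟨u, by
        simp only [Finset.mem_filter, Finset.mem_powerset]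
        exact ⟨hu.1.subset, .refl, hu, hAu, hfu⟩⟩
    simp only [Finset.mem_filter, Finset.mem_powerset] at hw hmax
    obtain ⟨hwS, hw1, hw2, hw3, hw4⟩ := hw
    refine ⟨w, hw1, hw2, hw3, ?_⟩
    -- sum of heights positive
    have hsum : ∀ w, w ⊆ S → A ⊆ w → rk w = rk A + 1 → 0 < ∑ s ∈ w, h s ∧ ∃ s ∈ w, s ∉ A := by
      intro w hwS hAw hr
      have : ∃ s ∈ w, s ∉ A := by
        by_contra! hc
        have : w = A := Finset.Subset.antisymm hc hAw
        rw [this] at hr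
        omega
      obtain ⟨s, hs, hsA⟩ := this
      exact ⟨Finset.sum_pos' (fun s hs => hh0 s (hwS hs)) ⟨s, hs, hhp s (hwS hs) hsA⟩, s, hs, hsA⟩
    obtain ⟨hws, s0, hs0, hs0A⟩ := hsum w hwS hw3 hw2.2.1
    have hhs0 := hhp s0 (hwS hs0) hs0A
    set c : ℝ := f s0 / h s0 with hc
    have hc0 : 0 ≤ c := div_nonneg (hw4 s0 hs0) hhs0.le
    have hcw : ∀ s ∈ w, f s = c * h s := by
      intro s hs
      have := ray hw3 hw2.2.1 hhA0 hfA hs0 hhs0.ne' s hs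
      rw [hc]
      field_simp
      linarith
    have hρw : ρ w = c := by
      rw [hρ]
      simp only
      rw [Finset.sum_congr rfl hcw, ← Finset.mul_sum, mul_div_cancel_right₀ _ hws.ne']
    have hcM : c ≤ M := by
      rw [hc, div_le_iff₀ hhs0]
      exact hle s0 (hwS hs0)
    rcases hcM.eq_or_lt with hcM | hcM
    · intro s hs
      rw [hXm, ← hcM]
      exact ⟨hwS hs, hcw s hs⟩
    exfalso
    set g : V →ₗ[ℝ] ℝ := f - c • h with hg
    have hgs : ∀ s, g s = f s - c * h s := fun s => by simp [hg]
    have hgw : ∀ s ∈ w, g s = 0 := fun s hs => by rw [hgs, hcw s hs]; ring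
    obtain ⟨E, hE, hwE, hEr, hEg⟩ := exists_up hw2.1 hgw ⟨e, heS, by
      rw [hgs, ((hXm e).1 heX).2]
      have := hhp e heS heA
      nlinarith⟩
    have hES := hE.subset
    have hEg0 : ∀ s ∈ E, 0 ≤ g s := fun s hs => by
      by_cases h : s ∈ w
      · rw [hgw s h]
      · exact (hEg s hs h).le
    have hEf0 : ∀ s ∈ E, 0 ≤ f s := fun s hs => by
      have h1 := hEg0 s hs
      rw [hgs] at h1
      have := mul_nonneg hc0 (hh0 s (hES hs))
      linarith
    have hEgood : Good S B (rk A + 1 + 1) E := by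
      refine ⟨hE, by rw [hEr, hw2.2.1], fun b hb hbE => hw2.2.2 b hb fun s hs => ?_⟩
      by_contra hsw
      have h1 := zero_of_sum (hfB b hb) (fun s hs => hEf0 s (hbE hs)) s hs
      have h2 := hEg s (hbE hs) hsw
      rw [hgs] at h2
      have := mul_nonneg hc0 (hh0 s (hES (hbE hs)))
      linarith
    have hwE' : ∃ s ∈ E, s ∉ w := by
      by_contra! hc
      have : E = w := Finset.Subset.antisymm hc hwE
      rw [this] at hEr
      omega
    obtain ⟨x, hxE, hxw⟩ := hwE'
    obtain ⟨w', hw', hAw', hr', hg'⟩ := exists_up (hA.restrict (hw3.trans hwE) hES)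
      (fun s hs => hgw s (hw3 hs)) ⟨x, hxE, hEg x hxE hxw⟩
    have hw'E := hw'.subset
    have hw'good : Good S B (rk A + 1) w' :=
      ⟨hE.trans hw', hr', fun b hb hbw => hEgood.2.2 b hb (hbw.trans hw'E)⟩
    have := hmax w' ⟨hw'E.trans hES, hw1.tail ⟨hw2, hw'good, E, hEgood, hwE, hw'E⟩, hw'good, hAw',
      fun s hs => hEf0 s (hw'E hs)⟩
    rw [hρw] at this
    obtain ⟨hws', s1, hs1, hs1A⟩ := hsum w' (hw'E.trans hES) hAw' hr'
    have h1 : 0 < ∑ s ∈ w', g s :=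
      Finset.sum_pos' (fun s hs => hEg0 s (hw'E hs)) ⟨s1, hs1, hg' s1 hs1 hs1A⟩
    simp only [hgs, Finset.sum_sub_distrib, ← Finset.mul_sum] at h1
    have h2 : (∑ s ∈ w', f s) / (∑ s ∈ w', h s) ≤ c := this
    rw [div_le_iff₀ hws'] at h2
    linarith
  obtain ⟨u', hu1, hu2, hu3, hu4⟩ := climb u hu hAu hfu
  obtain ⟨v', hv1, hv2, hv3, hv4⟩ := climb v hv hAv hfv
  refine (hu1.trans ?_).trans (conn_symm hv1)
  by_cases hr : rk A + 2 ≤ rk X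
  · have := ih X hXS (hA.restrict hAX hX.subset) hr u' v'
      ⟨hu2.1.restrict hu4 hX.subset, hu2.2.1, by simp⟩
      ⟨hv2.1.restrict hv4 hX.subset, hv2.2.1, by simp⟩ hu3 hv3
    have up : ∀ j F, Good X ∅ j F → Good S B j F := fun j F hF =>
      ⟨hX.trans hF.1, hF.2.1, fun b hb hbF => hXB b hb (hbF.trans hF.1.subset)⟩
    refine Relation.ReflTransGen.mono ?_ _ _ this
    rintro F G ⟨h1, h2, T, h3, h4, h5⟩
    exact ⟨up _ _ h1, up _ _ h2, T, up _ _ h3, h4, h5⟩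
  · have h1 : u' = X := hu2.1.eq_of_rk hX.subset hu4 (by rw [hu2.2.1]; omega)
    have h2 : v' = X := hv2.1.eq_of_rk hX.subset hv4 (by rw [hv2.2.1]; omega)
    rw [h1, h2]

theorem balinski (S : Finset V) : ∀ (A : Finset V) (B : Finset (Finset V)), CFace S A →
    (∀ b ∈ B, ¬ b ⊆ A) → B.card + rk A + 2 ≤ rk S →
      ∀ u v, Good S B (rk A + 1) u → Good S B (rk A + 1) v → A ⊆ u → A ⊆ v →
        Relation.ReflTransGen (GAdj S B (rk A + 1)) u v := by
  induction S using Finset.strongInduction with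
  | H S ih =>
  intro A B hA hAB hcard u v hu hv hAu hAv
  have ih' : ∀ S' : Finset V, S' ⊂ S → CFace S' A → rk A + 2 ≤ rk S' →
      ∀ u v, Good S' ∅ (rk A + 1) u → Good S' ∅ (rk A + 1) v → A ⊆ u → A ⊆ v →
        Relation.ReflTransGen (GAdj S' ∅ (rk A + 1)) u v := by
    intro S' hS' hA' hr
    exact ih S' hS' A ∅ hA' (by simp) (by simpa using hr)
  obtain ⟨f, hfu, hfB, s, hs, hfs⟩ := exists_functional' (S := S) (F := u) (B := B)
    (by rw [hu.2.1]; omega)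
  have hfA : ∀ s ∈ A, f s = 0 := fun s hs => hfu s (hAu hs)
  obtain ⟨t, htu, htA⟩ : ∃ t ∈ u, t ∉ A := by
    by_contra! hc
    have : u = A := Finset.Subset.antisymm hc hAu
    have h2 := hu.2.1
    rw [this] at h2
    omega
  have htS := hu.1.subset htu
  -- sign alternative on v
  obtain ⟨h, hh0, hhA⟩ := id hA
  have hhA0 : ∀ s ∈ A, h s = 0 := fun s hs => ((hhA s).1 hs).2
  have hsign : (∀ s ∈ v, 0 ≤ f s) ∨ (∀ s ∈ v, f s ≤ 0) := by
    obtain ⟨y, hyv, hyA⟩ : ∃ t ∈ v, t ∉ A := by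
      by_contra! hc
      have : v = A := Finset.Subset.antisymm hc hAv
      have h2 := hv.2.1
      rw [this] at h2
      omega
    have hyS := hv.1.subset hyv
    have hy : 0 < h y := lt_of_le_of_ne (hh0 y hyS) (fun he => hyA ((hhA y).2 ⟨hyS, he.symm⟩))
    have hr := ray hAv hv.2.1 hhA0 hfA hyv hy.ne'
    rcases le_total 0 (f y) with hfy | hfy
    · left
      intro s hs
      have h1 := hr s hs
      have h2 := mul_nonneg hfy (hh0 s (hv.1.subset hs))
      rw [← h1] at h2
      exact nonneg_of_mul_nonneg_left h2 hy
    · right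
      intro s hs
      have h1 := hr s hs
      have h2 := mul_nonpos_of_nonpos_of_nonneg hfy (hh0 s (hv.1.subset hs))
      rw [← h1] at h2
      by_contra! hc
      have := mul_pos hc hy
      linarith
  -- the positive side / negative side, in a uniform way
  have main : ∀ f : V →ₗ[ℝ] ℝ, (∀ s ∈ u, f s = 0) → (∀ b ∈ B, f (∑ s ∈ b, s) = 0) →
      (∃ s ∈ S, f s ≠ 0) → (∀ s ∈ v, 0 ≤ f s) →
      Relation.ReflTransGen (GAdj S B (rk A + 1)) u v := by
    intro f hfu hfB hne hfv
    have hfA : ∀ s ∈ A, f s = 0 := fun s hs => hfu s (hAu hs)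
    by_cases hp : ∃ s ∈ S, 0 < f s
    · exact half ih' hA hAB hfA hfB hp ⟨t, htS, htA, (hfu t htu).le⟩ u v hu hv hAu hAv
        (fun s hs => (hfu s hs).ge) hfv
    · push Not at hp
      obtain ⟨s, hs, hfs⟩ := hne
      refine half (f := -f) ih' hA hAB (fun s hs => by simp [hfA s hs])
        (fun b hb => by rw [LinearMap.neg_apply, hfB b hb, neg_zero])
        ⟨s, hs, ?_⟩ ⟨t, htS, htA, by simp [hfu t htu]⟩ u v hu hv hAu hAv
        (fun s hs => by simp [hfu s hs]) (fun s hs => ?_)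
      · have := lt_of_le_of_ne (hp s hs) hfs
        simpa using this
      · have := hp s (hv.1.subset hs)
        simpa using this
  rcases hsign with hpos | hneg
  · exact main f hfu hfB ⟨s, hs, hfs⟩ hpos
  · exact main (-f) (fun s hs => by simp [hfu s hs])
      (fun b hb => by rw [LinearMap.neg_apply, hfB b hb, neg_zero])
      ⟨s, hs, by simpa using hfs⟩ (fun s hs => by simpa using hneg s hs)

theorem config_main (S : Finset V) (B : Finset (Finset V)) (k : ℕ) (hk : B.card + k + 1 ≤ rk S) :
    ∀ (i : ℕ) (A : Finset V), Good S B (rk A) A → rk A + i = k →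
      ∀ F G, Good S B k F → Good S B k G → A ⊆ F → A ⊆ G →
        Relation.ReflTransGen (GAdj S B k) F G := by
  intro i
  induction i with
  | zero =>
    intro A hA hr F G hF hG hAF hAG
    have h1 : A = F := hA.1.eq_of_rk hF.1.subset hAF (by rw [hF.2.1]; omega)
    have h2 : A = G := hA.1.eq_of_rk hG.1.subset hAG (by rw [hG.2.1]; omega)
    rw [← h1, ← h2]
  | succ i ih =>
    intro A hA hr F G hF hG hAF hAG
    have down : ∀ F, Good S B k F → A ⊆ F → ∃ F1, Good S B (rk A + 1) F1 ∧ A ⊆ F1 ∧ F1 ⊆ F := by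
      intro F hF hAF
      obtain ⟨E, h1, h2, h3, h4⟩ := exists_cover hA.1 hF.1
        (Finset.ssubset_iff_subset_ne.2 ⟨hAF, by
          rintro rfl
          have := hF.2.1
          omega⟩)
      exact ⟨E, ⟨h1, h4, fun b hb hbE => hF.2.2 b hb (hbE.trans h3)⟩, h2, h3⟩
    obtain ⟨F1, hF1, hAF1, hF1F⟩ := down F hF hAF
    obtain ⟨G1, hG1, hAG1, hG1G⟩ := down G hG hAG
    have hb := balinski S A B hA.1 hA.2.2 (by omega) F1 G1 hF1 hG1 hAF1 hAG1
    clear hAF hAG hAG1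
    induction hb generalizing G with
    | refl =>
      exact ih F1 (by rw [hF1.2.1]; exact hF1) (by rw [hF1.2.1]; omega) F G hF hG hF1F hG1G
    | @tail Y Z _ hYZ ih2 =>
      obtain ⟨hY, hZ, T, hT, hYT, hZT⟩ := hYZ
      rcases Nat.eq_zero_or_pos i with hi | hi
      · have hkk : k = rk A + 1 := by omega
        have h1 : Z = G := hZ.1.eq_of_rk hG.1.subset hG1G (by rw [hG.2.1, hZ.2.1]; omega)
        subst h1
        subst hkk
        exact (ih2 Y hY hY subset_rfl).tail ⟨hY, hZ, T, hT, hYT, hZT⟩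
      · obtain ⟨D, hD, hTD⟩ := extend_many hT (i - 1) (by omega)
        have he : rk A + 1 + 1 + (i - 1) = k := by omega
        rw [he] at hD
        exact (ih2 D hD hY (hYT.trans hTD)).trans
          (ih Z (by rw [hZ.2.1]; exact hZ) (by rw [hZ.2.1]; omega) D G hD hG (hZT.trans hTD) hG1G)

end Config

section Transport

variable {N : ℕ}

/-- Homogenisation of a finite point set. -/
noncomputable def up (s : Finset (Pt N)) : Finset (Pt N × ℝ) := s.image fun x => (x, (1 : ℝ))

/-- Points of `S0` whose lift is in `T`. -/
noncomputable def dn (S0 : Finset (Pt N)) (T : Finset (Pt N × ℝ)) : Finset (Pt N) :=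
  S0.filter fun x => (x, (1 : ℝ)) ∈ T

/-- Polytope face to configuration face. -/
noncomputable def phi (S0 : Finset (Pt N)) (F : Set (Pt N)) : Finset (Pt N × ℝ) :=
  up (S0.filter fun x => x ∈ F)

/-- Configuration face to polytope face. -/
noncomputable def psi (S0 : Finset (Pt N)) (T : Finset (Pt N × ℝ)) : Set (Pt N) :=
  convexHull ℝ (dn S0 T : Set (Pt N))

theorem mem_up {s : Finset (Pt N)} {x : Pt N} : (x, (1 : ℝ)) ∈ up s ↔ x ∈ s := by
  simp [up]

theorem up_dn {S0 : Finset (Pt N)} {T : Finset (Pt N × ℝ)} (h : T ⊆ up S0) :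
    up (dn S0 T) = T := by
  ext y
  constructor
  · intro hy
    obtain ⟨x, hx, rfl⟩ := Finset.mem_image.1 hy
    exact (Finset.mem_filter.1 hx).2
  · intro hy
    obtain ⟨x, hx, rfl⟩ := Finset.mem_image.1 (h hy)
    exact mem_up.2 (Finset.mem_filter.2 ⟨hx, hy⟩)

theorem dn_up {S0 s : Finset (Pt N)} (h : s ⊆ S0) : dn S0 (up s) = s := by
  ext x
  simp only [dn, Finset.mem_filter, mem_up]
  exact ⟨fun h => h.2, fun hx => ⟨h hx, hx⟩⟩

theorem rk_up (s : Finset (Pt N)) (hs : s.Nonempty) :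
    rk (up s) = finrank ℝ (vectorSpan ℝ (s : Set (Pt N))) + 1 := by
  obtain ⟨p, hp⟩ := hs
  have hsp : span ℝ (up s : Set (Pt N × ℝ)) =
      (vectorSpan ℝ (s : Set (Pt N))).map (LinearMap.inl ℝ (Pt N) ℝ) ⊔
        span ℝ {((p, 1) : Pt N × ℝ)} := by
    apply le_antisymm
    · refine span_le.2 fun y hy => ?_
      obtain ⟨x, hx, rfl⟩ := Finset.mem_image.1 (Finset.mem_coe.1 hy)
      refine Submodule.mem_sup.2 ⟨(x - p, 0), ⟨x - p, ?_, by simp⟩, (p, 1), mem_span_singleton_self _,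
        by simp⟩
      exact vsub_mem_vectorSpan ℝ hx hp
    · refine sup_le ?_ ?_
      · rw [Submodule.map_le_iff_le_comap, vectorSpan_eq_span_vsub_set_right ℝ hp]
        refine span_le.2 ?_
        rintro _ ⟨x, hx, rfl⟩
        have h1 : ((x, 1) : Pt N × ℝ) ∈ span ℝ (up s : Set (Pt N × ℝ)) :=
          subset_span (mem_up.2 hx)
        have h2 : ((p, 1) : Pt N × ℝ) ∈ span ℝ (up s : Set (Pt N × ℝ)) :=
          subset_span (mem_up.2 hp)
        have := Submodule.sub_mem _ h1 h2
        simpa using this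
      · refine span_le.2 ?_
        rintro _ rfl
        exact subset_span (mem_up.2 hp)
  have hinf : (vectorSpan ℝ (s : Set (Pt N))).map (LinearMap.inl ℝ (Pt N) ℝ) ⊓
        span ℝ {((p, 1) : Pt N × ℝ)} = ⊥ := by
    rw [eq_bot_iff]
    rintro y ⟨⟨x, _, rfl⟩, hy⟩
    obtain ⟨c, hc⟩ := mem_span_singleton.1 hy
    have h1 := congrArg Prod.snd hc
    simp at h1
    subst h1
    rw [← hc]
    simp
  have h := Submodule.finrank_sup_add_finrank_inf_eq
    ((vectorSpan ℝ (s : Set (Pt N))).map (LinearMap.inl ℝ (Pt N) ℝ)) (span ℝ {((p, 1) : Pt N × ℝ)})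
  rw [hinf, finrank_bot, finrank_span_singleton (by simp), ← hsp,
    ← (Submodule.equivMapOfInjective (LinearMap.inl ℝ (Pt N) ℝ) LinearMap.inl_injective
      (vectorSpan ℝ (s : Set (Pt N)))).finrank_eq] at h
  exact h

theorem faceDim_hull (s : Finset (Pt N)) (hs : s.Nonempty) :
    faceDim (convexHull ℝ (s : Set (Pt N))) = (rk (up s) : ℤ) - 1 := by
  have hne : convexHull ℝ (s : Set (Pt N)) ≠ ∅ := by
    rw [Ne, convexHull_eq_empty]
    simpa using hs.ne_empty
  rw [faceDim, if_neg hne, affineSpan_convexHull, direction_affineSpan, rk_up s hs]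
  push_cast
  ring

theorem hull_val {S0 : Finset (Pt N)} {L : Pt N × ℝ →ₗ[ℝ] ℝ} (h0 : ∀ s ∈ S0, 0 ≤ L (s, 1))
    {x : Pt N} (hx : x ∈ convexHull ℝ (S0 : Set (Pt N))) :
    0 ≤ L (x, 1) ∧ (L (x, 1) = 0 →
      x ∈ convexHull ℝ (S0.filter (fun s => L (s, 1) = 0) : Set (Pt N))) := by
  obtain ⟨w, hw0, hw1, hwx⟩ := Finset.mem_convexHull'.1 hx
  have hL : L (x, 1) = ∑ y ∈ S0, w y * L (y, 1) := by
    have : ((x, 1) : Pt N × ℝ) = ∑ y ∈ S0, w y • ((y, 1) : Pt N × ℝ) := by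
      refine Prod.ext ?_ ?_
      · simp [Prod.fst_sum, hwx]
      · simp [Prod.snd_sum, hw1]
    rw [this, map_sum]
    simp only [map_smul, smul_eq_mul]
  have hnn : ∀ y ∈ S0, 0 ≤ w y * L (y, 1) := fun y hy => mul_nonneg (hw0 y hy) (h0 y hy)
  refine ⟨by rw [hL]; exact Finset.sum_nonneg hnn, fun hz => ?_⟩
  rw [hL] at hz
  have hz' := (Finset.sum_eq_zero_iff_of_nonneg hnn).1 hz
  have hwz : ∀ y ∈ S0, ¬ L (y, 1) = 0 → w y = 0 := fun y hy hn =>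
    (mul_eq_zero.1 (hz' y hy)).resolve_right hn
  refine Finset.mem_convexHull'.2 ⟨w, fun y hy => hw0 y (Finset.mem_filter.1 hy).1, ?_, ?_⟩
  · refine Eq.trans ?_ hw1
    refine Finset.sum_subset (Finset.filter_subset _ _) fun y hy hn => hwz y hy fun h => ?_
    exact hn (Finset.mem_filter.2 ⟨hy, h⟩)
  · refine Eq.trans ?_ hwx
    refine Finset.sum_subset (Finset.filter_subset _ _) fun y hy hn => ?_
    rw [hwz y hy fun h => hn (Finset.mem_filter.2 ⟨hy, h⟩), zero_smul]

theorem hull_eq {S0 : Finset (Pt N)} {L : Pt N × ℝ →ₗ[ℝ] ℝ} (h0 : ∀ s ∈ S0, 0 ≤ L (s, 1)) :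
    convexHull ℝ (S0.filter (fun s => L (s, 1) = 0) : Set (Pt N)) =
      {x ∈ convexHull ℝ (S0 : Set (Pt N)) | L (x, 1) = 0} := by
  ext x
  constructor
  · intro hx
    refine ⟨convexHull_mono (by exact_mod_cast Finset.filter_subset _ _) hx, ?_⟩
    have h1 := (hull_val (S0 := S0.filter (fun s => L (s, 1) = 0)) (L := L)
      (fun s hs => (Finset.mem_filter.1 hs).2.ge) hx).1
    have h2 := (hull_val (S0 := S0.filter (fun s => L (s, 1) = 0)) (L := -L)
      (fun s hs => by simp [(Finset.mem_filter.1 hs).2]) hx).1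
    rw [LinearMap.neg_apply] at h2
    linarith
  · rintro ⟨hx, h⟩
    exact (hull_val h0 hx).2 h

theorem psi_spec {S0 : Finset (Pt N)} {T : Finset (Pt N × ℝ)} (hT : CFace (up S0) T)
    (hne : T.Nonempty) : IsFaceOf (convexHull ℝ (S0 : Set (Pt N))) (psi S0 T) ∧
      faceDim (psi S0 T) = (rk T : ℤ) - 1 ∧ phi S0 (psi S0 T) = T := by
  have hTS := hT.subset
  obtain ⟨L, h1, h2⟩ := id hT
  have h0 : ∀ s ∈ S0, 0 ≤ L (s, 1) := fun s hs => h1 _ (mem_up.2 hs)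
  have hdn : dn S0 T = S0.filter (fun s => L (s, 1) = 0) := by
    ext x
    simp only [dn, Finset.mem_filter, h2, mem_up]
    tauto
  have hpsi : psi S0 T = {x ∈ convexHull ℝ (S0 : Set (Pt N)) | L (x, 1) = 0} := by
    rw [psi, hdn, hull_eq h0]
  obtain ⟨z, hz⟩ := hne
  obtain ⟨p, hp, rfl⟩ := Finset.mem_image.1 (hTS hz)
  have hpz : L (p, 1) = 0 := ((h2 _).1 hz).2
  have hpP : p ∈ convexHull ℝ (S0 : Set (Pt N)) := subset_convexHull ℝ _ hp
  refine ⟨fun _ => ⟨LinearMap.toContinuousLinearMap (-(L ∘ₗ LinearMap.inl ℝ (Pt N) ℝ)), ?_⟩, ?_, ?_⟩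
  · have hsplit : ∀ x, L (x, 1) = L (x, 0) + L (0, 1) := fun x => by
      rw [← map_add]; simp
    rw [hpsi]
    ext x
    simp only [Set.mem_ofPred_eq, and_congr_right_iff]
    intro hx
    simp only [LinearMap.coe_toContinuousLinearMap', LinearMap.neg_apply, LinearMap.comp_apply,
      LinearMap.inl_apply]
    constructor
    · intro hx0 y hy
      have := (hull_val h0 hy).1
      rw [hsplit] at this hx0
      linarith
    · intro h
      have h3 := h p hpP
      have h4 := (hull_val h0 hx).1
      rw [hsplit] at hpz h4 ⊢
      linarith
  · have hne : (dn S0 T).Nonempty := ⟨p, Finset.mem_filter.2 ⟨hp, hz⟩⟩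
    rw [psi, faceDim_hull _ hne, up_dn hTS]
  · have : S0.filter (fun x => x ∈ psi S0 T) = dn S0 T := by
      rw [hdn]
      ext x
      rw [Finset.mem_filter, Finset.mem_filter, hpsi]
      simp only [Set.mem_ofPred_eq]
      constructor
      · rintro ⟨a, _, b⟩; exact ⟨a, b⟩
      · rintro ⟨a, b⟩; exact ⟨a, subset_convexHull ℝ _ a, b⟩
    rw [phi, this, up_dn hTS]

theorem phi_spec {S0 : Finset (Pt N)} {F : Set (Pt N)}
    (hF : IsFaceOf (convexHull ℝ (S0 : Set (Pt N))) F) (hne : F.Nonempty) :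
    CFace (up S0) (phi S0 F) ∧ psi S0 (phi S0 F) = F ∧ (phi S0 F).Nonempty := by
  obtain ⟨l, hl⟩ := hF hne
  obtain ⟨p, hp⟩ := hne
  have hp' := hp
  rw [hl] at hp'
  set L : Pt N × ℝ →ₗ[ℝ] ℝ :=
    (l p) • LinearMap.snd ℝ (Pt N) ℝ - (l : Pt N →ₗ[ℝ] ℝ) ∘ₗ LinearMap.fst ℝ (Pt N) ℝ with hL
  have hLx : ∀ x, L (x, 1) = l p - l x := fun x => by simp [hL]
  have h0 : ∀ s ∈ S0, 0 ≤ L (s, 1) := fun s hs => by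
    rw [hLx]
    have := hp'.2 s (subset_convexHull ℝ _ hs)
    linarith
  have hFL : F = {x ∈ convexHull ℝ (S0 : Set (Pt N)) | L (x, 1) = 0} := by
    rw [hl]
    ext x
    simp only [Set.mem_ofPred_eq, and_congr_right_iff]
    intro hx
    rw [hLx]
    constructor
    · intro h
      have h1 := h p hp'.1
      have h2 := hp'.2 x hx
      linarith
    · intro h y hy
      have := hp'.2 y hy
      linarith
  have hfil : S0.filter (fun x => x ∈ F) = S0.filter (fun s => L (s, 1) = 0) := by
    ext x
    rw [hFL]
    simp only [Finset.mem_filter, Set.mem_ofPred_eq]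
    constructor
    · rintro ⟨a, _, b⟩; exact ⟨a, b⟩
    · rintro ⟨a, b⟩; exact ⟨a, subset_convexHull ℝ _ a, b⟩
  have hpsi : psi S0 (phi S0 F) = F := by
    rw [psi, phi, dn_up (Finset.filter_subset _ _), hfil, hull_eq h0, ← hFL]
  refine ⟨⟨L, ?_, ?_⟩, hpsi, ?_⟩
  · intro s hs
    obtain ⟨x, hx, rfl⟩ := Finset.mem_image.1 hs
    exact h0 x hx
  · intro s
    rw [phi, hfil]
    constructor
    · intro hs
      obtain ⟨x, hx, rfl⟩ := Finset.mem_image.1 hs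
      exact ⟨mem_up.2 (Finset.mem_filter.1 hx).1, (Finset.mem_filter.1 hx).2⟩
    · rintro ⟨hs, hz⟩
      obtain ⟨x, hx, rfl⟩ := Finset.mem_image.1 hs
      exact mem_up.2 (Finset.mem_filter.2 ⟨hx, hz⟩)
  · by_contra hc
    rw [Finset.not_nonempty_iff_eq_empty] at hc
    rw [← hpsi, psi, hc] at hp
    simp [dn] at hp

theorem phi_mono {S0 : Finset (Pt N)} {F G : Set (Pt N)} (h : F ⊆ G) : phi S0 F ⊆ phi S0 G :=
  Finset.image_subset_image (Finset.monotone_filter_right _ fun _ _ hx => h hx)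

theorem psi_mono {S0 : Finset (Pt N)} {T U : Finset (Pt N × ℝ)} (h : T ⊆ U) :
    psi S0 T ⊆ psi S0 U :=
  convexHull_mono (by
    intro x hx
    obtain ⟨a, b⟩ := Finset.mem_filter.1 (Finset.mem_coe.1 hx)
    exact Finset.mem_coe.2 (Finset.mem_filter.2 ⟨a, h b⟩))

end Transport

theorem chain_of_conn {α : Type*} {r : α → α → Prop} {a b : α} (h : Relation.ReflTransGen r a b) :
    ∃ (m : ℕ) (c : ℕ → α), c 0 = a ∧ c m = b ∧ ∀ i < m, r (c i) (c (i + 1)) := by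
  induction h with
  | refl => exact ⟨0, fun _ => a, rfl, rfl, by simp⟩
  | @tail x y _ hxy ih =>
    obtain ⟨m, c, h0, hm, hc⟩ := ih
    refine ⟨m + 1, fun i => if i ≤ m then c i else y, by simp [h0], by simp, fun i hi => ?_⟩
    rcases Nat.lt_succ_iff_lt_or_eq.1 hi with h | h
    · have h1 : i ≤ m := h.le
      have h2 : i + 1 ≤ m := h
      simp only [h1, h2, if_true]
      exact hc i h
    · subst h
      simp [hm, hxy]

/-- The hypergraph `H_k(P)` of `k`-faces vs `(k+1)`-faces of a
`d`-polytope `P` is strongly `(d-k)`-vertex connected. -/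
theorem hypergraph_strongly_connected {N d k : ℕ} (P : Set (Pt N))
    (hP : IsPolytope P) (hd : faceDim P = d) (hk : k + 1 ≤ d)
    (B : Set (Set (Pt N))) (hBfaces : ∀ b ∈ B, IsKFaceOf k P b)
    (hBfin : B.Finite) (hBcard : B.ncard < d - k)
    (F G : Set (Pt N)) (hF : IsKFaceOf k P F) (hG : IsKFaceOf k P G)
    (hFB : F ∉ B) (hGB : G ∉ B) :
    ∃ (m : ℕ) (c : Fin (m + 1) → Set (Pt N)),
      c 0 = F ∧ c (Fin.last m) = G ∧
      (∀ i, IsKFaceOf k P (c i) ∧ c i ∉ B) ∧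
      (∀ i : Fin m, ∃ T : Set (Pt N), IsKFaceOf (k + 1) P T ∧
        c i.castSucc ⊆ T ∧ c i.succ ⊆ T ∧ ∀ b ∈ B, ¬ b ⊆ T) := by
  obtain ⟨S1, hS1, rfl⟩ := hP
  obtain ⟨S0, rfl⟩ := hS1.exists_finset_coe
  have hne : ∀ {j : ℕ} {X : Set (Pt N)}, faceDim X = j → X.Nonempty := by
    intro j X h
    rw [Set.nonempty_iff_ne_empty]
    rintro rfl
    simp [faceDim] at h
  have hS0 : S0.Nonempty := by
    have := hne hd
    rw [convexHull_nonempty_iff] at this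
    exact_mod_cast this
  have hrS : rk (up S0) = d + 1 := by
    rw [faceDim_hull S0 hS0] at hd
    omega
  have hrk0 : rk (∅ : Finset (Pt N × ℝ)) = 0 := by simp [rk]
  -- transport of faces
  have hφ : ∀ {j : ℕ} {X : Set (Pt N)}, IsKFaceOf j (convexHull ℝ (S0 : Set (Pt N))) X →
      CFace (up S0) (phi S0 X) ∧ rk (phi S0 X) = j + 1 ∧ psi S0 (phi S0 X) = X := by
    intro j X hX
    obtain ⟨h1, h2, h3⟩ := phi_spec hX.1 (hne hX.2)
    have h4 := (psi_spec h1 h3).2.1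
    rw [h2, hX.2] at h4
    exact ⟨h1, by omega, h2⟩
  have hψ : ∀ {j : ℕ} {T : Finset (Pt N × ℝ)}, CFace (up S0) T → rk T = j + 1 →
      IsKFaceOf j (convexHull ℝ (S0 : Set (Pt N))) (psi S0 T) ∧ phi S0 (psi S0 T) = T := by
    intro j T hT hr
    have hTn : T.Nonempty := by
      rw [Finset.nonempty_iff_ne_empty]
      rintro rfl
      rw [hrk0] at hr
      omega
    obtain ⟨h1, h2, h3⟩ := psi_spec hT hTn
    exact ⟨⟨h1, by rw [h2, hr]; push_cast; ring⟩, h3⟩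
  set B' : Finset (Finset (Pt N × ℝ)) := hBfin.toFinset.image (phi S0) with hB'
  have hB'card : B'.card ≤ B.ncard := by
    rw [Set.ncard_eq_toFinset_card B hBfin]
    exact Finset.card_image_le
  have hB'mem : ∀ b ∈ B, phi S0 b ∈ B' := fun b hb =>
    Finset.mem_image_of_mem _ (hBfin.mem_toFinset.2 hb)
  have hB'of : ∀ b' ∈ B', ∃ b ∈ B, phi S0 b = b' := fun b' hb' => by
    obtain ⟨b, hb, h⟩ := Finset.mem_image.1 hb'
    exact ⟨b, hBfin.mem_toFinset.1 hb, h⟩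
  have hgood : ∀ X, IsKFaceOf k (convexHull ℝ (S0 : Set (Pt N))) X → X ∉ B →
      Good (up S0) B' (k + 1) (phi S0 X) := by
    intro X hX hXB
    obtain ⟨h1, h2, h3⟩ := hφ hX
    refine ⟨h1, h2, fun b' hb' hsub => ?_⟩
    obtain ⟨b, hb, rfl⟩ := hB'of b' hb'
    obtain ⟨g1, g2, g3⟩ := hφ (hBfaces b hb)
    have := g1.eq_of_rk h1.subset hsub (by omega)
    apply hXB
    rw [← h3, ← this, g3]
    exact hb
  have hempty : Good (up S0) B' (rk (∅ : Finset (Pt N × ℝ))) ∅ := by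
    refine ⟨⟨LinearMap.snd ℝ (Pt N) ℝ, ?_, ?_⟩, rfl, fun b' hb' hsub => ?_⟩
    · intro s hs
      obtain ⟨x, hx, rfl⟩ := Finset.mem_image.1 hs
      simp
    · intro s
      simp only [Finset.notMem_empty, false_iff, not_and]
      intro hs
      obtain ⟨x, hx, rfl⟩ := Finset.mem_image.1 hs
      simp
    · obtain ⟨b, hb, rfl⟩ := hB'of b' hb'
      have h2 := (hφ (hBfaces b hb)).2.1
      rw [Finset.subset_empty.1 hsub, hrk0] at h2
      omega
  have hconn := config_main (up S0) B' (k + 1) (by omega) (k + 1) ∅ hempty (by omega)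
    (phi S0 F) (phi S0 G) (hgood F hF hFB) (hgood G hG hGB) (by simp) (by simp)
  obtain ⟨m, c, hc0, hcm, hc⟩ := chain_of_conn hconn
  have hcg : ∀ i ≤ m, Good (up S0) B' (k + 1) (c i) := by
    intro i hi
    rcases hi.eq_or_lt with h | h
    · rw [h, hcm]; exact hgood G hG hGB
    · exact (hc i h).1
  refine ⟨m, fun i => psi S0 (c i), ?_, ?_, ?_, ?_⟩
  · simp [hc0, (hφ hF).2.2]
  · simp [hcm, (hφ hG).2.2]
  · intro i
    have hg := hcg i (Nat.lt_succ_iff.1 i.2)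
    obtain ⟨h1, h2⟩ := hψ hg.1 hg.2.1
    refine ⟨h1, fun hB => ?_⟩
    have := hB'mem _ hB
    rw [h2] at this
    exact hg.2.2 _ this subset_rfl
  · intro i
    obtain ⟨_, _, T, hT, h1, h2⟩ := hc i i.2
    obtain ⟨h3, h4⟩ := hψ hT.1 hT.2.1
    refine ⟨psi S0 T, h3, ?_, ?_, fun b hb hbT => ?_⟩
    · simpa using psi_mono (S0 := S0) h1
    · simpa using psi_mono (S0 := S0) h2
    · have := phi_mono (S0 := S0) hbT
      rw [h4] at this
      exact hT.2.2 _ (hB'mem b hb) this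
end

section
/- For every d-dimensional polytope Q and every integer k with 0 ≤ k ≤ d−1, the k-skeleton of Q is (k+1)-connected through codimension one: for every set B of fewer than k+1 k-faces of Q and any two k-faces F, F′ of Q not in B, there is a sequence F = G_1, G_2, …, G_ℓ = F′ of k-faces of Q, none belonging to B, such that for each i the intersection G_i ∩ G_{i+1} is a (k−1)-dimensional face of Q that is not contained in any face belonging to B. -/
open Set Classical

namespace SkelAux

set_option linter.unusedSectionVars false

section abstractPart

variable {V : Type*} [NormedAddCommGroup V] [InnerProductSpace ℝ V] [FiniteDimensional ℝ V]

/-- The polar of a finite set. -/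
def pol (T : Finset V) : Set V := {a | ∀ t ∈ T, inner ℝ a t ≤ 1}

/-- Vertices of the polar; they index the facets. -/
def PA (T : Finset V) : Set V := extremePoints ℝ (pol T)

/-- The finite set is spanning and has centroid zero. -/
structure Good (T : Finset V) : Prop where
  sum : ∑ t ∈ T, t = 0
  span : Submodule.span ℝ (T : Set V) = ⊤

/-- The convex hull. -/
def CH (T : Finset V) : Set V := convexHull ℝ (T : Set V)

/-- The facet of a polar vertex. -/
def Ph (T : Finset V) (a : V) : Set V := {z | z ∈ CH T ∧ inner ℝ a z = 1}

theorem eq_of_inner_eq {T : Set V} (h : Submodule.span ℝ T = ⊤) {a b : V}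
    (hab : ∀ t ∈ T, inner ℝ a t = inner ℝ b t) : a = b := by
  have h1 : ∀ v : V, inner ℝ (a - b) v = 0 := by
    intro v
    have hv : v ∈ Submodule.span ℝ T := by rw [h]; trivial
    induction hv using Submodule.span_induction with
    | mem x hx => rw [inner_sub_left, hab x hx, sub_self]
    | zero => simp
    | add x y _ _ hx hy => rw [inner_add_right, hx, hy, add_zero]
    | smul r x _ hx => rw [inner_smul_right, hx, mul_zero]
  have := h1 (a - b)
  rw [inner_self_eq_zero] at this
  exact sub_eq_zero.mp this

theorem exists_pos {T : Finset V} (hT : Good T) {c : V} (hc : c ≠ 0) :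
    ∃ t ∈ T, 0 < inner ℝ c t := by
  by_contra hcon
  push Not at hcon
  have hs : ∑ t ∈ T, inner ℝ c t = 0 := by
    rw [← inner_sum, hT.sum, inner_zero_right]
  have := (Finset.sum_eq_zero_iff_of_nonpos hcon).1 hs
  apply hc
  apply eq_of_inner_eq hT.span
  intro t ht
  rw [this t (by simpa using ht), inner_zero_left]

theorem pol_convex (T : Finset V) : Convex ℝ (pol T) := by
  intro x hx y hy r s hr hs hrs t ht
  rw [inner_add_left, inner_smul_left, inner_smul_left]
  have h1 := hx t ht
  have h2 := hy t ht
  simp only [conj_trivial]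
  nlinarith

theorem pol_compact {T : Finset V} (hT : Good T) : IsCompact (pol T) := by
  let f : V →ₗ[ℝ] (T → ℝ) := LinearMap.pi (fun t => innerₗ V (t : V))
  have hf : ∀ a t, f a t = inner ℝ (a : V) (t : V) := by
    intro a t
    simp [f, real_inner_comm]
  have hker : LinearMap.ker f = ⊥ := by
    rw [LinearMap.ker_eq_bot']
    intro a ha
    apply eq_of_inner_eq hT.span
    intro t ht
    have := congrFun ha ⟨t, by simpa using ht⟩
    rw [hf] at this
    simpa using this
  have hemb := LinearMap.isClosedEmbedding_of_injective hker
  have hK : IsCompact (Set.pi Set.univ (fun _ : T => Set.Icc (-(T.card : ℝ)) 1)) :=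
    isCompact_univ_pi (fun _ => isCompact_Icc)
  have := hemb.isCompact_preimage hK
  convert this using 1
  ext a
  simp only [pol, Set.mem_ofPred_eq, Set.mem_preimage, Set.mem_pi, Set.mem_univ, forall_true_left,
    Set.mem_Icc, hf, Subtype.forall]
  constructor
  · intro h t ht
    refine ⟨?_, h t ht⟩
    have hs : ∑ t ∈ T, inner ℝ a t = 0 := by
      rw [← inner_sum, hT.sum, inner_zero_right]
    rw [← Finset.add_sum_erase T _ ht] at hs
    have h2 : ∑ x ∈ T.erase t, inner ℝ a x ≤ ∑ x ∈ T.erase t, (1 : ℝ) :=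
      Finset.sum_le_sum (fun x hx => h x (Finset.mem_of_mem_erase hx))
    have h3 : ∑ x ∈ T.erase t, (1 : ℝ) ≤ T.card := by
      simp only [Finset.sum_const, nsmul_eq_mul, mul_one]
      exact_mod_cast Finset.card_le_card (Finset.erase_subset _ _)
    linarith
  · intro h t ht
    exact (h t ht).2

theorem zero_mem_pol (T : Finset V) : (0 : V) ∈ pol T := by
  intro t _
  simp

/-- The maximum of a linear functional on the polar is attained at a vertex. -/
theorem exists_max {T : Finset V} (hT : Good T) (y : V) :
    ∃ a ∈ PA T, ∀ p ∈ pol T, inner ℝ p y ≤ inner ℝ a y := by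
  have hex : IsExposed ℝ (pol T) {x ∈ pol T | ∀ p ∈ pol T, (innerSL ℝ y) p ≤ (innerSL ℝ y) x} :=
    fun _ => ⟨innerSL ℝ y, rfl⟩
  have hne : {x ∈ pol T | ∀ p ∈ pol T, (innerSL ℝ y) p ≤ (innerSL ℝ y) x}.Nonempty := by
    obtain ⟨x, hx, hm⟩ := (pol_compact hT).exists_isMaxOn ⟨0, zero_mem_pol T⟩
      ((innerSL ℝ y).continuous.continuousOn)
    exact ⟨x, hx, fun p hp => hm hp⟩
  obtain ⟨a, ha⟩ := (hex.isCompact (pol_compact hT)).extremePoints_nonempty hne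
  refine ⟨a, hex.isExtreme.extremePoints_subset_extremePoints ha, fun p hp => ?_⟩
  have := (extremePoints_subset ha).2 p hp
  simpa [real_inner_comm] using this

theorem PA_sub {T : Finset V} {a : V} (ha : a ∈ PA T) : a ∈ pol T := extremePoints_subset ha

theorem exists_PA_pos {T : Finset V} (hT : Good T) {y : V} (hy : y ≠ 0) :
    ∃ a ∈ PA T, 0 < inner ℝ a y := by
  obtain ⟨a, ha, hm⟩ := exists_max hT y
  refine ⟨a, ha, ?_⟩
  obtain ⟨M, hM⟩ : ∃ M : ℝ, ∀ t ∈ T, inner ℝ y t ≤ M := by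
    refine ⟨∑ t ∈ T, |inner ℝ y t|, fun t ht => (le_abs_self _).trans ?_⟩
    exact Finset.single_le_sum (f := fun t => |inner ℝ y t|) (fun _ _ => abs_nonneg _) ht
  have hM' : 0 < |M| + 1 := by positivity
  have := hm ((|M| + 1)⁻¹ • y) (by
    intro t ht
    rw [inner_smul_left, conj_trivial, inv_mul_le_iff₀ hM']
    have := hM t ht
    have := le_abs_self M
    linarith)
  refine lt_of_lt_of_le ?_ this
  rw [inner_smul_left, conj_trivial]
  have : 0 < inner ℝ y y := real_inner_self_pos.mpr hy
  positivity

theorem inner_le_one {T : Finset V} {p z : V} (hp : p ∈ pol T) (hz : z ∈ CH T) :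
    inner ℝ p z ≤ 1 := by
  have : CH T ⊆ {z | innerSL ℝ p z ≤ 1} := by
    refine convexHull_min ?_ ?_
    · intro t ht
      simpa using hp t (by simpa using ht)
    · exact convex_halfSpace_le (innerSL ℝ p).toLinearMap.isLinear 1
  simpa using this hz

theorem zero_mem_CH {T : Finset V} (hT : Good T) (hne : T.Nonempty) : (0 : V) ∈ CH T := by
  have hc : (T.card : ℝ) ≠ 0 := by
    exact_mod_cast (Finset.card_pos.mpr hne).ne'
  have := (convex_convexHull ℝ (T : Set V)).sum_mem (t := T) (w := fun _ => (T.card : ℝ)⁻¹)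
    (z := fun t => t) (fun _ _ => by positivity) (by simp [hc])
    (fun t ht => subset_convexHull ℝ _ (by simpa using ht))
  rw [← Finset.smul_sum, hT.sum, smul_zero] at this
  exact this

/-- The bipolar theorem. -/
theorem mem_CH {T : Finset V} (hT : Good T) (hne : T.Nonempty) {x : V}
    (hx : ∀ a ∈ PA T, inner ℝ a x ≤ 1) : x ∈ CH T := by
  by_contra hcon
  have hcl : IsClosed (CH T) := (Set.Finite.isCompact_convexHull ℝ T.finite_toSet).isClosed
  obtain ⟨f, u, h1, h2⟩ := geometric_hahn_banach_closed_point (convex_convexHull ℝ _) hcl hcon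
  have hu : 0 < u := by simpa using h1 0 (zero_mem_CH hT hne)
  set w := (InnerProductSpace.toDual ℝ V).symm f with hw
  have hfw : ∀ z, f z = inner ℝ w z := by
    intro z
    rw [hw, InnerProductSpace.toDual_symm_apply]
  obtain ⟨a, ha, hm⟩ := exists_max hT x
  have h3 := hm (u⁻¹ • w) (by
    intro t ht
    rw [inner_smul_left, conj_trivial, inv_mul_le_iff₀ hu, mul_one, ← hfw]
    exact (h1 t (subset_convexHull ℝ _ (by simpa using ht))).le)
  have h4 : 1 < inner ℝ (u⁻¹ • w) x := by
    rw [inner_smul_left, conj_trivial, ← hfw, lt_inv_mul_iff₀ hu, mul_one]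
    exact h2
  have := hx a ha
  linarith

theorem tight_span {T : Finset V} {a : V} (ha : a ∈ PA T) :
    Submodule.span ℝ {t : V | t ∈ T ∧ inner ℝ a t = 1} = ⊤ := by
  by_contra hcon
  set K := Submodule.span ℝ {t : V | t ∈ T ∧ inner ℝ a t = 1} with hK
  have hKo : Kᗮ ≠ ⊥ := by
    intro h
    exact hcon (Submodule.orthogonal_eq_bot_iff.mp h)
  obtain ⟨w, hw, hw0⟩ := Submodule.exists_mem_ne_zero_of_ne_bot hKo
  -- small perturbation
  have hev : ∀ᶠ e in nhds (0 : ℝ), ∀ t ∈ T, inner ℝ a t ≠ 1 → inner ℝ (a + e • w) t < 1 := by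
    rw [Filter.eventually_all_finset]
    intro t ht
    by_cases h1 : inner ℝ a t = 1
    · exact Filter.Eventually.of_forall (fun _ h => (h h1).elim)
    · have hlt : inner ℝ a t < 1 := lt_of_le_of_ne (PA_sub ha t ht) h1
      have hcont : Continuous (fun e : ℝ => inner ℝ (a + e • w) t) := by fun_prop
      have := hcont.tendsto 0
      simp only [zero_smul, add_zero] at this
      filter_upwards [this.eventually_lt_const hlt] with e he _ using he
  have hmem : ∀ᶠ e in nhds (0 : ℝ), a + e • w ∈ pol T := by
    filter_upwards [hev] with e he t ht
    by_cases h1 : inner ℝ a t = 1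
    · have : inner ℝ w t = 0 := by
        rw [real_inner_comm]
        exact hw t (Submodule.subset_span ⟨ht, h1⟩)
      rw [inner_add_left, inner_smul_left, this, h1]
      simp
    · exact (he t ht h1).le
  have hmem2 : ∀ᶠ e in nhds (0 : ℝ), a + (-e) • w ∈ pol T := by
    have : Filter.Tendsto (fun e : ℝ => -e) (nhds 0) (nhds 0) := by
      simpa using (continuous_neg (G := ℝ)).tendsto 0
    exact this.eventually hmem
  obtain ⟨e, ⟨h1, h2⟩, he⟩ := ((hmem.and hmem2).filter_mono nhdsWithin_le_nhds |>.and
    (self_mem_nhdsWithin : Set.Ioi (0 : ℝ) ∈ nhdsWithin 0 (Set.Ioi 0))).exists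
  have hseg : a ∈ openSegment ℝ (a + e • w) (a + (-e) • w) := by
    refine ⟨1/2, 1/2, by norm_num, by norm_num, by norm_num, ?_⟩
    module
  have := (mem_extremePoints.mp ha).2 _ h1 _ h2 hseg
  have h3 : e • w = 0 := by simpa using this.1
  rcases smul_eq_zero.mp h3 with h | h
  · exact (ne_of_gt he) h
  · exact hw0 h

theorem PA_finite (T : Finset V) : (PA T).Finite := by
  refine Set.Finite.of_finite_image (f := fun a => {t : V | t ∈ T ∧ inner ℝ a t = 1}) ?_ ?_
  · refine (T.finite_toSet.finite_subsets).subset ?_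
    rintro _ ⟨a, _, rfl⟩
    intro t ht
    simpa using ht.1
  · intro a ha b hb hab
    apply eq_of_inner_eq (tight_span ha)
    intro t ht
    have h2 : t ∈ {t : V | t ∈ T ∧ inner ℝ b t = 1} := by
      have hab' : {t : V | t ∈ T ∧ inner ℝ a t = 1} = {t : V | t ∈ T ∧ inner ℝ b t = 1} := hab
      rw [← hab']; exact ht
    rw [ht.2, h2.2]

/-- A point where exactly one facet is active. -/
theorem exists_center {T : Finset V} [Nontrivial V] {a : V} (ha : a ∈ PA T) :
    ∃ x, inner ℝ a x = 1 ∧ (∀ p ∈ pol T, p ≠ a → inner ℝ p x < 1) ∧ x ∈ CH T := by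
  set Ta := T.filter (fun t => inner ℝ a t = 1) with hTa
  have hspan := tight_span ha
  have hTaS : {t : V | t ∈ T ∧ inner ℝ a t = 1} = (Ta : Set V) := by
    ext t; simp [hTa]
  rw [hTaS] at hspan
  have hne : Ta.Nonempty := by
    rw [Finset.nonempty_iff_ne_empty]
    intro h
    rw [h] at hspan
    simp at hspan
  have hc : (0 : ℝ) < Ta.card := by exact_mod_cast Finset.card_pos.mpr hne
  have hin : ∀ p : V, inner ℝ p ((Ta.card : ℝ)⁻¹ • ∑ t ∈ Ta, t) =
      (Ta.card : ℝ)⁻¹ * ∑ t ∈ Ta, inner ℝ p t := by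
    intro p
    rw [inner_smul_right, inner_sum]
  refine ⟨(Ta.card : ℝ)⁻¹ • ∑ t ∈ Ta, t, ?_, ?_, ?_⟩
  · rw [hin, Finset.sum_congr rfl (fun t ht => (Finset.mem_filter.mp ht).2)]
    simp only [Finset.sum_const, nsmul_eq_mul, mul_one]; exact inv_mul_cancel₀ hc.ne'
  · intro p hp hpa
    rw [hin, inv_mul_lt_iff₀ hc, mul_one]
    have hle : ∀ t ∈ Ta, inner ℝ p t ≤ 1 := fun t ht => hp t (Finset.mem_filter.mp ht).1
    have : ∑ t ∈ Ta, inner ℝ p t < ∑ t ∈ Ta, (1 : ℝ) := by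
      refine Finset.sum_lt_sum hle ?_
      by_contra hcon
      push Not at hcon
      apply hpa
      apply eq_of_inner_eq hspan
      intro t ht
      have ht' : t ∈ Ta := by simpa using ht
      rw [(Finset.mem_filter.mp ht').2]
      exact le_antisymm (hle t ht') (hcon t ht')
    simpa using this
  · rw [Finset.smul_sum]
    refine (convex_convexHull ℝ (T : Set V)).sum_mem (fun _ _ => by positivity) ?_ ?_
    · simp only [Finset.sum_const, nsmul_eq_mul]; exact mul_inv_cancel₀ hc.ne'
    · intro t ht
      exact subset_convexHull ℝ _ (by simpa using (Finset.mem_filter.mp ht).1)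

/-- Dimension of a face from a relative interior point. -/
theorem vectorSpan_face {T : Finset V} (hT : Good T) (hne : T.Nonempty) (D : Set V) {y : V}
    (hy : ∀ a ∈ PA T, inner ℝ a y ≤ 1) (hD : ∀ a ∈ D, inner ℝ a y = 1)
    (hD' : ∀ a ∈ PA T, inner ℝ a y = 1 → a ∈ D) :
    vectorSpan ℝ {z | z ∈ CH T ∧ ∀ a ∈ D, inner ℝ a z = 1} = (Submodule.span ℝ D)ᗮ := by
  have hy0 : y ∈ {z | z ∈ CH T ∧ ∀ a ∈ D, inner ℝ a z = 1} := ⟨mem_CH hT hne hy, hD⟩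
  apply le_antisymm
  · rw [vectorSpan_def, Submodule.span_le]
    rintro _ ⟨u, hu, v, hv, rfl⟩
    simp only [SetLike.mem_coe, Submodule.mem_orthogonal]
    intro w hw
    induction hw using Submodule.span_induction with
    | mem x hx => rw [vsub_eq_sub, inner_sub_right, hu.2 x hx, hv.2 x hx, sub_self]
    | zero => simp
    | add x y _ _ hx hy => rw [inner_add_left, hx, hy, add_zero]
    | smul r x _ hx => rw [inner_smul_left, hx, mul_zero]
  · intro w hw
    have hwD : ∀ a ∈ D, inner ℝ a w = 0 := fun a ha => hw a (Submodule.subset_span ha)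
    have hev : ∀ᶠ e in nhds (0 : ℝ), ∀ a ∈ PA T, inner ℝ a (y + e • w) ≤ 1 := by
      rw [Filter.eventually_all_finite (PA_finite T)]
      intro a ha
      by_cases h1 : inner ℝ a y = 1
      · refine Filter.Eventually.of_forall (fun e => ?_)
        rw [inner_add_right, inner_smul_right, hwD a (hD' a ha h1), h1]
        simp
      · have hlt : inner ℝ a y < 1 := lt_of_le_of_ne (hy a ha) h1
        have hcont : Continuous (fun e : ℝ => inner ℝ a (y + e • w)) := by fun_prop
        have := hcont.tendsto 0
        simp only [zero_smul, add_zero] at this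
        filter_upwards [this.eventually_lt_const hlt] with e he using he.le
    obtain ⟨e, h1, he⟩ := (hev.filter_mono nhdsWithin_le_nhds |>.and
      (self_mem_nhdsWithin : Set.Ioi (0 : ℝ) ∈ nhdsWithin 0 (Set.Ioi 0))).exists
    have he' : (0 : ℝ) < e := he
    have hmem : y + e • w ∈ {z | z ∈ CH T ∧ ∀ a ∈ D, inner ℝ a z = 1} := by
      refine ⟨mem_CH hT hne h1, fun a ha => ?_⟩
      rw [inner_add_right, inner_smul_right, hwD a ha, hD a ha]
      simp
    have h2 := vsub_mem_vectorSpan ℝ hmem hy0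
    rw [vsub_eq_sub, add_sub_cancel_left] at h2
    have h3 := Submodule.smul_mem _ e⁻¹ h2
    rwa [smul_smul, inv_mul_cancel₀ he'.ne', one_smul] at h3

/-- There is a nonzero vector on which few polar points agree. -/
theorem exists_c {ι : Type*} [Fintype ι] (hcard : Fintype.card ι < Module.finrank ℝ V)
    (f : ι → V) : ∃ c : V, c ≠ 0 ∧ ∀ i, inner ℝ (f i) c = 0 := by
  have h1 : Submodule.span ℝ (Set.range f) ≠ ⊤ := by
    intro h
    have := finrank_range_le_card (R := ℝ) f
    rw [Set.finrank, h, finrank_top] at this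
    omega
  have hKo : (Submodule.span ℝ (Set.range f))ᗮ ≠ ⊥ := by
    intro h
    exact h1 (Submodule.orthogonal_eq_bot_iff.mp h)
  obtain ⟨c, hc, hc0⟩ := Submodule.exists_mem_ne_zero_of_ne_bot hKo
  exact ⟨c, hc0, fun i => hc _ (Submodule.subset_span ⟨i, rfl⟩)⟩

theorem PA_card {T : Finset V} (hT : Good T) [Nontrivial V] :
    Module.finrank ℝ V < (PA T).ncard := by
  by_contra hcon
  push Not at hcon
  obtain ⟨a0, ha0, _⟩ := exists_max hT (0 : V)
  have hfin := PA_finite T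
  set A' := (PA T) \ {a0} with hA'
  have hfin' : A'.Finite := hfin.subset Set.sdiff_subset
  have : Fintype A' := hfin'.fintype
  have hlt : A'.ncard < (PA T).ncard := by
    rw [hA']
    exact Set.ncard_sdiff_singleton_lt_of_mem ha0 hfin
  have hc : Fintype.card A' < Module.finrank ℝ V := by
    rw [← Nat.card_eq_fintype_card, Nat.card_coe_set_eq]
    omega
  obtain ⟨c, hc0, hc⟩ := exists_c hc (fun a : A' => (a : V) - a0)
  have heq : ∀ a ∈ PA T, inner ℝ a c = inner ℝ a0 c := by
    intro a ha
    by_cases h : a = a0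
    · rw [h]
    · have := hc ⟨a, ha, h⟩
      rw [inner_sub_left] at this
      linarith
  obtain ⟨a1, ha1, h1⟩ := exists_PA_pos hT hc0
  obtain ⟨a2, ha2, h2⟩ := exists_PA_pos hT (neg_ne_zero.mpr hc0)
  rw [inner_neg_right] at h2
  rw [heq a1 ha1] at h1
  rw [heq a2 ha2] at h2
  linarith

/-- Every proper face that is not the facet of `a0` lies in another facet. -/
theorem exists_other {T : Finset V} (hT : Good T) {b : Set V}
    (hb : IsExposed ℝ (CH T) b) (hbQ : ¬ CH T ⊆ b) {a0 : V}
    (h0 : ¬ Ph T a0 ⊆ b ∨ a0 ∉ pol T) : ∃ a ∈ PA T, a ≠ a0 ∧ b ⊆ Ph T a := by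
  set Nb : Set V := {p | p ∈ pol T ∧ ∀ z ∈ b, inner ℝ p z = 1} with hNb
  have hbsub : b ⊆ CH T := hb.subset
  have hext : IsExtreme ℝ (pol T) Nb := by
    refine ⟨fun p hp => hp.1, ?_⟩
    intro x hx y hy z hz hseg
    refine ⟨hx, fun w hw => ?_⟩
    obtain ⟨r, s, hr, hs, hrs, rfl⟩ := hseg
    have h1 := hz.2 w hw
    rw [inner_add_left, inner_smul_left, inner_smul_left, conj_trivial, conj_trivial] at h1
    have h2 := inner_le_one hx (hbsub hw)
    have h3 := inner_le_one hy (hbsub hw)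
    nlinarith
  have hconv : Convex ℝ Nb := by
    intro x hx y hy r s hr hs hrs
    refine ⟨pol_convex T hx.1 hy.1 hr hs hrs, fun z hz => ?_⟩
    rw [inner_add_left, inner_smul_left, inner_smul_left, hx.2 z hz, hy.2 z hz]
    simpa using hrs
  have hcomp : IsCompact Nb := by
    have : Nb = pol T ∩ ⋂ z ∈ b, {p | inner ℝ p z = 1} := by
      ext p; simp [hNb]
    rw [this]
    refine (pol_compact hT).inter_right (isClosed_biInter fun z _ => ?_)
    exact isClosed_eq (by fun_prop) continuous_const
  -- a point of `Nb` different from `a0`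
  obtain ⟨β, hβ, hβ0⟩ : ∃ β ∈ Nb, β ≠ a0 := by
    by_cases hbe : b.Nonempty
    · obtain ⟨l, hl⟩ := hb hbe
      set w := (InnerProductSpace.toDual ℝ V).symm l with hw
      have hlw : ∀ z, l z = inner ℝ w z := by
        intro z
        rw [hw, InnerProductSpace.toDual_symm_apply]
      have hw0 : w ≠ 0 := by
        intro h
        apply hbQ
        intro z hz
        rw [hl]
        refine ⟨hz, fun y _ => ?_⟩
        rw [hlw, hlw, h]
        simp
      obtain ⟨t, ht, htp⟩ := exists_pos hT hw0
      obtain ⟨x, hx⟩ := hbe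
      have hx' := hx
      rw [hl] at hx'
      set m := l x with hm
      have hmpos : 0 < m := by
        have := hx'.2 t (subset_convexHull ℝ _ (by simpa using ht))
        rw [hlw t] at this
        linarith
      have hmem : m⁻¹ • w ∈ Nb := by
        refine ⟨fun s hs => ?_, fun z hz => ?_⟩
        · rw [inner_smul_left, conj_trivial, inv_mul_le_iff₀ hmpos, mul_one, ← hlw]
          exact hx'.2 s (subset_convexHull ℝ _ (by simpa using hs))
        · rw [inner_smul_left, conj_trivial, ← hlw, inv_mul_eq_one₀ hmpos.ne']
          rw [hl] at hz
          exact le_antisymm (hz.2 x hx'.1) (hx'.2 z hz.1)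
      refine ⟨m⁻¹ • w, hmem, ?_⟩
      rintro rfl
      replace h0 := h0.resolve_right (not_not.mpr hmem.1)
      apply h0
      intro z hz
      rw [hl]
      refine ⟨hz.1, fun y hy => ?_⟩
      have h1 := hz.2
      rw [inner_smul_left, conj_trivial, ← hlw, inv_mul_eq_one₀ hmpos.ne'] at h1
      rw [← h1]
      exact hx'.2 y hy
    · rw [Set.not_nonempty_iff_eq_empty] at hbe
      refine ⟨0, ⟨zero_mem_pol T, by simp [hbe]⟩, ?_⟩
      rintro rfl
      replace h0 := h0.resolve_right (not_not.mpr (zero_mem_pol T))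
      apply h0
      intro z hz
      have := hz.2
      simp at this
  by_contra hcon
  push Not at hcon
  have hsub : (extremePoints ℝ Nb : Set V) ⊆ {a0} := by
    intro a ha
    by_contra hne
    have ha1 : a ∈ PA T := hext.extremePoints_subset_extremePoints ha
    exact hcon a ha1 hne (fun z hz => ⟨hbsub hz, (extremePoints_subset ha).2 z hz⟩)
  have h1 := closure_convexHull_extremePoints hcomp hconv
  have h2 : closure (convexHull ℝ (extremePoints ℝ Nb)) ⊆ {a0} := by
    refine closure_minimal ?_ isClosed_singleton
    exact convexHull_min hsub (convex_singleton a0)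
  rw [h1] at h2
  exact hβ0 (h2 hβ)

end abstractPart

end SkelAux

namespace SkelAux

section abstractPart

variable {V : Type*} [NormedAddCommGroup V] [InnerProductSpace ℝ V] [FiniteDimensional ℝ V]

theorem Ph_finrank {T : Finset V} (hT : Good T) (hne : T.Nonempty) [Nontrivial V] {a : V}
    (ha : a ∈ PA T) : (Ph T a).Nonempty ∧
      Module.finrank ℝ (vectorSpan ℝ (Ph T a)) + 1 = Module.finrank ℝ V := by
  obtain ⟨x, hx1, hx2, hx3⟩ := exists_center ha
  refine ⟨⟨x, hx3, hx1⟩, ?_⟩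
  have h := vectorSpan_face hT hne {a} (y := x) (fun p hp => inner_le_one (PA_sub hp) hx3)
    (by simpa using hx1) (by
      intro p hp hp1
      by_contra hpa
      have := hx2 p (PA_sub hp) hpa
      linarith)
  have h2 : Ph T a = {z | z ∈ CH T ∧ ∀ p ∈ ({a} : Set V), inner ℝ p z = 1} := by
    ext z; simp [Ph]
  rw [h2, h]
  have h3 := Submodule.finrank_add_finrank_orthogonal (Submodule.span ℝ ({a} : Set V))
  have ha0 : a ≠ 0 := by
    rintro rfl
    simp at hx1
  rw [finrank_span_singleton ha0] at h3
  omega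

theorem three_indep {T : Finset V} {a b c : V} (ha : a ∈ PA T) (hb : b ∈ PA T) (hc : c ∈ PA T)
    (hab : a ≠ b) (hac : a ≠ c) (hbc : b ≠ c) {r s : ℝ}
    (h : r • (a - b) + s • (a - c) = 0) : r = 0 ∧ s = 0 := by
  have hnc : ¬ Collinear ℝ {a, b, c} := by
    intro hcol
    have ha' := (mem_extremePoints_iff_forall_segment.mp ha)
    have hb' := (mem_extremePoints_iff_forall_segment.mp hb)
    have hc' := (mem_extremePoints_iff_forall_segment.mp hc)
    rcases hcol.wbtw_or_wbtw_or_wbtw with h | h | h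
    · rcases hb'.2 a ha'.1 c hc'.1 (mem_segment_iff_wbtw.mpr h) with h | h
      · exact hab h
      · exact hbc h.symm
    · rcases hc'.2 b hb'.1 a ha'.1 (mem_segment_iff_wbtw.mpr h) with h | h
      · exact hbc h
      · exact hac h
    · rcases ha'.2 c hc'.1 b hb'.1 (mem_segment_iff_wbtw.mpr h) with h | h
      · exact hac h.symm
      · exact hab h.symm
  have hai := affineIndependent_iff_not_collinear_set.mpr hnc
  rw [affineIndependent_iff] at hai
  have := hai Finset.univ ![r + s, -r, -s] (by simp [Fin.sum_univ_three]) (by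
    simp only [Fin.sum_univ_three, Matrix.cons_val]
    rw [← h]
    module)
  have h1 := this 1 (Finset.mem_univ _)
  have h2 := this 2 (Finset.mem_univ _)
  simp at h1 h2
  exact ⟨h1, h2⟩

theorem exists_avoid {Z : Set V} (hZ : Z.Finite) (h0 : ∀ z ∈ Z, z ≠ 0) {x : V} {O : Set V}
    (hO : O ∈ nhds x) : ∃ p ∈ O, ∀ z ∈ Z, inner ℝ z p ≠ 0 := by
  have hd : Dense (⋂ z ∈ Z, {p : V | inner ℝ z p ≠ 0}) := by
    refine dense_biInter_of_isOpen ?_ hZ.countable ?_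
    · intro z _
      exact isOpen_ne_fun (by fun_prop) continuous_const
    · intro z hz
      have : {p : V | inner ℝ z p ≠ 0} = ((LinearMap.ker (innerₗ V z) : Submodule ℝ V) : Set V)ᶜ := by
        ext p; simp
      rw [this, ← interior_eq_empty_iff_dense_compl]
      by_contra hne
      rw [← ne_eq, ← Set.nonempty_iff_ne_empty] at hne
      have htop := Submodule.eq_top_of_nonempty_interior' _ hne
      have : z ∈ LinearMap.ker (innerₗ V z) := by rw [htop]; trivial
      simp at this
      exact h0 z hz this
  obtain ⟨p, hp, hpO⟩ := (hd.inter_nhds_nonempty hO)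
  refine ⟨p, hpO, fun z hz => ?_⟩
  have := Set.mem_iInter₂.mp hp z hz
  exact this

theorem exists_generic (T : Finset V) {x x' c : V} {O O' W : Set V}
    (hO : O ∈ nhds x) (hO' : O' ∈ nhds x') (hW : W ∈ nhds c) :
    ∃ p ∈ O, ∃ p' ∈ O', ∃ q ∈ W, ∀ y ∈ segment ℝ p q ∪ segment ℝ p' q,
      ∀ a ∈ PA T, ∀ b ∈ PA T, ∀ d ∈ PA T, a ≠ b → a ≠ d → b ≠ d →
        ¬ (inner ℝ a y = inner ℝ b y ∧ inner ℝ a y = inner ℝ d y) := by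
  have hfin := PA_finite T
  set Z : Set V := (fun w : V × V => w.1 - w.2) '' ((PA T ×ˢ PA T) ∩ {w | w.1 ≠ w.2}) with hZ
  have hZf : Z.Finite := ((hfin.prod hfin).subset Set.inter_subset_left).image _
  have hZ0 : ∀ z ∈ Z, z ≠ 0 := by
    rintro _ ⟨w, ⟨_, hw⟩, rfl⟩
    exact sub_ne_zero.mpr hw
  obtain ⟨p, hpO, hp⟩ := exists_avoid hZf hZ0 hO
  obtain ⟨p', hpO', hp'⟩ := exists_avoid hZf hZ0 hO'
  have hpz : ∀ a ∈ PA T, ∀ b ∈ PA T, a ≠ b → inner ℝ (a - b) p ≠ 0 :=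
    fun a ha b hb hab => hp _ ⟨(a, b), ⟨⟨ha, hb⟩, hab⟩, rfl⟩
  have hpz' : ∀ a ∈ PA T, ∀ b ∈ PA T, a ≠ b → inner ℝ (a - b) p' ≠ 0 :=
    fun a ha b hb hab => hp' _ ⟨(a, b), ⟨⟨ha, hb⟩, hab⟩, rfl⟩
  let g : V → V × V × V → V := fun p w =>
    (inner ℝ (w.1 - w.2.1) p) • (w.1 - w.2.2) - (inner ℝ (w.1 - w.2.2) p) • (w.1 - w.2.1)
  let J : Set (V × V × V) := (PA T ×ˢ PA T ×ˢ PA T) ∩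
    {w | w.1 ≠ w.2.1 ∧ w.1 ≠ w.2.2 ∧ w.2.1 ≠ w.2.2}
  have hJ : J.Finite := (hfin.prod (hfin.prod hfin)).subset Set.inter_subset_left
  have hg0 : ∀ p : V, (∀ a ∈ PA T, ∀ b ∈ PA T, a ≠ b → inner ℝ (a - b) p ≠ 0) →
      ∀ w ∈ J, g p w ≠ 0 := by
    rintro p hpz ⟨a, b, d⟩ ⟨⟨ha, hb, hd⟩, hab, had, hbd⟩ h0
    have : (-inner ℝ (a - d) p) • (a - b) + (inner ℝ (a - b) p) • (a - d) = 0 := by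
      rw [← h0]
      simp only [g]
      module
    exact hpz a ha b hb hab (three_indep ha hb hd hab had hbd this).2
  obtain ⟨q, hqW, hq⟩ := exists_avoid (Z := g p '' J ∪ g p' '' J)
    ((hJ.image _).union (hJ.image _)) (by
      rintro z (⟨w, hw, rfl⟩ | ⟨w, hw, rfl⟩)
      · exact hg0 p hpz w hw
      · exact hg0 p' hpz' w hw) hW
  have key : ∀ p : V, (∀ w ∈ J, inner ℝ (g p w) q ≠ 0) → ∀ y ∈ segment ℝ p q,
      ∀ a ∈ PA T, ∀ b ∈ PA T, ∀ d ∈ PA T, a ≠ b → a ≠ d → b ≠ d →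
        ¬ (inner ℝ a y = inner ℝ b y ∧ inner ℝ a y = inner ℝ d y) := by
    rintro p hp y ⟨r, s, hr, hs, hrs, rfl⟩ a ha b hb d hd hab had hbd ⟨h1, h2⟩
    apply hp (a, b, d) ⟨⟨ha, hb, hd⟩, hab, had, hbd⟩
    have e1 : r * inner ℝ (a - b) p + s * inner ℝ (a - b) q = 0 := by
      simp only [inner_add_right, inner_smul_right, inner_sub_left] at h1 ⊢
      linarith
    have e2 : r * inner ℝ (a - d) p + s * inner ℝ (a - d) q = 0 := by
      simp only [inner_add_right, inner_smul_right, inner_sub_left] at h2 ⊢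
      linarith
    have e3 : inner ℝ (g p (a, b, d)) q =
        inner ℝ (a - b) p * inner ℝ (a - d) q - inner ℝ (a - d) p * inner ℝ (a - b) q := by
      simp only [g]
      rw [inner_sub_left, inner_smul_left, inner_smul_left]
      simp
    rw [e3]
    set A := inner ℝ (a - b) p
    set B := inner ℝ (a - d) p
    set C := inner ℝ (a - b) q
    set D := inner ℝ (a - d) q
    have f1 : r * (A * D - B * C) = 0 := by linear_combination D * e1 - C * e2
    have f2 : s * (A * D - B * C) = 0 := by linear_combination A * e2 - B * e1
    calc A * D - B * C = (r + s) * (A * D - B * C) := by rw [hrs, one_mul]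
      _ = 0 := by rw [add_mul, f1, f2, add_zero]
  refine ⟨p, hpO, p', hpO', q, hqW, ?_⟩
  rintro y (hy | hy)
  · exact key p (fun w hw => hq _ (Or.inl ⟨w, hw, rfl⟩)) y hy
  · exact key p' (fun w hw => hq _ (Or.inr ⟨w, hw, rfl⟩)) y hy

theorem seg_nhds {U : Set V} (hU : IsOpen U) {x c : V} (h : segment ℝ x c ⊆ U) :
    ∃ δ > 0, ∀ p ∈ Metric.ball x δ, ∀ q ∈ Metric.ball c δ, segment ℝ p q ⊆ U := by
  have hcomp : IsCompact (segment ℝ x c) := by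
    rw [segment_eq_image_lineMap]
    exact isCompact_Icc.image AffineMap.lineMap_continuous
  obtain ⟨δ, hδ, hsub⟩ := hcomp.exists_thickening_subset_open hU h
  refine ⟨δ, hδ, ?_⟩
  rintro p hp q hq _ ⟨r, s, hr, hs, hrs, rfl⟩
  apply hsub
  rw [Metric.mem_thickening_iff]
  refine ⟨r • x + s • c, ⟨r, s, hr, hs, hrs, rfl⟩, ?_⟩
  rw [Metric.mem_ball, dist_eq_norm] at hp hq
  rw [dist_eq_norm]
  have e : r • p + s • q - (r • x + s • c) = r • (p - x) + s • (q - c) := by module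
  rw [e]
  refine lt_of_le_of_lt (norm_add_le _ _) ?_
  rw [norm_smul, norm_smul, Real.norm_of_nonneg hr, Real.norm_of_nonneg hs]
  have : s = 1 - r := by linarith
  subst this
  rcases hr.eq_or_lt with h | h
  · rw [← h]; simpa using hq
  · nlinarith

/-- Being active at a point. -/
def Act (T : Finset V) (a y : V) : Prop := a ∈ PA T ∧ ∀ p ∈ PA T, inner ℝ p y ≤ inner ℝ a y

theorem path_of_connected {T : Finset V} (hT : Good T) {K : Set V} (hK : IsPreconnected K)
    {a0 a1 p p' : V} (hp : p ∈ K) (hp' : p' ∈ K) (h0 : Act T a0 p) (h1 : Act T a1 p') :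
    Relation.ReflTransGen (fun a b => ∃ y ∈ K, Act T a y ∧ Act T b y) a0 a1 := by
  set R : V → V → Prop := fun a b => ∃ y ∈ K, Act T a y ∧ Act T b y with hR
  set C : Set V := {a | Relation.ReflTransGen R a0 a} with hC
  have hclosed : ∀ D : Set V, IsClosed {y | ∃ a ∈ PA T ∩ D, Act T a y} := by
    intro D
    have : {y | ∃ a ∈ PA T ∩ D, Act T a y} =
        ⋃ a ∈ PA T ∩ D, ⋂ p ∈ PA T, {y | inner ℝ p y ≤ inner ℝ a y} := by
      ext y
      simp only [Set.mem_ofPred_eq, Set.mem_iUnion, Set.mem_iInter, Act, exists_prop]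
      constructor
      · rintro ⟨a, ha, _, h⟩; exact ⟨a, ha, h⟩
      · rintro ⟨a, ha, h⟩; exact ⟨a, ha, ha.1, h⟩
    rw [this]
    refine Set.Finite.isClosed_biUnion ((PA_finite T).subset Set.inter_subset_left) fun a _ => ?_
    refine isClosed_biInter fun p _ => ?_
    exact isClosed_le (by fun_prop) (by fun_prop)
  by_contra hcon
  obtain ⟨y, hy, ⟨a, ha, haa⟩, ⟨b, hb, hbb⟩⟩ := (isPreconnected_closed_iff.mp hK) _ _
    (hclosed C) (hclosed Cᶜ) (by
      intro y _
      obtain ⟨a, ha, hm⟩ := exists_max hT y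
      by_cases haC : a ∈ C
      · exact Or.inl ⟨a, ⟨ha, haC⟩, ha, fun p hp => hm p (PA_sub hp)⟩
      · exact Or.inr ⟨a, ⟨ha, haC⟩, ha, fun p hp => hm p (PA_sub hp)⟩)
    ⟨p, hp, a0, ⟨h0.1, Relation.ReflTransGen.refl⟩, h0⟩
    ⟨p', hp', a1, ⟨h1.1, hcon⟩, h1⟩
  exact hb.2 (Relation.ReflTransGen.tail ha.2 ⟨y, hy, haa, hbb⟩)

theorem seg_avoid {T : Finset V} {x c a0 e s : V} (h0 : a0 ∈ PA T) (hs : s ∈ PA T)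
    (h1 : inner ℝ e x < inner ℝ a0 x) (h2 : inner ℝ e c ≤ inner ℝ a0 c)
    (h3 : inner ℝ e c < inner ℝ s c) {y : V} (hy : y ∈ segment ℝ x c) :
    ∃ a ∈ PA T, inner ℝ e y < inner ℝ a y := by
  obtain ⟨r, t, hr, ht, hrt, rfl⟩ := hy
  rcases hr.eq_or_lt with h | h
  · refine ⟨s, hs, ?_⟩
    have : t = 1 := by linarith
    simp [← h, this, h3]
  · refine ⟨a0, h0, ?_⟩
    simp only [inner_add_right, inner_smul_right]
    nlinarith

theorem abs_path {T : Finset V} (hT : Good T) (hne : T.Nonempty) (hd : 2 ≤ Module.finrank ℝ V)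
    {m : ℕ} (hm : m < Module.finrank ℝ V) (b : Fin m → Set V)
    (hb : ∀ i, IsExposed ℝ (CH T) (b i)) {a0 a1 : V} (ha0 : a0 ∈ PA T) (ha1 : a1 ∈ PA T)
    (h0 : ∀ i, ¬ Ph T a0 ⊆ b i) (h1 : ∀ i, ¬ Ph T a1 ⊆ b i) :
    Relation.ReflTransGen (fun a a' => a ∈ PA T ∧ a' ∈ PA T ∧ (Ph T a ∩ Ph T a').Nonempty ∧
      (∀ i, ¬ (Ph T a ∩ Ph T a') ⊆ b i) ∧
      Module.finrank ℝ (vectorSpan ℝ (Ph T a ∩ Ph T a' : Set V)) + 2 = Module.finrank ℝ V) a0 a1 := by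
  have : Nontrivial V := Module.nontrivial_of_finrank_pos (R := ℝ) (by omega)
  -- choice of facets
  have hch : ∀ i, ∃ e f, (e ∈ PA T ∧ f ∈ PA T) ∧ e ≠ a0 ∧ f ≠ a1 ∧ b i ⊆ Ph T e ∧ b i ⊆ Ph T f ∧
      (f = e ∨ f = a0) := by
    intro i
    have hQ : ¬ CH T ⊆ b i := fun h => h0 i (fun z hz => h hz.1)
    obtain ⟨e, he, he0, heb⟩ := exists_other hT (hb i) hQ (Or.inl (h0 i))
    obtain ⟨f, hf, hf1, hfb⟩ := exists_other hT (hb i) hQ (Or.inl (h1 i))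
    by_cases h : e = a1
    · by_cases h' : f = a0
      · exact ⟨e, f, ⟨he, hf⟩, he0, hf1, heb, hfb, Or.inr h'⟩
      · exact ⟨f, f, ⟨hf, hf⟩, h', hf1, hfb, hfb, Or.inl rfl⟩
    · exact ⟨e, e, ⟨he, he⟩, he0, h, heb, heb, Or.inl rfl⟩
  choose e f hef he0 hf1 heb hfb hfe using hch
  obtain ⟨c0, hc0, hcc0⟩ := exists_c (by simpa using hm) (fun i => e i - a0)
  have hcc0' : ∀ i, inner ℝ (e i) c0 = inner ℝ a0 c0 := by
    intro i
    have := hcc0 i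
    rw [inner_sub_left] at this
    linarith
  obtain ⟨c, hc, hcs, s, hs, hsc⟩ : ∃ c : V, (∀ i, inner ℝ (e i) c = inner ℝ a0 c) ∧
      inner ℝ a0 c ≤ inner ℝ a1 c ∧ ∃ s ∈ PA T, inner ℝ a0 c < inner ℝ s c := by
    have hneg : ∀ i, inner ℝ (e i) (-c0) = inner ℝ a0 (-c0) := by
      intro i
      rw [inner_neg_right, inner_neg_right, hcc0' i]
    rcases lt_trichotomy (inner ℝ a0 c0) (inner ℝ a1 c0) with h | h | h
    · exact ⟨c0, hcc0', h.le, a1, ha1, h⟩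
    · rcases le_or_gt (inner ℝ a0 c0) 0 with h' | h'
      · obtain ⟨s, hs, hsc⟩ := exists_PA_pos hT hc0
        exact ⟨c0, hcc0', h.le, s, hs, by linarith⟩
      · obtain ⟨s, hs, hsc⟩ := exists_PA_pos hT (neg_ne_zero.mpr hc0)
        refine ⟨-c0, hneg, ?_, s, hs, ?_⟩
        · rw [inner_neg_right, inner_neg_right, h]
        · rw [inner_neg_right a0]; linarith
    · have h2 : inner ℝ a0 (-c0) < inner ℝ a1 (-c0) := by
        rw [inner_neg_right, inner_neg_right]; linarith
      exact ⟨-c0, hneg, h2.le, a1, ha1, h2⟩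
  obtain ⟨x, hx1, hx2, -⟩ := exists_center ha0
  obtain ⟨x', hx1', hx2', -⟩ := exists_center ha1
  set U : Set V := {y | ∀ i, ∃ a ∈ PA T, b i ⊆ Ph T a ∧ ∃ a' ∈ PA T, inner ℝ a y < inner ℝ a' y}
    with hU
  have hUo : IsOpen U := by
    have : U = ⋂ i, ⋃ a ∈ PA T, ⋃ (_ : b i ⊆ Ph T a), ⋃ a' ∈ PA T,
        {y | inner ℝ a y < inner ℝ a' y} := by
      ext y
      simp only [hU, Set.mem_ofPred_eq, Set.mem_iInter, Set.mem_iUnion, exists_prop]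
    rw [this]
    refine isOpen_iInter_of_finite fun i => isOpen_biUnion fun a _ => isOpen_iUnion fun _ =>
      isOpen_biUnion fun a' _ => isOpen_lt (by fun_prop) (by fun_prop)
  have hs1 : segment ℝ x c ⊆ U := by
    intro y hy i
    refine ⟨e i, (hef i).1, heb i, seg_avoid ha0 hs ?_ (hc i).le ?_ hy⟩
    · rw [hx1]; exact hx2 _ (PA_sub (hef i).1) (he0 i)
    · rw [hc i]; exact hsc
  have hs2 : segment ℝ x' c ⊆ U := by
    intro y hy i
    have hfc : inner ℝ (f i) c = inner ℝ a0 c := by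
      rcases hfe i with h | h
      · rw [h]; exact hc i
      · rw [h]
    refine ⟨f i, (hef i).2, hfb i, seg_avoid ha1 hs ?_ (hfc.le.trans hcs) ?_ hy⟩
    · rw [hx1']; exact hx2' _ (PA_sub (hef i).2) (hf1 i)
    · rw [hfc]; exact hsc
  obtain ⟨δ, hδ, hseg⟩ := seg_nhds hUo hs1
  obtain ⟨δ', hδ', hseg'⟩ := seg_nhds hUo hs2
  have hact : ∀ (a x : V), a ∈ PA T → inner ℝ a x = 1 →
      (∀ p ∈ pol T, p ≠ a → inner ℝ p x < 1) → ∀ᶠ z in nhds x, Act T a z := by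
    intro a x ha hx1 hx2
    have : ∀ᶠ z in nhds x, ∀ p ∈ PA T, inner ℝ p z ≤ inner ℝ a z := by
      rw [Filter.eventually_all_finite (PA_finite T)]
      intro p hp
      by_cases hpa : p = a
      · subst hpa; exact Filter.Eventually.of_forall fun _ => le_rfl
      · have hlt : inner ℝ p x < inner ℝ a x := by rw [hx1]; exact hx2 p (PA_sub hp) hpa
        have hop : IsOpen {z : V | inner ℝ p z < inner ℝ a z} :=
          isOpen_lt (by fun_prop) (by fun_prop)
        filter_upwards [hop.mem_nhds hlt] with z hz
        exact le_of_lt hz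
    filter_upwards [this] with z hz using ⟨ha, hz⟩
  obtain ⟨p, hpO, p', hpO', q, hqW, hgen⟩ := exists_generic T
    (Filter.inter_mem (Metric.ball_mem_nhds x hδ) (hact a0 x ha0 hx1 hx2))
    (Filter.inter_mem (Metric.ball_mem_nhds x' hδ') (hact a1 x' ha1 hx1' hx2'))
    (Filter.inter_mem (Metric.ball_mem_nhds c hδ) (Metric.ball_mem_nhds c hδ'))
  have hKU : segment ℝ p q ∪ segment ℝ p' q ⊆ U :=
    Set.union_subset (hseg p hpO.1 q hqW.1) (hseg' p' hpO'.1 q hqW.2)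
  have hKc : IsPreconnected (segment ℝ p q ∪ segment ℝ p' q) :=
    IsPreconnected.union q (right_mem_segment ℝ p q) (right_mem_segment ℝ p' q)
      (convex_segment p q).isPreconnected (convex_segment p' q).isPreconnected
  have hpath := path_of_connected hT hKc (Or.inl (left_mem_segment ℝ p q))
    (Or.inr (left_mem_segment ℝ p' q)) hpO.2 hpO'.2
  clear hpO hpO'
  refine Relation.ReflTransGen.trans_induction_on
    (motive := fun {u v} _ => Relation.ReflTransGen _ u v) hpath
    (fun _ => Relation.ReflTransGen.refl) ?_ (fun _ _ h h' => h.trans h')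
  rintro a a' ⟨y, hy, hya, hya'⟩
  by_cases haa : a = a'
  · subst haa; exact Relation.ReflTransGen.refl
  apply Relation.ReflTransGen.single
  have hg := hgen y hy
  have heq : inner ℝ a y = inner ℝ a' y := le_antisymm (hya'.2 a hya.1) (hya.2 a' hya'.1)
  have hy0 : y ≠ 0 := by
    rintro rfl
    have hcard := PA_card hT
    obtain ⟨u, v, w, hu, hv, hw, huv, huw, hvw⟩ :=
      (Set.two_lt_ncard_iff (PA_finite T)).mp (by omega : 2 < (PA T).ncard)
    exact hg u hu v hv w hw huv huw hvw (by simp)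
  set h := inner ℝ a y with hh
  have hpos : 0 < h := by
    obtain ⟨u, hu, hupos⟩ := exists_PA_pos hT hy0
    exact lt_of_lt_of_le hupos (hya.2 u hu)
  have hin : ∀ u : V, inner ℝ u (h⁻¹ • y) = h⁻¹ * inner ℝ u y := by
    intro u; rw [inner_smul_right]
  have hz1 : inner ℝ a (h⁻¹ • y) = 1 := by
    rw [hin, ← hh, inv_mul_cancel₀ hpos.ne']
  have hz2 : inner ℝ a' (h⁻¹ • y) = 1 := by
    rw [hin, ← heq, inv_mul_cancel₀ hpos.ne']
  have hzle : ∀ u ∈ PA T, inner ℝ u (h⁻¹ • y) ≤ 1 := by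
    intro u hu
    rw [hin, inv_mul_le_iff₀ hpos, mul_one]
    exact hya.2 u hu
  have hzC : h⁻¹ • y ∈ CH T := mem_CH hT hne hzle
  have hzm : h⁻¹ • y ∈ Ph T a ∩ Ph T a' := ⟨⟨hzC, hz1⟩, ⟨hzC, hz2⟩⟩
  refine ⟨hya.1, hya'.1, ⟨_, hzm⟩, ?_, ?_⟩
  · intro i hsub
    obtain ⟨u, hu, hub, v, hv, huv⟩ := hKU hy i
    have h2 := (hub (hsub hzm)).2
    rw [hin, inv_mul_eq_one₀ hpos.ne'] at h2
    have := hya.2 v hv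
    linarith
  · have hface := vectorSpan_face hT hne {a, a'} (y := h⁻¹ • y) hzle
      (by rintro u (rfl | rfl); exacts [hz1, hz2]) (by
        intro u hu hu1
        by_contra hcon
        simp only [Set.mem_insert_iff, Set.mem_singleton_iff, not_or] at hcon
        rw [hin, inv_mul_eq_one₀ hpos.ne'] at hu1
        exact hg a hya.1 a' hya'.1 u hu haa (Ne.symm hcon.1) (Ne.symm hcon.2) ⟨heq, hu1⟩)
    have hset : (Ph T a ∩ Ph T a' : Set V) =
        {z | z ∈ CH T ∧ ∀ p ∈ ({a, a'} : Set V), inner ℝ p z = 1} := by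
      ext z
      simp only [Ph, Set.mem_inter_iff, Set.mem_ofPred_eq, Set.mem_insert_iff,
        Set.mem_singleton_iff, forall_eq_or_imp, forall_eq]
      tauto
    rw [hset, hface]
    have h3 := Submodule.finrank_add_finrank_orthogonal (Submodule.span ℝ ({a, a'} : Set V))
    have h4 : Module.finrank ℝ (Submodule.span ℝ ({a, a'} : Set V)) = 2 := by
      have hli : LinearIndependent ℝ ![a, a'] := by
        rw [LinearIndependent.pair_iff]
        intro r t hrt
        have e1 : r + t = 0 := by
          have := congrArg (fun v => inner ℝ v (h⁻¹ • y)) hrt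
          simp only [inner_add_left, inner_smul_left, conj_trivial, hz1, hz2, inner_zero_left] at this
          linarith
        have e2 : t = -r := by linarith
        subst e2
        have e3 : r • (a - a') = 0 := by
          rw [← hrt]; module
        rcases smul_eq_zero.mp e3 with h | h
        · simp [h]
        · exact (haa (sub_eq_zero.mp h)).elim
      have := finrank_span_eq_card hli
      rw [Matrix.range_cons_cons_empty] at this
      simpa using this
    omega

end abstractPart

end SkelAux

namespace SkelAux

section ambient

variable {N : ℕ}

theorem faceDim_of_nonempty {s : Set (Pt N)} (h : s.Nonempty) :
    faceDim s = (Module.finrank ℝ (vectorSpan ℝ s) : ℤ) := by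
  rw [faceDim, if_neg h.ne_empty, direction_affineSpan]

theorem nonempty_of_faceDim {s : Set (Pt N)} {n : ℕ} (h : faceDim s = n) : s.Nonempty := by
  by_contra hne
  rw [Set.not_nonempty_iff_eq_empty] at hne
  rw [faceDim, if_pos hne] at h
  omega

theorem eq_of_faceDim {F G : Set (Pt N)} (hex : IsExposed ℝ G F) (hne : F.Nonempty)
    (hdim : faceDim F = faceDim G) : F = G := by
  have hsub : F ⊆ G := hex.subset
  obtain ⟨x, hx⟩ := id hne
  rw [faceDim_of_nonempty hne, faceDim_of_nonempty (hne.mono hsub)] at hdim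
  have hvs : vectorSpan ℝ F = vectorSpan ℝ G :=
    Submodule.eq_of_le_of_finrank_eq (vectorSpan_mono ℝ hsub) (by exact_mod_cast hdim)
  obtain ⟨l, hl⟩ := hex hne
  refine hsub.antisymm fun y hy => ?_
  have hyx : y - x ∈ vectorSpan ℝ F := by
    rw [hvs]; exact vsub_mem_vectorSpan ℝ hy (hsub hx)
  have hker : vectorSpan ℝ F ≤ LinearMap.ker l.toLinearMap := by
    rw [vectorSpan_def, Submodule.span_le]
    rintro _ ⟨u, hu, v, hv, rfl⟩
    rw [hl] at hu hv
    have h1 := hu.2 v hv.1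
    have h2 := hv.2 u hu.1
    simp only [SetLike.mem_coe, LinearMap.mem_ker, vsub_eq_sub, map_sub]
    exact sub_eq_zero.mpr (le_antisymm h2 h1)
  have h0 : l y = l x := by
    have h := hker hyx
    rw [LinearMap.mem_ker, map_sub] at h
    exact sub_eq_zero.mp h
  rw [hl] at hx ⊢
  refine ⟨hy, fun z hz => ?_⟩
  rw [h0]
  exact hx.2 z hz

theorem hull_split {S G : Set (Pt N)} (hG : Convex ℝ G) (L : Pt N →L[ℝ] ℝ) (c : ℝ)
    (hGL : ∀ x ∈ G, L x = c) (hS : ∀ s ∈ S, L s < c ∨ s ∈ G) :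
    ∀ x ∈ convexHull ℝ S, L x < c ∨ x ∈ G := by
  have : convexHull ℝ S ⊆ {x | L x < c ∨ x ∈ G} := by
    refine convexHull_min hS ?_
    rw [convex_iff_forall_pos]
    rintro x hx y hy r s hr hs hrs
    have hle : ∀ z, (L z < c ∨ z ∈ G) → L z ≤ c := by
      rintro z (h | h)
      · exact h.le
      · exact (hGL z h).le
    have hc : c = r * c + s * c := by rw [← add_mul, hrs, one_mul]
    have hxl := hle x hx
    have hyl := hle y hy
    have hx' : L x < c ∨ x ∈ G := hx
    have hy' : L y < c ∨ y ∈ G := hy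
    change L (r • x + s • y) < c ∨ r • x + s • y ∈ G
    rcases hx' with hx' | hx'
    · left
      simp only [map_add, map_smul, smul_eq_mul]
      nlinarith
    · rcases hy' with hy' | hy'
      · left
        simp only [map_add, map_smul, smul_eq_mul]
        nlinarith
      · right
        exact hG hx' hy' hr.le hs.le hrs
  exact this

theorem polytope_convex {Q : Set (Pt N)} (hQ : IsPolytope Q) : Convex ℝ Q := by
  obtain ⟨S, _, rfl⟩ := hQ
  exact convex_convexHull ℝ S

theorem polytope_face {Q F : Set (Pt N)} (hQ : IsPolytope Q) (hF : IsExposed ℝ Q F) :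
    IsPolytope F := by
  rcases F.eq_empty_or_nonempty with h | hne
  · exact ⟨∅, Set.finite_empty, by simp [h]⟩
  have hFc : Convex ℝ F := hF.convex (polytope_convex hQ)
  obtain ⟨S, hS, rfl⟩ := hQ
  refine ⟨S ∩ F, hS.subset Set.inter_subset_left, ?_⟩
  have hsubF : convexHull ℝ (S ∩ F) ⊆ F := convexHull_min Set.inter_subset_right hFc
  refine Set.Subset.antisymm ?_ hsubF
  obtain ⟨l, hl⟩ := hF hne
  obtain ⟨g, hg⟩ := hne
  have hg' := hg
  rw [hl] at hg'
  have hval : ∀ x ∈ F, l x = l g := by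
    intro x hx
    rw [hl] at hx
    exact le_antisymm (hg'.2 x hx.1) (hx.2 g hg'.1)
  have := hull_split (S := S) (convex_convexHull ℝ (S ∩ F)) l (l g)
    (fun x hx => hval x (hsubF hx)) (by
      intro s hs
      have hsQ := subset_convexHull ℝ S hs
      rcases (hg'.2 s hsQ).lt_or_eq with h | h
      · exact Or.inl h
      · refine Or.inr (subset_convexHull ℝ _ ⟨hs, ?_⟩)
        rw [hl]
        exact ⟨hsQ, fun y hy => h ▸ hg'.2 y hy⟩)
  intro x hx
  rcases this x (hF.subset hx) with h | h
  · exact absurd (hval x hx) h.ne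
  · exact h

theorem face_trans {Q F G : Set (Pt N)} (hQ : IsPolytope Q) (hF : IsExposed ℝ Q F)
    (hG : IsExposed ℝ F G) : IsExposed ℝ Q G := by
  intro hne
  have hFc : Convex ℝ F := hF.convex (polytope_convex hQ)
  have hGc : Convex ℝ G := hG.convex hFc
  obtain ⟨S, hS, rfl⟩ := hQ
  obtain ⟨l2, hl2⟩ := hG hne
  obtain ⟨l1, hl1⟩ := hF (hne.mono hG.subset)
  obtain ⟨g, hg⟩ := hne
  have hgF := hG.subset hg
  have hg1 := hgF
  rw [hl1] at hg1
  have hg2 := hg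
  rw [hl2] at hg2
  have hval1 : ∀ x ∈ F, l1 x = l1 g := by
    intro x hx
    rw [hl1] at hx
    exact le_antisymm (hg1.2 x hx.1) (hx.2 g hg1.1)
  have hval2 : ∀ x ∈ G, l2 x = l2 g := by
    intro x hx
    rw [hl2] at hx
    exact le_antisymm (hg2.2 x hx.1) (hx.2 g hg2.1)
  obtain ⟨M, hM⟩ : ∃ M : ℝ, ∀ s ∈ S, s ∉ F → l2 s - l2 g < M * (l1 g - l1 s) := by
    have : ∀ᶠ M in (Filter.atTop : Filter ℝ), ∀ s ∈ S, s ∉ F →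
        l2 s - l2 g < M * (l1 g - l1 s) := by
      rw [Filter.eventually_all_finite hS]
      intro s hs
      by_cases hsF : s ∈ F
      · exact Filter.Eventually.of_forall fun _ h => (h hsF).elim
      · have hsQ := subset_convexHull ℝ S hs
        have hpos : 0 < l1 g - l1 s := by
          rcases (hg1.2 s hsQ).lt_or_eq with h | h
          · linarith
          · refine absurd ?_ hsF
            rw [hl1]
            exact ⟨hsQ, fun y hy => h ▸ hg1.2 y hy⟩
        filter_upwards [Filter.eventually_gt_atTop ((l2 s - l2 g) / (l1 g - l1 s))] with M hM _
        rwa [div_lt_iff₀ hpos] at hM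
    exact this.exists
  have key := hull_split (S := S) hGc (M • l1 + l2) ((M • l1 + l2) g)
    (by
      intro x hx
      simp [hval1 x (hG.subset hx), hval2 x hx])
    (by
      intro s hs
      by_cases hsF : s ∈ F
      · rcases (hg2.2 s hsF).lt_or_eq with h | h
        · left
          simp [hval1 s hsF, h]
        · right
          rw [hl2]
          exact ⟨hsF, fun y hy => h ▸ hg2.2 y hy⟩
      · left
        have := hM s hs hsF
        simp only [add_apply, smul_apply, smul_eq_mul]
        nlinarith)
  have hGL : ∀ x ∈ G, (M • l1 + l2) x = (M • l1 + l2) g := by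
    intro x hx
    simp [hval1 x (hG.subset hx), hval2 x hx]
  refine ⟨M • l1 + l2, ?_⟩
  ext x
  constructor
  · intro hx
    refine ⟨hF.subset (hG.subset hx), fun y hy => ?_⟩
    rw [hGL x hx]
    rcases key y hy with h | h
    · exact h.le
    · exact (hGL y h).le
  · rintro ⟨hx, hxm⟩
    rcases key x hx with h | h
    · exact absurd (hxm g hg1.1) (not_le.mpr h)
    · exact h

theorem facets_exist {Q : Set (Pt N)} (hQ : IsPolytope Q) {n : ℕ} (hd : faceDim Q = n)
    (hn : 1 ≤ n) : ∃ 𝓕 : Set (Set (Pt N)),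
      (∀ P ∈ 𝓕, IsExposed ℝ Q P ∧ faceDim P = (n : ℤ) - 1) ∧
      (∀ G, IsExposed ℝ Q G → ¬ Q ⊆ G → ∃ P ∈ 𝓕, G ⊆ P) ∧
      𝓕.Finite ∧ n < 𝓕.ncard ∧
      (2 ≤ n → ∀ (m : ℕ) (b : Fin m → Set (Pt N)), m < n → (∀ i, IsExposed ℝ Q (b i)) →
        ∀ P ∈ 𝓕, ∀ P' ∈ 𝓕, (∀ i, ¬ P ⊆ b i) → (∀ i, ¬ P' ⊆ b i) →
        Relation.ReflTransGen (fun X Y => X ∈ 𝓕 ∧ Y ∈ 𝓕 ∧ (∀ i, ¬ X ∩ Y ⊆ b i) ∧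
          faceDim (X ∩ Y) = (n : ℤ) - 2) P P') := by
  have hQne := nonempty_of_faceDim hd
  obtain ⟨S, hS, rfl⟩ := hQ
  have hSne : S.Nonempty := convexHull_nonempty_iff.mp hQne
  rw [faceDim, if_neg hQne.ne_empty, affineSpan_convexHull, direction_affineSpan] at hd
  have hd' : Module.finrank ℝ (vectorSpan ℝ S) = n := by exact_mod_cast hd
  set W := vectorSpan ℝ S with hW
  set S' := hS.toFinset with hS'
  have hmemS' : ∀ s, s ∈ S' ↔ s ∈ S := fun s => by simp [hS']
  have hS'ne : S'.Nonempty := by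
    obtain ⟨s, hs⟩ := hSne
    exact ⟨s, (hmemS' s).2 hs⟩
  have hcard : (0 : ℝ) < S'.card := by exact_mod_cast Finset.card_pos.mpr hS'ne
  set o : Pt N := (S'.card : ℝ)⁻¹ • ∑ s ∈ S', s with ho
  have hsub : ∀ s ∈ S, s - o ∈ W := by
    intro s hs
    have : s - o = (S'.card : ℝ)⁻¹ • ∑ s' ∈ S', (s - s') := by
      rw [Finset.sum_sub_distrib, smul_sub, ← ho, Finset.sum_const, ← Nat.cast_smul_eq_nsmul ℝ,
        smul_smul, inv_mul_cancel₀ hcard.ne', one_smul]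
    rw [this]
    refine Submodule.smul_mem _ _ (Submodule.sum_mem _ fun s' hs' => ?_)
    exact vsub_mem_vectorSpan ℝ hs ((hmemS' s').1 hs')
  let f : W →ᵃ[ℝ] Pt N := W.subtype.toAffineMap + AffineMap.const ℝ W o
  have hf : ∀ w : W, f w = (w : Pt N) + o := fun w => rfl
  have hflin : f.linear = W.subtype := by
    ext w
    simp [f]
  have hfinj : Function.Injective f := by
    intro u v huv
    rw [hf, hf] at huv
    exact Subtype.ext (add_right_cancel huv)
  let T : Finset W := S'.attach.image (fun s => ⟨s.1 - o, hsub s.1 ((hmemS' _).1 s.2)⟩)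
  have hTmem : ∀ w : W, w ∈ T ↔ f w ∈ S := by
    intro w
    simp only [T, Finset.mem_image, Finset.mem_attach, true_and, Subtype.exists, hf]
    constructor
    · rintro ⟨s, hs, rfl⟩
      simpa using (hmemS' _).1 hs
    · intro h
      exact ⟨w + o, (hmemS' _).2 h, Subtype.ext (by simp)⟩
  have hTS : f '' (T : Set W) = S := by
    ext s
    constructor
    · rintro ⟨w, hw, rfl⟩
      exact (hTmem w).1 (by simpa using hw)
    · intro hs
      refine ⟨⟨s - o, hsub s hs⟩, ?_, by rw [hf]; simp⟩
      rw [Finset.mem_coe, hTmem, hf]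
      simpa using hs
  have hTne : T.Nonempty := by
    obtain ⟨s, hs⟩ := hSne
    exact ⟨⟨s - o, hsub s hs⟩, (hTmem _).2 (by rw [hf]; simpa using hs)⟩
  have hT : Good T := by
    constructor
    · apply Subtype.ext
      rw [Finset.sum_image]
      · rw [AddSubmonoidClass.coe_finsetSum]
        simp only
        rw [Finset.sum_attach S' (fun s => s - o), Finset.sum_sub_distrib, Finset.sum_const, ho,
          ← Nat.cast_smul_eq_nsmul ℝ, smul_smul, mul_inv_cancel₀ hcard.ne', one_smul, sub_self]
        rfl
      · intro u _ v _ huv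
        have := congrArg Subtype.val huv
        exact Subtype.ext (sub_left_injective this)
    · rw [eq_top_iff]
      rintro w -
      have hle : W ≤ Submodule.map W.subtype (Submodule.span ℝ (T : Set W)) := by
        refine Submodule.span_le.mpr ?_
        rintro _ ⟨u, hu, v, hv, rfl⟩
        have hu' : (⟨u - o, hsub u hu⟩ : W) ∈ T := (hTmem _).2 (by rw [hf]; simpa using hu)
        have hv' : (⟨v - o, hsub v hv⟩ : W) ∈ T := (hTmem _).2 (by rw [hf]; simpa using hv)
        exact ⟨⟨u - o, hsub u hu⟩ - ⟨v - o, hsub v hv⟩,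
          Submodule.sub_mem _ (Submodule.subset_span hu') (Submodule.subset_span hv'), by simp⟩
      obtain ⟨v, hv, hvw⟩ := hle w.2
      have : v = w := Subtype.ext hvw
      rwa [← this]
  have hQim : convexHull ℝ S = f '' CH T := by
    rw [CH, AffineMap.image_convexHull, hTS]
  have hnt : Nontrivial W := Module.nontrivial_of_finrank_pos (R := ℝ) (by omega)
  have hdimim : ∀ G : Set W, G.Nonempty →
      faceDim (f '' G) = (Module.finrank ℝ (vectorSpan ℝ G) : ℤ) := by
    intro G hG
    rw [faceDim_of_nonempty (hG.image f), ← AffineMap.map_vectorSpan, hflin,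
      Submodule.finrank_map_subtype_eq]
  have hexp : ∀ b, IsExposed ℝ (convexHull ℝ S) b → IsExposed ℝ (CH T) (f ⁻¹' b) := by
    rintro b hb ⟨w, hw⟩
    obtain ⟨l, hl⟩ := hb ⟨_, hw⟩
    refine ⟨l.comp W.subtypeL, ?_⟩
    ext v
    rw [Set.mem_preimage, hl, hQim]
    simp only [Set.mem_ofPred_eq, Set.forall_mem_image, hfinj.mem_set_image]
    simp only [hf, map_add, add_le_add_iff_right,
      ContinuousLinearMap.comp_apply, Submodule.subtypeL_apply]
  have hPexp : ∀ a ∈ PA T, IsExposed ℝ (convexHull ℝ S) (f '' Ph T a) := by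
    intro a ha _
    refine ⟨innerSL ℝ (a : Pt N), ?_⟩
    obtain ⟨⟨x, hxC, hx1⟩, -⟩ := Ph_finrank hT hTne ha
    rw [hQim]
    ext y
    constructor
    · rintro ⟨w, hw, rfl⟩
      refine ⟨⟨w, hw.1, rfl⟩, ?_⟩
      rintro _ ⟨v, hv, rfl⟩
      have h1 := inner_le_one (PA_sub ha) hv
      have h2 := hw.2
      rw [Submodule.coe_inner] at h1 h2
      simp only [innerSL_apply_apply, hf, inner_add_right]
      linarith
    · rintro ⟨⟨w, hw, rfl⟩, hm⟩
      refine ⟨w, ⟨hw, ?_⟩, rfl⟩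
      have h1 := hm (f x) ⟨x, hxC, rfl⟩
      have h2 := inner_le_one (PA_sub ha) hw
      rw [Submodule.coe_inner] at h2 hx1 ⊢
      simp only [innerSL_apply_apply, hf, inner_add_right] at h1
      linarith
  refine ⟨(fun a => f '' Ph T a) '' PA T, ?_, ?_, (PA_finite T).image _, ?_, ?_⟩
  · rintro _ ⟨a, ha, rfl⟩
    refine ⟨hPexp a ha, ?_⟩
    obtain ⟨h1, h2⟩ := Ph_finrank hT hTne ha
    simp only
    rw [hdimim _ h1]
    omega
  · intro G hG hQG
    obtain ⟨a0, ha0⟩ : ∃ a0, a0 ∉ pol T := by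
      by_contra hcon
      push Not at hcon
      have h1 : pol T = Set.univ := Set.eq_univ_of_forall hcon
      have h2 := pol_compact hT
      rw [h1] at h2
      have := NormedSpace.noncompactSpace ℝ W
      exact noncompact_univ W h2
    obtain ⟨a, ha, -, hsubP⟩ := exists_other hT (hexp G hG) (by
      intro h
      apply hQG
      rw [hQim]
      exact Set.image_subset_iff.mpr h) (Or.inr ha0)
    refine ⟨_, ⟨a, ha, rfl⟩, ?_⟩
    intro x hx
    have hxQ := hG.subset hx
    rw [hQim] at hxQ
    obtain ⟨w, hw, rfl⟩ := hxQ
    exact ⟨w, hsubP hx, rfl⟩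
  · rw [Set.ncard_image_of_injOn, ← hd']
    · exact PA_card hT
    · intro a ha a' ha' haa
      have h1 : Ph T a = Ph T a' := Set.image_injective.mpr hfinj haa
      obtain ⟨x, hx1, hx2, hx3⟩ := exists_center ha
      by_contra hne
      have h2 := hx2 a' (PA_sub ha') (Ne.symm hne)
      have h3 : x ∈ Ph T a' := h1 ▸ ⟨hx3, hx1⟩
      exact h2.ne h3.2
  · rintro h2 m b hm hb _ ⟨a, ha, rfl⟩ _ ⟨a', ha', rfl⟩ hP hP'
    have hpath := abs_path hT hTne (by omega) (m := m) (by omega) (fun i => f ⁻¹' b i)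
      (fun i => hexp _ (hb i)) ha ha'
      (fun i h => hP i (Set.image_subset_iff.mpr h))
      (fun i h => hP' i (Set.image_subset_iff.mpr h))
    refine Relation.ReflTransGen.lift (fun a => f '' Ph T a) ?_ _ _ hpath
    rintro u v ⟨hu, hv, hne, hsubs, hfr⟩
    refine ⟨⟨u, hu, rfl⟩, ⟨v, hv, rfl⟩, ?_, ?_⟩
    · intro i h
      rw [← Set.image_inter hfinj] at h
      exact hsubs i (Set.image_subset_iff.mp h)
    · rw [← Set.image_inter hfinj, hdimim _ hne]
      omega

end ambient

end SkelAux

namespace SkelAux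

section skeleton

variable {N : ℕ}

/-- A proper face of dimension one less than the polytope is a member of the facet family. -/
theorem eq_facet {Q P G : Set (Pt N)} (hG : IsExposed ℝ Q G) (hne : G.Nonempty)
    (hP : IsExposed ℝ Q P) (hsub : G ⊆ P) (hdim : faceDim G = faceDim P) : G = P :=
  eq_of_faceDim (hG.mono hP.subset hsub) hne hdim

theorem exists_kface {k m : ℕ} (hk : 1 ≤ k) (hm : m ≤ k) (n : ℕ) (hn : k ≤ n) :
    ∀ (R : Set (Pt N)) (b : Fin m → Set (Pt N)), IsPolytope R → faceDim R = n →
      (∀ i, IsExposed ℝ R (b i)) → (∀ i, ¬ R ⊆ b i) →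
      ∃ K, IsExposed ℝ R K ∧ faceDim K = k ∧ ∀ i, ¬ K ⊆ b i := by
  induction n, hn using Nat.le_induction with
  | base =>
    intro R b _ hd _ hb
    exact ⟨R, IsExposed.refl R, hd, hb⟩
  | succ n hn ih =>
    intro R b hR hd hbe hb
    obtain ⟨𝓕, hF1, hF2, hF3, hF4, -⟩ := facets_exist hR hd (by omega)
    have hP : ∃ P ∈ 𝓕, ∀ i, ¬ P ⊆ b i := by
      by_contra hcon
      push Not at hcon
      have hne𝓕 : 𝓕.Nonempty := by
        rw [← Set.ncard_pos hF3]
        omega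
      obtain ⟨P0, hP0⟩ := hne𝓕
      have : Nonempty (Fin m) := ⟨(hcon P0 hP0).choose⟩
      choose! g hg using hcon
      obtain ⟨P, hP, P', hP', hne, hgg⟩ : ∃ P ∈ 𝓕, ∃ P' ∈ 𝓕, P ≠ P' ∧ g P = g P' := by
        by_contra hinj
        push Not at hinj
        have hio : Set.InjOn g 𝓕 := fun P hP P' hP' h => by
          by_contra hne
          exact hinj P hP P' hP' hne h
        have h1 := Set.ncard_le_ncard_of_injOn g (t := Set.univ) (fun _ _ => Set.mem_univ _) hio
          Set.finite_univ
        rw [Set.ncard_univ, Nat.card_fin] at h1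
        omega
      obtain ⟨P'', hP'', hsub⟩ := hF2 (b (g P)) (hbe _) (hb _)
      have h1 : ∀ X ∈ 𝓕, X ⊆ b (g P) → X = P'' := by
        intro X hX hXs
        have hXd := (hF1 X hX).2
        refine eq_facet (hF1 X hX).1 (nonempty_of_faceDim (n := n) ?_) (hF1 P'' hP'').1
          (hXs.trans hsub) ?_
        · rw [hXd]; push_cast; ring
        · rw [hXd, (hF1 P'' hP'').2]
      exact hne ((h1 P hP (hg P hP)).trans (h1 P' hP' (hgg ▸ hg P' hP')).symm)
    obtain ⟨P, hP, hPb⟩ := hP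
    obtain ⟨hPe, hPd⟩ := hF1 P hP
    obtain ⟨K, hK1, hK2, hK3⟩ := ih P (fun i => b i ∩ P) (polytope_face hR hPe)
      (by rw [hPd]; push_cast; ring)
      (fun i => ((hbe i).inter hPe).mono hPe.subset Set.inter_subset_right)
      (fun i h => hPb i (h.trans Set.inter_subset_left))
    exact ⟨K, face_trans hR hPe hK1, hK2,
      fun i h => hK3 i (Set.subset_inter h hK1.subset)⟩

/-- Adjacency of `k`-faces through a ridge that avoids the removed faces. -/
def Adj {m : ℕ} (k : ℕ) (Q : Set (Pt N)) (b : Fin m → Set (Pt N)) (X Y : Set (Pt N)) : Prop :=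
  IsKFaceOf k Q X ∧ IsKFaceOf k Q Y ∧ faceDim (X ∩ Y) = (k : ℤ) - 1 ∧ ∀ i, ¬ X ∩ Y ⊆ b i

theorem main_ind {k m : ℕ} (hk : 1 ≤ k) (hm : m ≤ k) (n : ℕ) (hn : k + 1 ≤ n) :
    ∀ (Q : Set (Pt N)) (b : Fin m → Set (Pt N)), IsPolytope Q → faceDim Q = n →
      (∀ i, IsExposed ℝ Q (b i)) → ∀ F F', IsKFaceOf k Q F → IsKFaceOf k Q F' →
      (∀ i, ¬ F ⊆ b i) → (∀ i, ¬ F' ⊆ b i) →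
      Relation.ReflTransGen (Adj k Q b) F F' := by
  induction n, hn using Nat.le_induction with
  | base =>
    intro Q b hQ hd hbe F F' hF hF' hFb hF'b
    obtain ⟨𝓕, hF1, hF2, hF3, hF4, hF5⟩ := facets_exist hQ hd (by omega)
    have hdim : ∀ P ∈ 𝓕, faceDim P = k := fun P hP => by
      rw [(hF1 P hP).2]; push_cast; ring
    have hmem : ∀ G, IsKFaceOf k Q G → G ∈ 𝓕 := by
      rintro G ⟨hG, hGd⟩
      have hG' : IsExposed ℝ Q G := hG
      obtain ⟨P, hP, hGP⟩ := hF2 G hG (fun h => by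
        have := h.antisymm hG'.subset
        rw [this, hGd] at hd
        push_cast at hd
        omega)
      rw [eq_facet hG (nonempty_of_faceDim hGd) (hF1 P hP).1 hGP (by rw [hGd, hdim P hP])]
      exact hP
    have hpath := hF5 (by omega) m b (by omega) hbe F (hmem F hF) F' (hmem F' hF') hFb hF'b
    refine Relation.ReflTransGen.mono ?_ _ _ hpath
    rintro X Y ⟨hX, hY, hXY, hXYd⟩
    refine ⟨⟨(hF1 X hX).1, hdim X hX⟩, ⟨(hF1 Y hY).1, hdim Y hY⟩, ?_, hXY⟩
    rw [hXYd]; push_cast; ring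
  | succ n hn ih =>
    intro Q b hQ hd hbe F F' hF hF' hFb hF'b
    obtain ⟨𝓕, hF1, hF2, hF3, hF4, hF5⟩ := facets_exist hQ hd (by omega)
    have hdim : ∀ P ∈ 𝓕, faceDim P = n := fun P hP => by
      rw [(hF1 P hP).2]; push_cast; ring
    have hsup : ∀ G, IsKFaceOf k Q G → ∃ P ∈ 𝓕, G ⊆ P := by
      rintro G ⟨hG, hGd⟩
      have hG' : IsExposed ℝ Q G := hG
      refine hF2 G hG (fun h => ?_)
      have := h.antisymm hG'.subset
      rw [this, hGd] at hd
      push_cast at hd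
      omega
    -- connectivity inside a single facet
    have hin : ∀ P ∈ 𝓕, ∀ G G', IsKFaceOf k Q G → IsKFaceOf k Q G' → G ⊆ P → G' ⊆ P →
        (∀ i, ¬ G ⊆ b i) → (∀ i, ¬ G' ⊆ b i) → Relation.ReflTransGen (Adj k Q b) G G' := by
      rintro P hP G G' ⟨hG, hGd⟩ ⟨hG', hGd'⟩ hGP hGP' hGb hGb'
      have hPe := (hF1 P hP).1
      have hGe : IsExposed ℝ Q G := hG
      have hGe' : IsExposed ℝ Q G' := hG'
      have := ih P (fun i => b i ∩ P) (polytope_face hQ hPe) (hdim P hP)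
        (fun i => ((hbe i).inter hPe).mono hPe.subset Set.inter_subset_right)
        G G' ⟨hGe.mono hPe.subset hGP, hGd⟩ ⟨hGe'.mono hPe.subset hGP', hGd'⟩
        (fun i h => hGb i (h.trans Set.inter_subset_left))
        (fun i h => hGb' i (h.trans Set.inter_subset_left))
      refine Relation.ReflTransGen.mono ?_ _ _ this
      rintro X Y ⟨⟨hX, hXd⟩, ⟨hY, hYd⟩, hXYd, hXYb⟩
      have hX' : IsExposed ℝ P X := hX
      exact ⟨⟨face_trans hQ hPe hX, hXd⟩, ⟨face_trans hQ hPe hY, hYd⟩, hXYd,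
        fun i h => hXYb i (Set.subset_inter h (Set.inter_subset_left.trans hX'.subset))⟩
    obtain ⟨P, hP, hFP⟩ := hsup F hF
    obtain ⟨P', hP', hFP'⟩ := hsup F' hF'
    have hpath := hF5 (by omega) m b (by omega) hbe P hP P' hP'
      (fun i h => hFb i (hFP.trans h)) (fun i h => hF'b i (hFP'.trans h))
    have hall : ∀ G, IsKFaceOf k Q G → G ⊆ P' → (∀ i, ¬ G ⊆ b i) →
        Relation.ReflTransGen (Adj k Q b) F G := by
      clear hFP' hP'
      induction hpath with
      | refl =>
        intro G hG hGP hGb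
        exact hin P hP F G hF hG hFP hGP hFb hGb
      | @tail X Y _ hXY ihp =>
        intro G hG hGY hGb
        obtain ⟨hX, hY, hXYb, hXYd⟩ := hXY
        have hRe : IsExposed ℝ Q (X ∩ Y) := (hF1 X hX).1.inter (hF1 Y hY).1
        obtain ⟨K, hK1, hK2, hK3⟩ := exists_kface hk hm (n - 1) (by omega) (X ∩ Y)
          (fun i => b i ∩ (X ∩ Y)) (polytope_face hQ hRe) (by rw [hXYd]; omega)
          (fun i => ((hbe i).inter hRe).mono hRe.subset Set.inter_subset_right)
          (fun i h => hXYb i (h.trans Set.inter_subset_left))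
        have hKQ : IsKFaceOf k Q K := ⟨face_trans hQ hRe hK1, hK2⟩
        have hKb : ∀ i, ¬ K ⊆ b i := fun i h => hK3 i (Set.subset_inter h hK1.subset)
        exact (ihp K hKQ (hK1.subset.trans Set.inter_subset_left) hKb).trans
          (hin Y hY K G hKQ hG (hK1.subset.trans Set.inter_subset_right) hGY hKb hGb)
    have hdone := hall F' hF' hFP' hF'b
    exact hdone

/-- Convert reachability to an explicit finite sequence. -/
theorem chain_of_rtg {α : Type*} {r : α → α → Prop} {a z : α} (h : Relation.ReflTransGen r a z) :
    ∃ (m : ℕ) (c : Fin (m + 1) → α), c 0 = a ∧ c (Fin.last m) = z ∧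
      ∀ i : Fin m, r (c i.castSucc) (c i.succ) := by
  induction h with
  | refl => exact ⟨0, fun _ => a, rfl, rfl, fun i => i.elim0⟩
  | @tail y z _ hyz ih =>
    obtain ⟨m, c, h0, hl, hc⟩ := ih
    refine ⟨m + 1, Fin.snoc c z, ?_, Fin.snoc_last _ _, ?_⟩
    · rw [← Fin.castSucc_zero, Fin.snoc_castSucc, h0]
    · intro i
      refine Fin.lastCases ?_ (fun j => ?_) i
      · rw [Fin.snoc_castSucc, Fin.succ_last, Fin.snoc_last, hl]
        exact hyz
      · rw [Fin.snoc_castSucc, Fin.succ_castSucc, Fin.snoc_castSucc]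
        exact hc j

theorem zero_face {G : Set (Pt N)} (hd : faceDim G = (0 : ℕ)) : ∃ x, G = {x} := by
  have hne := nonempty_of_faceDim hd
  rw [faceDim_of_nonempty hne] at hd
  have h0 : Module.finrank ℝ (vectorSpan ℝ G) = 0 := by exact_mod_cast hd
  rw [Submodule.finrank_eq_zero, vectorSpan_eq_bot_iff_subsingleton] at h0
  obtain ⟨x, hx⟩ := hne
  exact ⟨x, Set.Subsingleton.eq_singleton_of_mem h0 hx⟩

end skeleton

end SkelAux

/-- The `k`-skeleton of a `d`-polytope is `(k+1)`-connected
through codimension one. -/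
theorem skeleton_connected_through_codim_one {N d k : ℕ} (Q : Set (Pt N))
    (hQ : IsPolytope Q) (hd : faceDim Q = d) (hk : k + 1 ≤ d)
    (B : Set (Set (Pt N))) (hBfaces : ∀ b ∈ B, IsKFaceOf k Q b)
    (hBfin : B.Finite) (hBcard : B.ncard < k + 1)
    (F F' : Set (Pt N)) (hF : IsKFaceOf k Q F) (hF' : IsKFaceOf k Q F')
    (hFB : F ∉ B) (hF'B : F' ∉ B) :
    ∃ (m : ℕ) (c : Fin (m + 1) → Set (Pt N)),
      c 0 = F ∧ c (Fin.last m) = F' ∧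
      (∀ i, IsKFaceOf k Q (c i) ∧ c i ∉ B) ∧
      (∀ i : Fin m,
        IsFaceOf Q (c i.castSucc ∩ c i.succ) ∧
        faceDim (c i.castSucc ∩ c i.succ) = (k : ℤ) - 1 ∧
        ∀ b ∈ B, ¬ (c i.castSucc ∩ c i.succ) ⊆ b) := by
  rcases Nat.eq_zero_or_pos k with rfl | hkpos
  · have hB : B = ∅ := by
      rw [← Set.ncard_eq_zero hBfin]
      omega
    subst hB
    by_cases hFF : F = F'
    · exact ⟨0, fun _ => F, rfl, hFF, fun _ => ⟨hF, hFB⟩, fun i => i.elim0⟩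
    · have hemp : F ∩ F' = ∅ := by
        obtain ⟨x, hx⟩ := SkelAux.zero_face hF.2
        obtain ⟨y, hy⟩ := SkelAux.zero_face hF'.2
        subst hx hy
        rw [Set.singleton_inter_eq_empty, Set.mem_singleton_iff]
        rintro rfl
        exact hFF rfl
      refine ⟨1, ![F, F'], rfl, rfl, ?_, ?_⟩
      · intro i
        fin_cases i
        · exact ⟨hF, hFB⟩
        · exact ⟨hF', hF'B⟩
      · intro i
        have hi : i = 0 := Subsingleton.elim _ _
        subst hi
        have hc : (![F, F'] : Fin 2 → Set (Pt N)) (Fin.castSucc 0) ∩ ![F, F'] (Fin.succ 0) = ∅ :=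
          hemp
        rw [hc]
        refine ⟨?_, ?_, fun b hb => hb.elim⟩
        · rintro ⟨x, hx⟩
          exact hx.elim
        · simp [faceDim]
  · have hbij : ∃ b : Fin B.ncard → Set (Pt N), Set.range b = B := by
      have := hBfin.to_subtype
      refine ⟨fun i => ((Finite.equivFin B).symm i : Set (Pt N)), ?_⟩
      ext s
      constructor
      · rintro ⟨i, rfl⟩
        exact Subtype.coe_prop _
      · intro hs
        exact ⟨Finite.equivFin B ⟨s, hs⟩,
          congrArg Subtype.val ((Finite.equivFin B).symm_apply_apply ⟨s, hs⟩)⟩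
    obtain ⟨b, hb⟩ := hbij
    have hbB : ∀ i, b i ∈ B := fun i => hb ▸ Set.mem_range_self i
    have hnot : ∀ G, IsKFaceOf k Q G → G ∉ B → ∀ i, ¬ G ⊆ b i := by
      rintro G ⟨hG, hGd⟩ hGB i h
      apply hGB
      have hbi := hBfaces _ (hbB i)
      rw [SkelAux.eq_facet hG (SkelAux.nonempty_of_faceDim hGd) hbi.1 h (by rw [hGd, hbi.2])]
      exact hbB i
    have hpath := SkelAux.main_ind hkpos (Nat.lt_succ_iff.mp hBcard) d hk Q b hQ hd
      (fun i => (hBfaces _ (hbB i)).1) F F' hF hF' (hnot F hF hFB) (hnot F' hF' hF'B)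
    obtain ⟨m, c, h0, hl, hc⟩ := SkelAux.chain_of_rtg hpath
    refine ⟨m, c, h0, hl, ?_, ?_⟩
    · intro i
      refine Fin.lastCases ?_ (fun j => ?_) i
      · rw [hl]
        exact ⟨hF', hF'B⟩
      · refine ⟨(hc j).1, fun hmem => ?_⟩
        rw [← hb] at hmem
        obtain ⟨t, ht⟩ := hmem
        exact (hc j).2.2.2 t (ht ▸ Set.inter_subset_left)
    · intro i
      obtain ⟨⟨hX, _⟩, ⟨hY, _⟩, hXYd, hXYb⟩ := hc i
      refine ⟨IsExposed.inter hX hY, hXYd, fun s hs h => ?_⟩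
      rw [← hb] at hs
      obtain ⟨t, rfl⟩ := hs
      exact hXYb t h
end

section
/- For every d-dimensional polytope Q and every set B of fewer than d facets of Q, any two facets F, F′ of Q not in B are connected by a sequence F = G_1, …, G_ℓ = F′ of facets of Q, none belonging to B, such that for each i the intersection G_i ∩ G_{i+1} is a (d−2)-dimensional face (ridge) of Q not contained in any facet from B. -/
open Set Classical

set_option linter.all false

section Core
variable {V : Type*} [NormedAddCommGroup V] [InnerProductSpace ℝ V]

/-- `a` maximises `⟨·, z⟩` over `A`. -/
def MaxAt (A : Finset V) (z a : V) : Prop := a ∈ A ∧ ∀ b ∈ A, inner ℝ b z ≤ inner ℝ a z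

/-- the two maximisers at some point are exactly `a` and `b`. -/
def AdjAt (A : Finset V) (a b : V) : Prop :=
  a ≠ b ∧ ∃ w : V, inner ℝ a w = inner ℝ b w ∧
    ∀ c ∈ A, c ≠ a → c ≠ b → inner ℝ c w < inner ℝ a w

lemma maxAt_exists (A : Finset V) (hA : A.Nonempty) (z : V) : ∃ a, MaxAt A z a := by
  obtain ⟨a, ha, h⟩ := A.exists_max_image (fun a => inner ℝ a z) hA
  exact ⟨a, ha, h⟩

lemma isClosed_maxAt (A : Finset V) (a : V) : IsClosed {z | MaxAt A z a} := by
  by_cases ha : a ∈ A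
  · have : {z | MaxAt A z a} = ⋂ b ∈ A, {z : V | inner ℝ b z ≤ inner ℝ a z} := by
      ext z; simp [MaxAt, ha]
    rw [this]
    refine isClosed_biInter fun b _ => isClosed_le (by fun_prop) (by fun_prop)
  · have : {z | MaxAt A z a} = ∅ := by
      ext z; simp [MaxAt, ha]
    rw [this]; exact isClosed_empty

/-- Walking along a preconnected set. -/
lemma walk (A : Finset V) (R : V → V → Prop) (S : Set V) (hS : IsPreconnected S)
    (hR : ∀ z ∈ S, ∀ a b, MaxAt A z a → MaxAt A z b → Relation.ReflTransGen R a b)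
    {p q a b : V} (hp : p ∈ S) (hq : q ∈ S) (ha : MaxAt A p a) (hb : MaxAt A q b) :
    Relation.ReflTransGen R a b := by
  by_contra hab
  have hA : A.Nonempty := ⟨a, ha.1⟩
  set K := A.filter (fun c => Relation.ReflTransGen R a c)
  set K' := A.filter (fun c => ¬ Relation.ReflTransGen R a c)
  have h := isPreconnected_closed_iff.1 hS (⋃ c ∈ K, {z | MaxAt A z c}) (⋃ c ∈ K', {z | MaxAt A z c})
    (isClosed_biUnion_finset fun c _ => isClosed_maxAt A c)
    (isClosed_biUnion_finset fun c _ => isClosed_maxAt A c) ?_ ?_ ?_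
  · obtain ⟨z, hz, h1, h2⟩ := h
    simp only [mem_iUnion, mem_ofPred_eq, exists_prop] at h1 h2
    obtain ⟨c, hc, hc'⟩ := h1
    obtain ⟨e, he, he'⟩ := h2
    exact (Finset.mem_filter.1 he).2 ((Finset.mem_filter.1 hc).2.trans (hR z hz c e hc' he'))
  · intro z hz
    obtain ⟨c, hc⟩ := maxAt_exists A hA z
    by_cases h : Relation.ReflTransGen R a c
    · left; simp only [mem_iUnion, mem_ofPred_eq, exists_prop]
      exact ⟨c, Finset.mem_filter.2 ⟨hc.1, h⟩, hc⟩
    · right; simp only [mem_iUnion, mem_ofPred_eq, exists_prop]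
      exact ⟨c, Finset.mem_filter.2 ⟨hc.1, h⟩, hc⟩
  · refine ⟨p, hp, ?_⟩
    simp only [mem_iUnion, mem_ofPred_eq, exists_prop]
    exact ⟨a, Finset.mem_filter.2 ⟨ha.1, .refl⟩, ha⟩
  · refine ⟨q, hq, ?_⟩
    simp only [mem_iUnion, mem_ofPred_eq, exists_prop]
    exact ⟨b, Finset.mem_filter.2 ⟨hb.1, hab⟩, hb⟩

/-- every element of `A` is a strict unique maximiser somewhere. -/
def Irred (A : Finset V) : Prop :=
  ∀ a ∈ A, ∃ p : V, ∀ b ∈ A, b ≠ a → inner ℝ b p < inner ℝ a p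

lemma Irred.mono {A A' : Finset V} (h : Irred A) (hs : A' ⊆ A) : Irred A' := by
  intro a ha
  obtain ⟨p, hp⟩ := h a (hs ha)
  exact ⟨p, fun b hb => hp b (hs hb)⟩

lemma Irred.indep {A : Finset V} (h : Irred A) {a b c : V} (ha : a ∈ A) (hb : b ∈ A) (hc : c ∈ A)
    (hab : a ≠ b) (hac : a ≠ c) (hbc : b ≠ c) {s t : ℝ} (hst : s • (a - b) + t • (a - c) = 0) :
    s = 0 ∧ t = 0 := by
  obtain ⟨p, hp⟩ := h a ha
  obtain ⟨q, hq⟩ := h b hb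
  obtain ⟨r, hr⟩ := h c hc
  have key : ∀ z : V, s * (inner ℝ a z - inner ℝ b z) + t * (inner ℝ a z - inner ℝ c z) = 0 := by
    intro z
    have := congrArg (fun v => inner ℝ v z) hst
    simpa [inner_add_left, inner_smul_left, inner_sub_left] using this
  have p1 := hp b hb hab.symm
  have p2 := hp c hc hac.symm
  have q1 := hq a ha hab
  have q2 := hq c hc hbc.symm
  have r1 := hr a ha hac
  have r2 := hr b hb hbc
  have kp := key p
  have kq := key q
  have kr := key r
  rcases lt_trichotomy s 0 with hs | hs | hs
  · exfalso
    rcases le_or_gt t 0 with ht | ht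
    · nlinarith
    · -- s < 0 < t
      rcases le_or_gt (s + t) 0 with h1 | h1
      · nlinarith
      · nlinarith
  · subst hs
    refine ⟨rfl, ?_⟩
    have : t * (inner ℝ a p - inner ℝ c p) = 0 := by linarith
    rcases mul_eq_zero.1 this with h | h
    · exact h
    · linarith
  · exfalso
    rcases le_or_gt 0 t with ht | ht
    · nlinarith
    · rcases le_or_gt (s + t) 0 with h1 | h1
      · nlinarith
      · nlinarith

/-- avoid finitely many hyperplanes inside an open set -/
lemma avoid (T : Finset V) (hT : ∀ u ∈ T, u ≠ 0) (U : Set V) (hU : IsOpen U) (hne : U.Nonempty) :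
    ∃ q ∈ U, ∀ u ∈ T, inner ℝ u q ≠ 0 := by
  induction T using Finset.induction_on generalizing U with
  | empty => obtain ⟨q, hq⟩ := hne; exact ⟨q, hq, by simp⟩
  | insert u T hu ih =>
    have hU' : IsOpen (U ∩ {q | inner ℝ u q ≠ 0}) :=
      hU.inter (isOpen_ne_fun (by fun_prop) (by fun_prop))
    have hne' : (U ∩ {q | inner ℝ u q ≠ 0}).Nonempty := by
      obtain ⟨q, hq⟩ := hne
      by_cases h : inner ℝ u q = 0
      · have hcont : Filter.Tendsto (fun e : ℝ => q + e • u) (nhdsWithin 0 (Set.Ioi 0)) (nhds q) := by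
          have : Continuous (fun e : ℝ => q + e • u) := by fun_prop
          have := this.tendsto 0
          simp only [zero_smul, add_zero] at this
          exact this.mono_left nhdsWithin_le_nhds
        have h1 := hcont.eventually (hU.mem_nhds hq)
        obtain ⟨e, he, he'⟩ := (h1.and self_mem_nhdsWithin).exists
        refine ⟨_, he, ?_⟩
        have hu0 := hT u (by simp)
        simp only [mem_ofPred_eq, inner_add_right, h, inner_smul_right, zero_add]
        have : (0:ℝ) < e := he'
        have := inner_self_ne_zero (𝕜 := ℝ).2 hu0
        positivity
      · exact ⟨q, hq, h⟩
    obtain ⟨q, hq, h⟩ := ih (fun v hv => hT v (by simp [hv])) _ hU' hne'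
    refine ⟨q, hq.1, ?_⟩
    intro v hv
    rcases Finset.mem_insert.1 hv with rfl | hv
    · exact hq.2
    · exact h v hv

/-- a generic segment only meets at most two maximisers at a time. -/
lemma generic_conn {A : Finset V} (hA : Irred A) {a b : V} (ha : a ∈ A) (hb : b ∈ A) :
    Relation.ReflTransGen (fun u v => u ∈ A ∧ v ∈ A ∧ AdjAt A u v) a b := by
  obtain ⟨p, hp⟩ := hA a ha
  obtain ⟨q0, hq0⟩ := hA b hb
  have hφ : ∀ t : V × V × V, ∃ u : V, t.1 ∈ A → t.2.1 ∈ A → t.2.2 ∈ A → t.1 ≠ t.2.1 →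
      t.1 ≠ t.2.2 → t.2.1 ≠ t.2.2 → u ≠ 0 ∧ inner ℝ u p = 0 ∧
      ∀ z : V, inner ℝ t.1 z = inner ℝ t.2.1 z → inner ℝ t.1 z = inner ℝ t.2.2 z → inner ℝ u z = 0 := by
    rintro ⟨x, y, w⟩
    by_cases h : inner ℝ (x - w) p = 0 ∧ inner ℝ (x - y) p = 0
    · refine ⟨x - y, fun _ _ _ h1 _ _ => ⟨sub_ne_zero.2 h1, h.2, fun z h1 _ => ?_⟩⟩
      rw [inner_sub_left]; linarith
    · refine ⟨(inner ℝ (x - w) p) • (x - y) + (- inner ℝ (x - y) p) • (x - w),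
        fun hx hy hw h1 h2 h3 => ⟨fun h0 => h ?_, ?_, fun z h4 h5 => ?_⟩⟩
      · have := hA.indep hx hy hw h1 h2 h3 h0
        exact ⟨this.1, by linarith [this.2]⟩
      · simp only [inner_add_left, inner_smul_left]; simp; ring
      · simp only at h4 h5
        simp only [inner_add_left, inner_smul_left, inner_sub_left, h4] 
        rw [← h5, h4]; simp
  choose φ hφ using hφ
  set T : Finset V := ((A ×ˢ A ×ˢ A).filter
    (fun t => t.1 ≠ t.2.1 ∧ t.1 ≠ t.2.2 ∧ t.2.1 ≠ t.2.2)).image φ with hTdef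
  have hT : ∀ u ∈ T, u ≠ 0 := by
    intro u hu
    obtain ⟨t, ht, rfl⟩ := Finset.mem_image.1 hu
    simp only [Finset.mem_filter, Finset.mem_product] at ht
    exact (hφ t ht.1.1 ht.1.2.1 ht.1.2.2 ht.2.1 ht.2.2.1 ht.2.2.2).1
  have hU : IsOpen (⋂ c ∈ A.erase b, {q : V | inner ℝ c q < inner ℝ b q}) :=
    isOpen_biInter_finset fun c _ => isOpen_lt (by fun_prop) (by fun_prop)
  obtain ⟨q, hq, hqT⟩ := avoid T hT _ hU ⟨q0, by
    simp only [mem_iInter, mem_ofPred_eq, Finset.mem_erase]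
    exact fun c hc => hq0 c hc.2 hc.1⟩
  simp only [mem_iInter, mem_ofPred_eq, Finset.mem_erase] at hq
  have le_of : ∀ {x y z : V}, (∀ c ∈ A, c ≠ x → inner ℝ c z < inner ℝ x z) → x ∈ A →
      MaxAt A z x := by
    intro x y z h hx
    refine ⟨hx, fun c hc => ?_⟩
    by_cases hcx : c = x
    · rw [hcx]
    · exact (h c hc hcx).le
  refine walk A _ (segment ℝ p q) (convex_segment p q).isPreconnected ?_
    (left_mem_segment ℝ p q) (right_mem_segment ℝ p q) (le_of (y := 0) hp ha)
    (le_of (y := 0) (fun c hc h => hq c ⟨h, hc⟩) hb)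
  intro z hz x y hx hy
  by_cases hxy : x = y
  · subst hxy; exact .refl
  refine .single ⟨hx.1, hy.1, hxy, z, le_antisymm (hy.2 _ hx.1) (hx.2 _ hy.1), ?_⟩
  intro c hc hcx hcy
  by_contra hlt
  have e1 : inner ℝ x z = inner ℝ y z := le_antisymm (hy.2 _ hx.1) (hx.2 _ hy.1)
  have e2 : inner ℝ x z = inner ℝ c z := le_antisymm (not_lt.1 hlt) (hx.2 _ hc)
  obtain ⟨-, h2, h3⟩ := hφ (x, y, c) hx.1 hy.1 hc hxy (Ne.symm hcx) (Ne.symm hcy)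
  have h4 := h3 z e1 e2
  have h5 : inner ℝ (φ (x, y, c)) q ≠ 0 := hqT _ (Finset.mem_image.2 ⟨(x, y, c), by
    simp [hx.1, hy.1, hc, hxy, Ne.symm hcx, Ne.symm hcy], rfl⟩)
  obtain ⟨s, t, hs, ht, hst, rfl⟩ := hz
  rw [inner_add_right, inner_smul_right, inner_smul_right, h2] at h4
  have ht0 : t = 0 := by
    rcases mul_eq_zero.1 (by linarith : t * inner ℝ (φ (x, y, c)) q = 0) with h | h
    · exact h
    · exact absurd h h5
  have hs1 : s = 1 := by linarith
  subst ht0 hs1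
  simp only [one_smul, zero_smul, add_zero] at e1 e2 
  by_cases hxa : x = a
  · subst hxa
    exact absurd (hp y hy.1 (Ne.symm hxy)) (by rw [e1]; exact lt_irrefl _)
  · have := hp x hx.1 hxa
    have h := hx.2 a ha
    simp only [one_smul, zero_smul, add_zero] at h
    linarith

/-- maximisers at a point are connected among themselves. -/
lemma local_conn {A : Finset V} (hA : Irred A) {x a b : V} (ha : MaxAt A x a) (hb : MaxAt A x b) :
    Relation.ReflTransGen (fun u v => MaxAt A x u ∧ MaxAt A x v ∧ AdjAt A u v) a b := by
  set A' := A.filter (fun c => MaxAt A x c) with hA'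
  have hsub : A' ⊆ A := Finset.filter_subset _ _
  have mem : ∀ {c}, MaxAt A x c → c ∈ A' := fun h => Finset.mem_filter.2 ⟨h.1, h⟩
  refine Relation.ReflTransGen.mono ?_ _ _ (generic_conn (hA.mono hsub) (mem ha) (mem hb))
  rintro u v ⟨hu, hv, huv, w, hw, hlt⟩
  have hu' := (Finset.mem_filter.1 hu).2
  have hv' := (Finset.mem_filter.1 hv).2
  have euv : inner ℝ u x = inner ℝ v x := le_antisymm (hv'.2 _ hu'.1) (hu'.2 _ hv'.1)
  refine ⟨hu', hv', huv, ?_⟩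
  have hev : ∀ c ∈ A, ∀ᶠ e : ℝ in nhdsWithin 0 (Set.Ioi 0), c ≠ u → c ≠ v →
      inner ℝ c (x + e • w) < inner ℝ u (x + e • w) := by
    intro c hc
    by_cases hcA : c ∈ A'
    · filter_upwards [self_mem_nhdsWithin] with e he hcu hcv
      have he : 0 < e := he
      have h1 := hlt c hcA hcu hcv
      have h2 := hu'.2 c hc
      simp only [inner_add_right, inner_smul_right]
      nlinarith
    · have hlt' : inner ℝ c x < inner ℝ u x := by
        by_contra h
        exact hcA (mem ⟨hc, fun d hd => (hu'.2 d hd).trans (not_lt.1 h)⟩)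
      have c1 : Continuous fun e : ℝ => (inner ℝ c (x + e • w) : ℝ) := by fun_prop
      have c2 : Continuous fun e : ℝ => (inner ℝ u (x + e • w) : ℝ) := by fun_prop
      have := (isOpen_lt c1 c2).mem_nhds (show (0:ℝ) ∈ _ by simpa using hlt')
      filter_upwards [mem_nhdsWithin_of_mem_nhds this] with e he _ _
      exact he
  obtain ⟨e, he⟩ := ((Finset.eventually_all A).2 hev).exists
  exact ⟨x + e • w, by simp only [inner_add_right, inner_smul_right, euv, hw], he⟩

lemma core [FiniteDimensional ℝ V] {A : Finset V} (hA : Irred A)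
    (hpos : ∀ x : V, x ≠ 0 → ∃ a ∈ A, 0 < inner ℝ a x) (B : Finset V)
    (hB : B.card < Module.finrank ℝ V) {a a' : V} (ha : a ∈ A) (ha' : a' ∈ A)
    (haB : a ∉ B) (ha'B : a' ∉ B) :
    Relation.ReflTransGen (fun u v => (u ∈ A ∧ u ∉ B) ∧ (v ∈ A ∧ v ∉ B) ∧ AdjAt A u v) a a' := by
  -- the direction
  obtain ⟨x0, hx0, hx0B⟩ : ∃ x : V, x ≠ 0 ∧ ∀ b ∈ B, inner ℝ b x = inner ℝ a x := by
    let L : V →ₗ[ℝ] (B → ℝ) := LinearMap.pi fun b => (innerₛₗ ℝ (b.1 - a))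
    have hker : LinearMap.ker L ≠ ⊥ := by
      apply LinearMap.ker_ne_bot_of_finrank_lt
      simpa using hB
    obtain ⟨x, hx, hx0⟩ := Submodule.exists_mem_ne_zero_of_ne_bot hker
    refine ⟨x, hx0, fun b hb => ?_⟩
    have := congrFun (LinearMap.mem_ker.1 hx) ⟨b, hb⟩
    simp [L] at this
    linarith
  obtain ⟨x0, hx0B, hxa', k, hk, hxk⟩ : ∃ x : V, (∀ b ∈ B, inner ℝ b x = inner ℝ a x) ∧
      inner ℝ a x ≤ inner ℝ a' x ∧ ∃ k ∈ A, inner ℝ a x < inner ℝ k x := by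
    have hneg : ∀ b ∈ B, inner ℝ b (-x0) = inner ℝ a (-x0) := by
      intro b hb; simp [hx0B b hb]
    rcases lt_trichotomy (inner ℝ a x0) (inner ℝ a' x0) with h | h | h
    · exact ⟨x0, hx0B, h.le, a', ha', h⟩
    · obtain ⟨k, hk, hk0⟩ := hpos x0 hx0
      obtain ⟨k', hk', hk0'⟩ := hpos (-x0) (neg_ne_zero.2 hx0)
      rcases le_or_gt (inner ℝ a x0) 0 with h0 | h0
      · exact ⟨x0, hx0B, h.le, k, hk, by linarith⟩
      · refine ⟨-x0, hneg, by simp [h], k', hk', ?_⟩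
        have : inner ℝ a (-x0) < 0 := by simpa using h0
        linarith
    · exact ⟨-x0, hneg, by simpa using h.le, a', ha', by simpa using h⟩
  obtain ⟨p, hp⟩ := hA a ha
  obtain ⟨p', hp'⟩ := hA a' ha'
  have toMax : ∀ {x z : V}, (∀ c ∈ A, c ≠ x → inner ℝ c z < inner ℝ x z) → x ∈ A →
      MaxAt A z x := by
    intro x z h hx
    refine ⟨hx, fun c hc => ?_⟩
    by_cases hcx : c = x
    · rw [hcx]
    · exact (h c hc hcx).le
  have key : ∀ {e r : V}, e ∈ A → e ∉ B → (∀ b ∈ A, b ≠ e → inner ℝ b r < inner ℝ e r) →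
      inner ℝ a x0 ≤ inner ℝ e x0 → ∀ z ∈ segment ℝ r x0, ∀ u, MaxAt A z u → u ∉ B := by
    intro e r he heB hr hle z hz u hu huB
    obtain ⟨s, t, hs, ht, hst, rfl⟩ := hz
    have h1 := hr u hu.1 (fun h => heB (h ▸ huB))
    have h2 := hx0B u huB
    have h3 := hu.2 e he
    have h4 := hu.2 k hk
    simp only [inner_add_right, inner_smul_right] at h3 h4
    rcases hs.eq_or_lt with rfl | hs
    · have : t = 1 := by linarith
      subst this
      linarith
    · nlinarith
  have h1 := key ha haB hp le_rfl
  have h2 := key ha' ha'B hp' hxa'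
  have hpre : IsPreconnected (segment ℝ p x0 ∪ segment ℝ p' x0) :=
    IsPreconnected.union x0 (right_mem_segment ℝ _ _) (right_mem_segment ℝ _ _)
      (convex_segment _ _).isPreconnected (convex_segment _ _).isPreconnected
  refine walk A _ _ hpre ?_ (Or.inl (left_mem_segment ℝ _ _)) (Or.inr (left_mem_segment ℝ _ _))
    (toMax hp ha) (toMax hp' ha')
  intro z hz u v hu hv
  have hzB : ∀ w, MaxAt A z w → w ∉ B := by
    rcases hz with hz | hz
    · exact h1 z hz
    · exact h2 z hz
  refine Relation.ReflTransGen.mono ?_ _ _ (local_conn hA hu hv)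
  rintro w y ⟨hw, hy, hwy⟩
  exact ⟨⟨hw.1, hzB w hw⟩, ⟨hy.1, hzB y hy⟩, hwy⟩

end Core

section Polar
variable {V : Type*} [NormedAddCommGroup V] [InnerProductSpace ℝ V] [FiniteDimensional ℝ V]

/-- the polar of `K` -/
def polarOf (K : Set V) : Set V := {a | ∀ x ∈ K, inner ℝ a x ≤ 1}

/-- A linear functional as an inner product. -/
lemma riesz (l : StrongDual ℝ V) : ∃ u : V, ∀ x, l x = inner ℝ u x := by
  haveI : CompleteSpace V := FiniteDimensional.complete ℝ V
  exact ⟨(InnerProductSpace.toDual ℝ V).symm l, fun x => by simp⟩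

lemma convex_polarOf (K : Set V) : Convex ℝ (polarOf K) := by
  intro a ha b hb s t hs ht hst x hx
  have h1 := ha x hx
  have h2 := hb x hx
  simp only [inner_add_left, inner_smul_left]
  simp only [conj_trivial]
  nlinarith

lemma small_mem {K : Set V} (h0 : (0 : V) ∈ interior K) (u : V) : ∃ e : ℝ, 0 < e ∧ e • u ∈ K := by
  have hc : Continuous fun e : ℝ => e • u := by fun_prop
  have h1 : ∀ᶠ e : ℝ in nhds 0, e • u ∈ K :=
    hc.continuousAt.eventually (by simpa using mem_interior_iff_mem_nhds.1 h0)
  obtain ⟨e, he, he'⟩ := ((h1.filter_mono nhdsWithin_le_nhds).and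
    (self_mem_nhdsWithin (s := Set.Ioi (0:ℝ)))).exists
  exact ⟨e, he', he⟩

lemma isCompact_polarOf {K : Set V} (h0 : (0 : V) ∈ interior K) : IsCompact (polarOf K) := by
  haveI : ProperSpace V := FiniteDimensional.proper ℝ V
  refine Metric.isCompact_of_isClosed_isBounded ?_ ?_
  · have : polarOf K = ⋂ x ∈ K, {a : V | inner ℝ a x ≤ 1} := by
      ext a; simp [polarOf]
    rw [this]
    exact isClosed_biInter fun x _ => isClosed_le (by fun_prop) (by fun_prop)
  · obtain ⟨r, hr, hrK⟩ := Metric.mem_nhds_iff.1 (mem_interior_iff_mem_nhds.1 h0)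
    refine (Metric.isBounded_closedBall (x := (0 : V)) (r := 2 / r)).subset ?_
    intro a ha
    rw [mem_closedBall_zero_iff]
    by_cases ha0 : a = 0
    · rw [ha0, norm_zero]; positivity
    have hn : 0 < ‖a‖ := norm_pos_iff.2 ha0
    have hmem : (r / 2 / ‖a‖) • a ∈ K := hrK (by
      rw [mem_ball_zero_iff, norm_smul, Real.norm_of_nonneg (by positivity)]
      field_simp; linarith)
    have := ha _ hmem
    rw [inner_smul_right, real_inner_self_eq_norm_sq] at this
    have h2 : r / 2 / ‖a‖ * ‖a‖ ^ 2 = r * ‖a‖ / 2 := by field_simp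
    rw [h2] at this
    rw [le_div_iff₀ hr]; linarith

lemma finite_extreme_polarOf {S : Set V} (hS : S.Finite) :
    ((polarOf (convexHull ℝ S)).extremePoints ℝ).Finite := by
  have hP : ∀ a : V, (∀ s ∈ S, inner ℝ a s ≤ 1) → a ∈ polarOf (convexHull ℝ S) := by
    intro a ha x hx
    have : convexHull ℝ S ⊆ {x : V | inner ℝ a x ≤ 1} := by
      refine convexHull_min ha ?_
      intro x hx y hy s t hs ht hst
      have h1 : inner ℝ a x ≤ 1 := hx
      have h2 : inner ℝ a y ≤ 1 := hy
      simp only [mem_ofPred_eq, inner_add_right, inner_smul_right]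
      nlinarith
    exact this hx
  refine Set.Finite.of_injOn (f := fun a : V => {s ∈ S | inner ℝ a s = 1}) (t := 𝒫 S) ?_ ?_ hS.finite_subsets
  · intro a _ s hs
    exact hs.1
  · intro a ha b hb hab
    simp only at hab
    have htight : ∀ s ∈ S, inner ℝ a s = 1 → inner ℝ b s = 1 := by
      intro s hs h
      have : s ∈ {s ∈ S | inner ℝ a s = 1} := ⟨hs, h⟩
      rw [hab] at this
      exact this.2
    have hev : ∀ s ∈ S, ∀ᶠ e : ℝ in nhdsWithin 0 (Set.Ioi 0),
        inner ℝ (a + e • (b - a)) s ≤ 1 ∧ inner ℝ (a - e • (b - a)) s ≤ 1 := by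
      intro s hs
      have hle : inner ℝ a s ≤ 1 := ha.1 s (subset_convexHull ℝ S hs)
      rcases hle.eq_or_lt with h | h
      · have h' := htight s hs h
        refine Filter.Eventually.of_forall fun e => ?_
        simp [inner_add_left, inner_sub_left, inner_smul_left, h, h']
      · have c1 : Continuous fun e : ℝ => (inner ℝ (a + e • (b - a)) s : ℝ) := by fun_prop
        have c2 : Continuous fun e : ℝ => (inner ℝ (a - e • (b - a)) s : ℝ) := by fun_prop
        have m1 := (isOpen_lt c1 continuous_const).mem_nhds
          (show (0:ℝ) ∈ {e : ℝ | inner ℝ (a + e • (b - a)) s < 1} by simpa using h)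
        have m2 := (isOpen_lt c2 continuous_const).mem_nhds
          (show (0:ℝ) ∈ {e : ℝ | inner ℝ (a - e • (b - a)) s < 1} by simpa using h)
        filter_upwards [mem_nhdsWithin_of_mem_nhds m1, mem_nhdsWithin_of_mem_nhds m2] with e h1 h2
        exact ⟨le_of_lt h1, le_of_lt h2⟩
    obtain ⟨e, he, he0⟩ := (((Filter.eventually_all_finite hS).2 hev).and
      self_mem_nhdsWithin).exists
    have he0 : 0 < e := he0
    have := ha.2 (hP _ fun s hs => (he s hs).1) (hP _ fun s hs => (he s hs).2)
      ⟨1/2, 1/2, by norm_num, by norm_num, by norm_num, by module⟩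
    have h3 : e • (b - a) = 0 := by simpa using this
    rcases smul_eq_zero.1 h3 with h | h
    · exact absurd h he0.ne'
    · exact (sub_eq_zero.1 h).symm

lemma exists_extreme_max {K : Set V} (h0 : (0 : V) ∈ interior K) (x : V) :
    ∃ a ∈ (polarOf K).extremePoints ℝ, ∀ b ∈ polarOf K, inner ℝ b x ≤ inner ℝ a x := by
  have hc := isCompact_polarOf h0
  let l : StrongDual ℝ V := innerSL ℝ x
  have hl : ∀ a, l a = inner ℝ a x := fun a => by simp [l, real_inner_comm]
  have h : IsExposed ℝ (polarOf K) {y ∈ polarOf K | ∀ z ∈ polarOf K, l z ≤ l y} := fun _ => ⟨l, rfl⟩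
  obtain ⟨z, hzA, hz⟩ := hc.exists_isMaxOn ⟨0, fun x _ => by simp⟩ l.continuous.continuousOn
  obtain ⟨y, hy⟩ := (h.isCompact hc).extremePoints_nonempty ⟨z, hzA, hz⟩
  refine ⟨y, h.isExtreme.extremePoints_subset_extremePoints hy, fun b hb => ?_⟩
  have := hy.1.2 b hb
  rwa [hl, hl] at this

/-- The needed facts on the polar vertices. -/
lemma polar_facts {S : Set V} (hS : S.Finite) (h0 : (0 : V) ∈ interior (convexHull ℝ S)) :
    ∃ A : Finset V, (∀ a, a ∈ A ↔ a ∈ (polarOf (convexHull ℝ S)).extremePoints ℝ) ∧ Irred A ∧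
      (∀ x : V, x ≠ 0 → ∃ a ∈ A, 0 < inner ℝ a x) ∧
      (∀ x : V, x ∈ convexHull ℝ S ↔ ∀ a ∈ A, inner ℝ a x ≤ 1) := by
  set K := convexHull ℝ S with hK
  have hfin : ((polarOf K).extremePoints ℝ).Finite := finite_extreme_polarOf hS
  have hKc : IsCompact K := hS.isCompact_convexHull ℝ
  have hmem : ∀ x : V, x ∈ K ↔ ∀ a ∈ hfin.toFinset, inner ℝ a x ≤ 1 := by
    intro x
    constructor
    · intro hx a ha
      exact (hfin.mem_toFinset.1 ha).1 x hx
    · intro h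
      by_contra hx
      obtain ⟨l, m, hl, hm⟩ := geometric_hahn_banach_closed_point (convex_convexHull ℝ S)
        (hS.isClosed_convexHull ℝ) hx
      obtain ⟨u, hu⟩ := riesz l
      have hm0 : 0 < m := by simpa using hl 0 (interior_subset h0)
      have hP : m⁻¹ • u ∈ polarOf K := by
        intro y hy
        rw [inner_smul_left, ← hu]
        have := hl y hy
        simp only [conj_trivial]
        rw [inv_mul_le_iff₀ hm0]; linarith
      obtain ⟨a, ha, hmax⟩ := exists_extreme_max h0 x
      have h1 := hmax _ hP
      have h2 := h a (hfin.mem_toFinset.2 ha)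
      rw [inner_smul_left, ← hu] at h1
      simp only [conj_trivial] at h1
      have h3 : m⁻¹ * l x ≤ 1 := h1.trans h2
      rw [inv_mul_le_iff₀ hm0] at h3
      linarith
  refine ⟨hfin.toFinset, fun a => hfin.mem_toFinset, ?_, ?_, hmem⟩
  · intro a ha
    have ha' := (convex_polarOf K).mem_extremePoints_iff_mem_sdiff_convexHull_sdiff.1
      (hfin.mem_toFinset.1 ha)
    have hna : a ∉ convexHull ℝ ((hfin.toFinset.erase a : Finset V) : Set V) := by
      intro h
      refine ha'.2 (convexHull_mono ?_ h)
      intro b hb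
      have hb := Finset.mem_erase.1 (Finset.mem_coe.1 hb)
      exact ⟨(hfin.mem_toFinset.1 hb.2).1, hb.1⟩
    obtain ⟨l, m, hl, hm⟩ := geometric_hahn_banach_closed_point (convex_convexHull ℝ _)
        ((Finset.finite_toSet _).isClosed_convexHull ℝ) hna
    obtain ⟨u, hu⟩ := riesz l
    refine ⟨u, fun b hb hba => ?_⟩
    have := hl b (subset_convexHull ℝ _ (Finset.mem_coe.2 (Finset.mem_erase.2 ⟨hba, hb⟩)))
    rw [real_inner_comm, real_inner_comm u a, ← hu, ← hu]
    linarith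
  · intro x hx
    by_contra hcon
    push Not at hcon
    obtain ⟨r, hr⟩ := hKc.isBounded.exists_norm_le
    have hr0 : 0 ≤ r := by simpa using hr 0 (interior_subset h0)
    have hn : 0 < ‖x‖ := norm_pos_iff.2 hx
    have : ((r + 1) / ‖x‖) • x ∈ K := by
      rw [hmem]
      intro a ha
      rw [inner_smul_right]
      have h1 := hcon a ha
      have h2 : 0 ≤ (r + 1) / ‖x‖ := by positivity
      nlinarith
    have := hr _ this
    rw [norm_smul, Real.norm_of_nonneg (by positivity)] at this
    field_simp at this
    linarith

/-- dimension of the face cut out by `T` -/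
lemma vectorSpan_face {K : Set V} {A : Finset V} (hmem : ∀ x : V, x ∈ K ↔ ∀ a ∈ A, inner ℝ a x ≤ 1)
    (T : Set V) {x : V} (hT : ∀ t ∈ T, inner ℝ t x = 1)
    (hA : ∀ c ∈ A, c ∉ T → inner ℝ c x < 1) :
    vectorSpan ℝ {v ∈ K | ∀ t ∈ T, inner ℝ t v = 1} = (Submodule.span ℝ T)ᗮ := by
  have hxK : x ∈ K := by
    rw [hmem]; intro a ha
    by_cases h : a ∈ T
    · exact (hT a h).le
    · exact (hA a ha h).le
  have hxG : x ∈ {v ∈ K | ∀ t ∈ T, inner ℝ t v = 1} := ⟨hxK, hT⟩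
  apply le_antisymm
  · rw [vectorSpan_def, Submodule.span_le]
    rintro _ ⟨v, hv, w, hw, rfl⟩
    rw [SetLike.mem_coe, Submodule.mem_orthogonal]
    intro u hu
    induction hu using Submodule.span_induction with
    | mem t ht => simp [inner_sub_right, hv.2 t ht, hw.2 t ht]
    | zero => simp
    | add a b _ _ h1 h2 => rw [inner_add_left, h1, h2, add_zero]
    | smul c a _ h => rw [inner_smul_left, h, mul_zero]
  · intro w hw
    rw [Submodule.mem_orthogonal] at hw
    have hw' : ∀ t ∈ T, inner ℝ t w = 0 := fun t ht => hw t (Submodule.subset_span ht)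
    have hev : ∀ c ∈ A, ∀ᶠ e : ℝ in nhdsWithin 0 (Set.Ioi 0), inner ℝ c (x + e • w) ≤ 1 := by
      intro c hc
      by_cases h : c ∈ T
      · refine Filter.Eventually.of_forall fun e => ?_
        simp [inner_add_right, inner_smul_right, hT c h, hw' c h]
      · have c1 : Continuous fun e : ℝ => (inner ℝ c (x + e • w) : ℝ) := by fun_prop
        have := (isOpen_lt c1 continuous_const).mem_nhds
          (show (0:ℝ) ∈ {e : ℝ | inner ℝ c (x + e • w) < 1} by simpa using hA c hc h)
        filter_upwards [mem_nhdsWithin_of_mem_nhds this] with e he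
        exact le_of_lt he
    obtain ⟨e, he, he0⟩ := (((Finset.eventually_all A).2 hev).and self_mem_nhdsWithin).exists
    have he0 : 0 < e := he0
    have hyG : x + e • w ∈ {v ∈ K | ∀ t ∈ T, inner ℝ t v = 1} :=
      ⟨(hmem _).2 he, fun t ht => by simp [inner_add_right, inner_smul_right, hT t ht, hw' t ht]⟩
    have := vsub_mem_vectorSpan ℝ hyG hxG
    simp only [vsub_eq_sub, add_sub_cancel_left] at this
    have h2 := Submodule.smul_mem _ e⁻¹ this
    rwa [smul_smul, inv_mul_cancel₀ he0.ne', one_smul] at h2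

lemma finrank_orth (T : Set V) : Module.finrank ℝ (Submodule.span ℝ T)ᗮ + Module.finrank ℝ (Submodule.span ℝ T)
    = Module.finrank ℝ V := by
  rw [add_comm]; exact Submodule.finrank_add_finrank_orthogonal _

/-- A facet of `K` comes from an extreme point of the polar. -/
lemma facet_extreme {K : Set V} (h0 : (0 : V) ∈ interior K) (u : V) {G : Set V}
    (hG : G = {v ∈ K | ∀ w ∈ K, inner ℝ u w ≤ inner ℝ u v}) (hne : G.Nonempty)
    (hdim : Module.finrank ℝ (vectorSpan ℝ G) + 1 = Module.finrank ℝ V) :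
    ∃ a ∈ (polarOf K).extremePoints ℝ, G = {v ∈ K | inner ℝ a v = 1} := by
  have hu0 : u ≠ 0 := by
    rintro rfl
    have hGK : G = K := by rw [hG]; ext v; simp
    have hint : (interior G).Nonempty := ⟨0, by rw [hGK]; exact h0⟩
    have : affineSpan ℝ G = ⊤ := by
      refine top_unique ?_
      rw [← isOpen_interior.affineSpan_eq_top hint]
      exact affineSpan_mono ℝ interior_subset
    rw [← direction_affineSpan, this, AffineSubspace.direction_top, finrank_top] at hdim
    omega
  obtain ⟨v0, hv0⟩ := hne
  have hv0' : v0 ∈ K ∧ ∀ w ∈ K, inner ℝ u w ≤ inner ℝ u v0 := by rw [hG] at hv0; exact hv0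
  set m : ℝ := inner ℝ u v0 with hm
  have hmpos : 0 < m := by
    obtain ⟨e, he, heK⟩ := small_mem h0 u
    have h1 := hv0'.2 _ heK
    rw [inner_smul_right] at h1
    have h2 : 0 < inner ℝ u u := real_inner_self_pos.2 hu0
    have : 0 < e * inner ℝ u u := by positivity
    linarith
  have hin : ∀ v, inner ℝ (m⁻¹ • u) v = m⁻¹ * inner ℝ u v := fun v => by
    rw [inner_smul_left]; simp
  have hGeq : G = {v ∈ K | inner ℝ (m⁻¹ • u) v = 1} := by
    rw [hG]; ext v
    constructor
    · rintro ⟨h1, h2⟩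
      have : inner ℝ u v = m := le_antisymm (hv0'.2 v h1) (h2 v0 hv0'.1)
      refine ⟨h1, ?_⟩
      rw [hin, this, inv_mul_cancel₀ hmpos.ne']
    · rintro ⟨h1, h2⟩
      refine ⟨h1, fun w hw => ?_⟩
      rw [hin, inv_mul_eq_one₀ hmpos.ne'] at h2
      rw [← h2]; exact hv0'.2 w hw
  refine ⟨m⁻¹ • u, ?_, hGeq⟩
  set a := m⁻¹ • u with ha
  have haP : a ∈ polarOf K := by
    intro v hv
    rw [hin, inv_mul_le_iff₀ hmpos, mul_one]
    exact hv0'.2 v hv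
  have hav0 : inner ℝ a v0 = 1 := by rw [hGeq] at hv0; exact hv0.2
  have hperp : ∀ b : V, (∀ v ∈ G, inner ℝ b v = 1) → b - a ∈ (vectorSpan ℝ G)ᗮ ∧ b ∈ (vectorSpan ℝ G)ᗮ := by
    have : ∀ b : V, (∃ c : ℝ, ∀ v ∈ G, inner ℝ b v = c) → b ∈ (vectorSpan ℝ G)ᗮ := by
      rintro b ⟨c, hb⟩
      rw [Submodule.mem_orthogonal]
      intro w hw
      rw [vectorSpan_def] at hw
      induction hw using Submodule.span_induction with
      | mem t ht =>
        obtain ⟨v, hv, w, hw, rfl⟩ := ht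
        rw [real_inner_comm]; simp [inner_sub_right, hb v hv, hb w hw]
      | zero => simp
      | add a b _ _ h1 h2 => rw [inner_add_left, h1, h2, add_zero]
      | smul c a _ h => rw [inner_smul_left, h, mul_zero]
    intro b hb
    refine ⟨this _ ⟨0, fun v hv => ?_⟩, this _ ⟨1, hb⟩⟩
    have hv2 := hv
    rw [hGeq] at hv2
    rw [inner_sub_left, hb v hv, hv2.2, sub_self]
  have ha0 : a ≠ 0 := by
    intro h; rw [h] at hav0; simp at hav0
  have haD := (hperp a (fun v hv => by rw [hGeq] at hv; exact hv.2)).2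
  have hone : Module.finrank ℝ (vectorSpan ℝ G)ᗮ = 1 := by
    have := Submodule.finrank_add_finrank_orthogonal (vectorSpan ℝ G)
    omega
  have huniq : ∀ b : V, (∀ v ∈ G, inner ℝ b v = 1) → b = a := by
    intro b hb
    have hbD := (hperp b hb).1
    obtain ⟨c, hc⟩ := (finrank_eq_one_iff_of_nonzero' (⟨a, haD⟩ : (vectorSpan ℝ G)ᗮ)
      (by simpa using ha0)).1 hone ⟨b - a, hbD⟩
    have hc' : c • a = b - a := congrArg Subtype.val hc
    have h1 := congrArg (fun w => inner ℝ w v0) hc'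
    simp only [inner_smul_left, inner_sub_left, hb v0 hv0, hav0] at h1
    simp at h1
    rw [h1, zero_smul] at hc'
    exact (sub_eq_zero.1 hc'.symm)
  rw [mem_extremePoints_iff_left]
  refine ⟨haP, fun b hb c hc hseg => huniq b fun v hv => ?_⟩
  obtain ⟨s, t, hs, ht, hst, hab⟩ := hseg
  have hvK : v ∈ K ∧ inner ℝ a v = 1 := by rw [hGeq] at hv; exact hv
  have h1 := hb v hvK.1
  have h2 := hc v hvK.1
  have h3 : s * inner ℝ b v + t * inner ℝ c v = 1 := by
    rw [← hvK.2, ← hab, inner_add_left, inner_smul_left, inner_smul_left]; simp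
  refine le_antisymm h1 ?_
  by_contra hlt
  push Not at hlt
  nlinarith
end Polar

section Transfer
variable {N : ℕ}

/-- the chart `v ↦ x0 + v` -/
noncomputable def chart (W : Submodule ℝ (Pt N)) (x0 : Pt N) : W →ᵃ[ℝ] Pt N :=
  W.subtype.toAffineMap + AffineMap.const ℝ W x0

lemma chart_apply (W : Submodule ℝ (Pt N)) (x0 : Pt N) (v : W) : chart W x0 v = (v : Pt N) + x0 := by
  simp [chart]

lemma chart_injective (W : Submodule ℝ (Pt N)) (x0 : Pt N) : Function.Injective (chart W x0) := by
  intro v w h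
  rw [chart_apply, chart_apply] at h
  exact Subtype.ext (add_right_cancel h)

lemma vectorSpan_chart (W : Submodule ℝ (Pt N)) (x0 : Pt N) (G : Set W) :
    vectorSpan ℝ (chart W x0 '' G) = (vectorSpan ℝ G).map W.subtype := by
  rw [← AffineMap.map_vectorSpan]
  congr 1
  simp [chart]

lemma faceDim_chart (W : Submodule ℝ (Pt N)) (x0 : Pt N) (G : Set W) (hG : G.Nonempty) :
    faceDim (chart W x0 '' G) = Module.finrank ℝ (vectorSpan ℝ G) := by
  rw [faceDim, if_neg (hG.image _).ne_empty, direction_affineSpan, vectorSpan_chart,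
    Submodule.finrank_map_subtype_eq]

lemma setup (Q : Set (Pt N)) (hQ : IsPolytope Q) (hne : Q.Nonempty) :
    ∃ (x0 : Pt N) (S : Set (vectorSpan ℝ Q)), S.Finite ∧ 0 ∈ interior (convexHull ℝ S) ∧
      Q = chart (vectorSpan ℝ Q) x0 '' convexHull ℝ S := by
  obtain ⟨S, hS, hQS⟩ := hQ
  obtain ⟨q0, hq0⟩ := hne
  set W := vectorSpan ℝ Q with hW
  have hSQ : S ⊆ Q := by rw [hQS]; exact subset_convexHull ℝ S
  set S1 : Set W := chart W q0 ⁻¹' S with hS1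
  have hS1f : S1.Finite := hS.preimage (chart_injective W q0).injOn
  have himg : chart W q0 '' S1 = S := by
    rw [hS1, Set.image_preimage_eq_iff]
    intro s hs
    refine ⟨⟨s - q0, vsub_mem_vectorSpan ℝ (hSQ hs) hq0⟩, ?_⟩
    rw [chart_apply]; simp
  have hK1 : chart W q0 '' convexHull ℝ S1 = Q := by
    rw [AffineMap.image_convexHull, himg, hQS]
  have hK1ne : (convexHull ℝ S1).Nonempty := by
    rw [← hK1] at hq0
    obtain ⟨v, hv, -⟩ := hq0
    exact ⟨v, hv⟩
  have hspan : affineSpan ℝ (convexHull ℝ S1) = ⊤ := by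
    rw [← AffineSubspace.direction_eq_top_iff_of_nonempty
      ((affineSpan_nonempty ℝ).2 hK1ne), direction_affineSpan]
    have h := vectorSpan_chart W q0 (convexHull ℝ S1)
    rw [hK1, ← hW] at h
    have h2 : (⊤ : Submodule ℝ W).map W.subtype = W := by simp
    exact Submodule.map_injective_of_injective W.injective_subtype (by rw [← h, h2])
  obtain ⟨v0, hv0⟩ := (convex_convexHull ℝ S1).interior_nonempty_iff_affineSpan_eq_top.2 hspan
  let τ : W →ᵃ[ℝ] W := AffineMap.id ℝ W + AffineMap.const ℝ W (-v0)
  have hτ : ∀ v, τ v = v + -v0 := fun v => by simp [τ]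
  have hτ' : (τ : W → W) = Homeomorph.addRight (-v0) := by ext v; simp [hτ]
  have hKτ : convexHull ℝ (τ '' S1) = τ '' convexHull ℝ S1 := (AffineMap.image_convexHull τ S1).symm
  refine ⟨(v0 : Pt N) + q0, τ '' S1, hS1f.image _, ?_, ?_⟩
  · rw [hKτ, hτ', ← Homeomorph.image_interior]
    exact ⟨v0, hv0, by simp⟩
  · rw [hKτ, Set.image_image, ← hK1]
    refine Set.image_congr fun v _ => ?_
    rw [chart_apply, chart_apply, hτ]
    simp only [Submodule.coe_add, Submodule.coe_neg]
    abel

lemma exposed_chart (W : Submodule ℝ (Pt N)) (x0 : Pt N) (K : Set W) (a : W)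
    (hle : ∀ v ∈ K, inner ℝ a v ≤ 1) :
    IsExposed ℝ (chart W x0 '' K) (chart W x0 '' {v ∈ K | inner ℝ a v = 1}) := by
  rintro ⟨_, v1, ⟨hv1, hv1'⟩, rfl⟩
  have hl : ∀ v : W, innerSL ℝ (a : Pt N) (chart W x0 v) = inner ℝ a v + inner ℝ (a : Pt N) x0 := by
    intro v
    rw [chart_apply, innerSL_apply_apply, inner_add_right, Submodule.coe_inner]
  refine ⟨innerSL ℝ (a : Pt N), ?_⟩
  ext x
  constructor
  · rintro ⟨v, ⟨hv, hv'⟩, rfl⟩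
    refine ⟨⟨v, hv, rfl⟩, ?_⟩
    rintro _ ⟨w, hw, rfl⟩
    rw [hl, hl, hv']
    linarith [hle w hw]
  · rintro ⟨⟨v, hv, rfl⟩, h⟩
    have := h _ ⟨v1, hv1, rfl⟩
    rw [hl, hl, hv1'] at this
    exact ⟨v, ⟨hv, le_antisymm (hle v hv) (by linarith)⟩, rfl⟩

lemma chain_of_reflTransGen {α : Type*} {R : α → α → Prop} {a b : α} (h : Relation.ReflTransGen R a b) :
    ∃ (m : ℕ) (c : ℕ → α), c 0 = a ∧ c m = b ∧ ∀ i < m, R (c i) (c (i + 1)) := by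
  induction h with
  | refl => exact ⟨0, fun _ => a, rfl, rfl, by simp⟩
  | tail _ hbc ih =>
    rename_i b e _
    obtain ⟨m, c, h0, hm, hc⟩ := ih
    refine ⟨m + 1, fun i => if i ≤ m then c i else e, by simp [h0], by simp, ?_⟩
    intro i hi
    rcases Nat.lt_succ_iff_lt_or_eq.1 hi with h | rfl
    · have h1 : i ≤ m := h.le
      have h2 : i + 1 ≤ m := h
      simp only [h1, h2, if_true]; exact hc i h
    · simp only [le_refl, if_true, Nat.not_succ_le_self, if_false, hm]; exact hbc

lemma case_one (Q F F' : Set (Pt N)) (hF : faceDim F = 0) (hF' : faceDim F' = 0) (hne : F ≠ F') :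
    F ∩ F' = ∅ := by
  have key : ∀ G : Set (Pt N), faceDim G = 0 → ∃ x, G = {x} := by
    intro G hG
    rw [faceDim] at hG
    split_ifs at hG with h
    · obtain ⟨x, hx⟩ := nonempty_iff_ne_empty.2 h
      have h0 : Module.finrank ℝ (vectorSpan ℝ G) = 0 := by
        rw [← direction_affineSpan]; exact_mod_cast hG
      rw [Submodule.finrank_eq_zero, vectorSpan_eq_bot_iff_subsingleton] at h0
      exact ⟨x, h0.eq_singleton_of_mem hx⟩
  obtain ⟨x, rfl⟩ := key F hF
  obtain ⟨y, rfl⟩ := key F' hF'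
  rw [Set.singleton_inter_eq_empty]
  rintro h
  exact hne (by rw [Set.mem_singleton_iff.1 h])

end Transfer

/-- (Dual Balinski.) In a `d`-polytope, after removing fewer
than `d` facets, the remaining facets are connected through ridges not contained
in any removed facet. -/
theorem facet_ridge_connectivity {N d : ℕ} (Q : Set (Pt N))
    (hQ : IsPolytope Q) (hd : faceDim Q = d)
    (B : Set (Set (Pt N))) (hBfacets : ∀ b ∈ B, IsKFaceOf (d - 1) Q b)
    (hBfin : B.Finite) (hBcard : B.ncard < d)
    (F F' : Set (Pt N)) (hF : IsKFaceOf (d - 1) Q F) (hF' : IsKFaceOf (d - 1) Q F')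
    (hFB : F ∉ B) (hF'B : F' ∉ B) :
    ∃ (m : ℕ) (c : Fin (m + 1) → Set (Pt N)),
      c 0 = F ∧ c (Fin.last m) = F' ∧
      (∀ i, IsKFaceOf (d - 1) Q (c i) ∧ c i ∉ B) ∧
      (∀ i : Fin m,
        IsFaceOf Q (c i.castSucc ∩ c i.succ) ∧
        faceDim (c i.castSucc ∩ c i.succ) = (d : ℤ) - 2 ∧
        ∀ b ∈ B, ¬ (c i.castSucc ∩ c i.succ) ⊆ b) := by
  have hd1 : 1 ≤ d := by omega
  rcases hd1.eq_or_lt with rfl | hd2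
  · have hB0 : B = ∅ := by
      rw [← Set.ncard_eq_zero hBfin]; omega
    subst hB0
    by_cases hne : F = F'
    · exact ⟨0, fun _ => F, rfl, hne, fun _ => ⟨hF, hFB⟩, fun i => i.elim0⟩
    · have hemp := case_one Q F F' (by simpa using hF.2) (by simpa using hF'.2) hne
      refine ⟨1, ![F, F'], rfl, rfl, ?_, ?_⟩
      · intro i
        fin_cases i
        · exact ⟨hF, hFB⟩
        · exact ⟨hF', hF'B⟩
      · intro i
        fin_cases i
        have : (![F, F'] (Fin.castSucc 0) ∩ ![F, F'] (Fin.succ 0) : Set (Pt N)) = ∅ := hemp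
        refine ⟨?_, ?_, by simp⟩
        · simp only [Fin.mk_zero, Fin.zero_eta, this]
          exact isExposed_empty
        · simp only [Fin.mk_zero, Fin.zero_eta, this]
          simp [faceDim]
  -- main case
  have hQne : Q.Nonempty := by
    rw [nonempty_iff_ne_empty]; rintro rfl
    simp [faceDim] at hd
  have hrank : Module.finrank ℝ (vectorSpan ℝ Q) = d := by
    rw [faceDim, if_neg hQne.ne_empty, direction_affineSpan] at hd
    exact_mod_cast hd
  obtain ⟨x0, S, hS, h0, hQK⟩ := setup Q hQ hQne
  obtain ⟨A, hAext, hirr, hpos, hmem⟩ := polar_facts hS h0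
  generalize hWdef : vectorSpan ℝ Q = W at *
  set K := convexHull ℝ S with hK
  have hle : ∀ a ∈ A, ∀ v ∈ K, inner ℝ a v ≤ 1 := fun a ha v hv => (hmem v).1 hv a ha
  let Fc : W → Set (Pt N) := fun a => chart W x0 '' {v ∈ K | inner ℝ a v = 1}
  have mem_Fc : ∀ a v, chart W x0 v ∈ Fc a ↔ v ∈ K ∧ inner ℝ a v = 1 := by
    intro a v
    exact (chart_injective W x0).mem_set_image
  -- orthogonal direction to a difference
  have two_le : ∀ a b : W, ∃ x : W, x ≠ 0 ∧ inner ℝ a x = inner ℝ b x := by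
    intro a b
    let L : W →ₗ[ℝ] ℝ := innerₛₗ ℝ (a - b)
    have hker : LinearMap.ker L ≠ ⊥ := by
      apply LinearMap.ker_ne_bot_of_finrank_lt
      rw [hrank, Module.finrank_self]; exact hd2
    obtain ⟨x, hx, hx0⟩ := Submodule.exists_mem_ne_zero_of_ne_bot hker
    refine ⟨x, hx0, ?_⟩
    have h : inner ℝ (a - b) x = 0 := LinearMap.mem_ker.1 hx
    rw [inner_sub_left] at h; linarith
  -- normalisation of witnesses
  have norm_wit : ∀ a ∈ A, ∀ b ∈ A, ∀ w : W, inner ℝ a w = inner ℝ b w →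
      (∀ c ∈ A, c ≠ a → c ≠ b → inner ℝ c w < inner ℝ a w) →
      ∃ x : W, inner ℝ a x = 1 ∧ inner ℝ b x = 1 ∧
        ∀ c ∈ A, c ≠ a → c ≠ b → inner ℝ c x < 1 := by
    intro a ha b hb w hab hlt
    have hw0 : w ≠ 0 := by
      rintro rfl
      have hAab : ∀ c ∈ A, c = a ∨ c = b := by
        intro c hc
        by_contra h
        push Not at h
        have := hlt c hc h.1 h.2
        simp at this
      obtain ⟨x, hx, hxab⟩ := two_le a b
      obtain ⟨c, hc, hc0⟩ := hpos x hx
      obtain ⟨c', hc', hc0'⟩ := hpos (-x) (neg_ne_zero.2 hx)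
      rw [inner_neg_right] at hc0'
      have e1 : inner ℝ c x = inner ℝ a x := by
        rcases hAab c hc with rfl | rfl
        · rfl
        · exact hxab.symm
      have e2 : inner ℝ c' x = inner ℝ a x := by
        rcases hAab c' hc' with rfl | rfl
        · rfl
        · exact hxab.symm
      linarith
    obtain ⟨k, hk, hk0⟩ := hpos w hw0
    have hpa : 0 < inner ℝ a w := by
      by_cases h1 : k = a
      · rwa [h1] at hk0
      by_cases h2 : k = b
      · rwa [h2, ← hab] at hk0
      exact hk0.trans (hlt k hk h1 h2)
    have e : ∀ (c : W) (r : ℝ), inner ℝ c (r • w) = r * inner ℝ c w :=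
      fun c r => real_inner_smul_right c w r
    refine ⟨(inner ℝ a w)⁻¹ • w, ?_, ?_, ?_⟩
    · rw [e, inv_mul_cancel₀ hpa.ne']
    · rw [e, ← hab, inv_mul_cancel₀ hpa.ne']
    · intro c hc h1 h2
      rw [e, inv_mul_lt_iff₀ hpa, mul_one]
      exact hlt c hc h1 h2
  have wit1 : ∀ a ∈ A, ∃ x : W, inner ℝ a x = 1 ∧ ∀ c ∈ A, c ≠ a → inner ℝ c x < 1 := by
    intro a ha
    obtain ⟨p, hp⟩ := hirr a ha
    obtain ⟨x, h1, -, h2⟩ := norm_wit a ha a ha p rfl (fun c hc h _ => hp c hc h)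
    exact ⟨x, h1, fun c hc h => h2 c hc h h⟩
  have ne0 : ∀ a x : W, inner ℝ a x = 1 → a ≠ 0 := by
    rintro a x h rfl
    simp at h
  have memK : ∀ x : W, (∀ c ∈ A, inner ℝ c x ≤ 1) → x ∈ K := fun x h => (hmem x).2 h
  have wit1K : ∀ a ∈ A, ∃ x : W, x ∈ K ∧ inner ℝ a x = 1 ∧ ∀ c ∈ A, c ≠ a → inner ℝ c x < 1 := by
    intro a ha
    obtain ⟨x, h1, h2⟩ := wit1 a ha
    refine ⟨x, memK x fun c hc => ?_, h1, h2⟩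
    by_cases h : c = a
    · rw [h, h1]
    · exact (h2 c hc h).le
  have Fc_exposed : ∀ a ∈ A, IsExposed ℝ Q (Fc a) := by
    intro a ha
    have := exposed_chart W x0 K a (hle a ha)
    rwa [← hQK] at this
  have Fc_facet : ∀ a ∈ A, IsKFaceOf (d - 1) Q (Fc a) := by
    intro a ha
    refine ⟨Fc_exposed a ha, ?_⟩
    obtain ⟨x, hxK, h1, h2⟩ := wit1K a ha
    have hG : ({v ∈ K | inner ℝ a v = 1} : Set W).Nonempty := ⟨x, hxK, h1⟩
    have hv := vectorSpan_face hmem {a} (x := x) (by simpa using h1) (by simpa using h2)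
    have hset : {v ∈ K | ∀ t ∈ ({a} : Set W), inner ℝ t v = 1} = {v ∈ K | inner ℝ a v = 1} := by
      simp
    rw [hset] at hv
    have hf := finrank_orth ({a} : Set W)
    rw [finrank_span_singleton (ne0 a x h1), hrank] at hf
    rw [faceDim_chart W x0 _ hG, hv]
    congr 1
    omega
  have Fc_inj : ∀ a ∈ A, ∀ b ∈ A, Fc a ⊆ Fc b → a = b := by
    intro a ha b hb hab
    obtain ⟨x, hxK, h1, h2⟩ := wit1K a ha
    have := (mem_Fc b x).1 (hab ((mem_Fc a x).2 ⟨hxK, h1⟩))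
    by_contra hne
    have h3 := h2 b hb (Ne.symm hne)
    linarith [this.2]
  have Fc_surj : ∀ G : Set (Pt N), IsKFaceOf (d - 1) Q G → ∃ a ∈ A, G = Fc a := by
    rintro G ⟨hGexp, hGdim⟩
    have hGne : G.Nonempty := by
      rw [nonempty_iff_ne_empty]; rintro rfl
      simp [faceDim] at hGdim
    obtain ⟨l, hl⟩ := hGexp hGne
    obtain ⟨u, hu⟩ := riesz (l.comp W.subtypeL)
    have hlu : ∀ v : W, l (chart W x0 v) = inner ℝ u v + l x0 := by
      intro v
      rw [chart_apply, map_add, ← hu]; rfl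
    set G' : Set W := {v ∈ K | ∀ w ∈ K, inner ℝ u w ≤ inner ℝ u v} with hG'
    have hGG' : G = chart W x0 '' G' := by
      rw [hl]
      ext x
      constructor
      · rintro ⟨hx, hmax⟩
        rw [hQK] at hx
        obtain ⟨v, hv, rfl⟩ := hx
        refine ⟨v, ⟨hv, fun w hw => ?_⟩, rfl⟩
        have := hmax (chart W x0 w) (by rw [hQK]; exact ⟨w, hw, rfl⟩)
        rw [hlu, hlu] at this
        linarith
      · rintro ⟨v, ⟨hv, hmax⟩, rfl⟩
        refine ⟨by rw [hQK]; exact ⟨v, hv, rfl⟩, fun y hy => ?_⟩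
        rw [hQK] at hy
        obtain ⟨w, hw, rfl⟩ := hy
        rw [hlu, hlu]
        linarith [hmax w hw]
    have hG'ne : G'.Nonempty := by
      rw [hGG'] at hGne; exact hGne.of_image
    rw [hGG', faceDim_chart W x0 _ hG'ne] at hGdim
    obtain ⟨a, ha, haG⟩ := facet_extreme h0 u hG' hG'ne (by rw [hrank]; omega)
    exact ⟨a, (hAext a).2 ha, by rw [hGG', haG]⟩
  -- ridges
  have ridge : ∀ a ∈ A, ∀ b ∈ A, AdjAt A a b → IsFaceOf Q (Fc a ∩ Fc b) ∧
      faceDim (Fc a ∩ Fc b) = (d : ℤ) - 2 ∧ ∀ c ∈ A, c ≠ a → c ≠ b → ¬ (Fc a ∩ Fc b ⊆ Fc c) := by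
    rintro a ha b hb ⟨hne, w, hw, hlt⟩
    obtain ⟨x, hxa, hxb, hxc⟩ := norm_wit a ha b hb w hw hlt
    have hxK : x ∈ K := memK x fun c hc => by
      by_cases h1 : c = a
      · rw [h1, hxa]
      by_cases h2 : c = b
      · rw [h2, hxb]
      exact (hxc c hc h1 h2).le
    refine ⟨IsExposed.inter (Fc_exposed a ha) (Fc_exposed b hb), ?_, ?_⟩
    · have hset : Fc a ∩ Fc b = chart W x0 '' {v ∈ K | ∀ t ∈ ({a, b} : Set W), inner ℝ t v = 1} := by
        rw [← Set.image_inter (chart_injective W x0)]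
        congr 1
        ext v
        constructor
        · rintro ⟨h1, h2⟩
          refine ⟨h1.1, ?_⟩
          rintro t (rfl | rfl)
          · exact h1.2
          · exact h2.2
        · rintro ⟨h1, h2⟩
          exact ⟨⟨h1, h2 a (by simp)⟩, ⟨h1, h2 b (by simp)⟩⟩
      have hT : ∀ t ∈ ({a, b} : Set W), inner ℝ t x = 1 := by
        rintro t (rfl | rfl)
        · exact hxa
        · exact hxb
      have hv := vectorSpan_face hmem {a, b} hT (by
        intro c hc hcab
        simp only [Set.mem_insert_iff, Set.mem_singleton_iff, not_or] at hcab
        exact hxc c hc hcab.1 hcab.2)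
      have hne2 : ({v ∈ K | ∀ t ∈ ({a, b} : Set W), inner ℝ t v = 1} : Set W).Nonempty :=
        ⟨x, hxK, hT⟩
      rw [hset, faceDim_chart W x0 _ hne2, hv]
      have hind : LinearIndependent ℝ ![a, b] := by
        rw [LinearIndependent.pair_iff' (ne0 a x hxa)]
        intro c hc
        have := congrArg (fun v => inner ℝ v x) hc
        simp only [inner_smul_left, hxa, hxb] at this
        simp at this
        rw [this, one_smul] at hc
        exact hne hc
      have hr := finrank_span_eq_card hind
      have hrange : Set.range ![a, b] = {a, b} := by
        simp [Matrix.range_cons, Set.pair_comm]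
      rw [hrange, Fintype.card_fin] at hr
      have hf := finrank_orth ({a, b} : Set W)
      rw [hr, hrank] at hf
      omega
    · intro c hc h1 h2 hsub
      have := (mem_Fc c x).1 (hsub ⟨(mem_Fc a x).2 ⟨hxK, hxa⟩, (mem_Fc b x).2 ⟨hxK, hxb⟩⟩)
      have h3 := hxc c hc h1 h2
      linarith [this.2]
  obtain ⟨a, ha, rfl⟩ := Fc_surj F hF
  obtain ⟨a', ha', rfl⟩ := Fc_surj F' hF'
  set B' : Finset W := A.filter (fun c => Fc c ∈ B) with hB'
  have hB'card : B'.card < Module.finrank ℝ W := by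
    rw [hrank]
    refine lt_of_le_of_lt ?_ hBcard
    rw [← Set.ncard_coe_finset]
    refine Set.ncard_le_ncard_of_injOn Fc (fun c hc => (Finset.mem_filter.1 hc).2) ?_ hBfin
    intro c hc e he hce
    exact Fc_inj c (Finset.mem_filter.1 hc).1 e (Finset.mem_filter.1 he).1 hce.subset
  have hconn := core hirr hpos B' hB'card ha ha' (fun h => hFB (Finset.mem_filter.1 h).2)
    (fun h => hF'B (Finset.mem_filter.1 h).2)
  obtain ⟨m, c, hc0, hcm, hc⟩ := chain_of_reflTransGen hconn
  have hcmem : ∀ i ≤ m, c i ∈ A ∧ c i ∉ B' := by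
    intro i hi
    rcases hi.lt_or_eq with h | rfl
    · exact (hc i h).1
    · rw [hcm]; exact ⟨ha', fun h => hF'B (Finset.mem_filter.1 h).2⟩
  refine ⟨m, fun i => Fc (c i), by simp [hc0], by simp [hcm], ?_, ?_⟩
  · intro i
    have := hcmem i (by omega)
    exact ⟨Fc_facet _ this.1, fun h => this.2 (Finset.mem_filter.2 ⟨this.1, h⟩)⟩
  · intro i
    obtain ⟨h1, h2, h3⟩ := hc i i.2
    obtain ⟨r1, r2, r3⟩ := ridge _ h1.1 _ h2.1 h3
    simp only [Fin.val_castSucc, Fin.val_succ]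
    refine ⟨r1, r2, fun b hb => ?_⟩
    obtain ⟨e, he, rfl⟩ := Fc_surj b (hBfacets b hb)
    have heB : e ∈ B' := Finset.mem_filter.2 ⟨he, hb⟩
    exact r3 e he (fun h => h1.2 (h ▸ heB)) (fun h => h2.2 (h ▸ heB))
end
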